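/- arXiv:1111.3061 — 4 statements merged into one kernel-verified Lean document; each statement's English description precedes it below -/
import Mathlib

section
/- For all n and k with n − k odd, the Hultman number satisfies (n+1)(n+2)·H(n,k) = 2·S(n+2,k), where S(m,k) denotes the unsigned Stirling number of the first kind, i.e., the number of permutations of Fin m whose disjoint cycle decomposition (counting fixed points as cycles of length 1) consists of exactly k cycles. For n − k even, H(n,k) = 0. -/
/-- The permutation of `ZMod (n+1)` fixing `0` and acting as `π` on `{1,…,n}`
(the element `i+1` of `ZMod (n+1)` corresponding to `i : Fin n`). -/
def pihat {n : ℕ} (π : Equiv.Perm (Fin n)) : Equiv.Perm (ZMod (n+1)) :=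
  Equiv.Perm.decomposeFin.symm (0, π)

/-- The permutation `v ↦ π̂ (π̂⁻¹ (v+1) - 1)` of `ZMod (n+1)`, whose orbits are the
alternating cycles of the cycle graph of `π`. -/
def cpi {n : ℕ} (π : Equiv.Perm (Fin n)) : Equiv.Perm (ZMod (n+1)) :=
  (Equiv.addRight (1 : ZMod (n+1))).trans
    ((pihat π).symm.trans ((Equiv.subRight (1 : ZMod (n+1))).trans (pihat π)))

/-- `A n π` is the number of alternating cycles of the cycle graph of `π`: the number of
orbits of the cyclic group generated by `cpi π` acting on `ZMod (n+1)`. -/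
noncomputable def A (n : ℕ) (π : Equiv.Perm (Fin n)) : ℕ :=
  Nat.card (MulAction.orbitRel.Quotient (Subgroup.zpowers (cpi π)) (ZMod (n+1)))

/-- The Hultman number `H n k`: the number of permutations of `Fin n` whose cycle graph
has exactly `k` alternating cycles. -/
noncomputable def H (n k : ℕ) : ℕ := Nat.card {π : Equiv.Perm (Fin n) // A n π = k}

/-- The unsigned Stirling number of the first kind `S m k`: the number of permutations of
`Fin m` whose disjoint cycle decomposition (counting fixed points as cycles of length 1)
consists of exactly `k` cycles, i.e. whose number of orbits on `Fin m` equals `k`. -/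
noncomputable def S (m k : ℕ) : ℕ :=
  Nat.card {σ : Equiv.Perm (Fin m) //
    Nat.card (MulAction.orbitRel.Quotient (Subgroup.zpowers σ) (Fin m)) = k}

open Equiv Equiv.Perm Finset Polynomial

noncomputable def cyc {α : Type*} (σ : Equiv.Perm α) : ℕ :=
  Nat.card (MulAction.orbitRel.Quotient (Subgroup.zpowers σ) α)

theorem inv_zpow_aux {α β : Type*} (σ : Equiv.Perm α) (f : α → β) (h : ∀ x, f (σ x) = f x) (i : ℤ) :
    ∀ x, f ((σ ^ i) x) = f x := by
  induction i using Int.induction_on with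
  | zero => simp
  | succ n ih => intro x; rw [zpow_add_one, Perm.mul_apply, ih, h]
  | pred n ih =>
    intro x
    rw [zpow_sub_one, Perm.mul_apply, ih]
    conv_rhs => rw [show x = σ (σ⁻¹ x) by simp, h]

theorem two_pow_cyc {α : Type*} [Finite α] (σ : Equiv.Perm α) :
    Nat.card {f : α → Bool // ∀ x, f (σ x) = f x} = 2 ^ cyc σ := by
  have e : {f : α → Bool // ∀ x, f (σ x) = f x} ≃
      (MulAction.orbitRel.Quotient (Subgroup.zpowers σ) α → Bool) :=
    { toFun := fun f q => Quotient.liftOn' q f.1 (by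
        intro a b hab
        obtain ⟨⟨g, i, rfl⟩, rfl⟩ := hab
        exact inv_zpow_aux σ f.1 f.2 i b)
      invFun := fun g => ⟨fun x => g (Quotient.mk'' x), fun x => by
        apply congrArg g
        apply Quotient.sound'
        exact ⟨⟨σ, Subgroup.mem_zpowers σ⟩, rfl⟩⟩
      left_inv := fun f => by ext x; rfl
      right_inv := fun g => by
        ext q
        induction q using Quotient.inductionOn' with
        | h x => rfl }
  rw [Nat.card_congr e, Nat.card_fun, Nat.card_eq_fintype_card, Fintype.card_bool, cyc]

theorem cyc_conj {α : Type*} [Finite α] (σ g : Equiv.Perm α) : cyc (g * σ * g⁻¹) = cyc σ := by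
  apply Nat.pow_right_injective (le_refl 2)
  show 2 ^ _ = 2 ^ _
  rw [← two_pow_cyc, ← two_pow_cyc]
  refine Nat.card_congr
    { toFun := fun f => ⟨fun x => f.1 (g x), fun x => ?_⟩
      invFun := fun f => ⟨fun x => f.1 (g⁻¹ x), fun x => ?_⟩
      left_inv := fun f => ?_
      right_inv := fun f => ?_ }
  · have := f.2 (g x)
    simpa using this
  · have := f.2 (g⁻¹ x)
    simpa using this
  · ext x; simp
  · ext x; simp

theorem cyc_swap {α : Type*} [Finite α] [DecidableEq α] (σ : Equiv.Perm α) (y v : α) (hv : σ v = v)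
    (hy : y ≠ v) : cyc (σ * swap y v) + 1 = cyc σ := by
  apply Nat.pow_right_injective (le_refl 2)
  show 2 ^ _ = 2 ^ _
  rw [pow_succ, ← two_pow_cyc, ← two_pow_cyc]
  have h2 : (2 : ℕ) = Nat.card Bool := by simp
  rw [h2, ← Nat.card_prod]
  have hne : ∀ x, x ≠ v → σ x ≠ v := fun x hx h => hx (σ.injective (h.trans hv.symm))
  symm
  refine Nat.card_congr
    { toFun := fun f => (⟨Function.update f.1 v (f.1 y), fun x => ?_⟩, f.1 v)
      invFun := fun p => ⟨Function.update p.1.1 v p.2, fun x => ?_⟩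
      left_inv := fun f => ?_
      right_inv := fun p => ?_ }
  · have h := f.2
    rw [Perm.mul_apply]
    by_cases h1 : x = v
    · subst h1
      rw [swap_apply_right, Function.update_of_ne (hne y hy), Function.update_self, h]
    · by_cases h3 : x = y
      · subst h3
        rw [swap_apply_left, hv, Function.update_self, Function.update_of_ne h1]
      · rw [swap_apply_of_ne_of_ne h3 h1, Function.update_of_ne (hne x h1),
          Function.update_of_ne h1, h]
  · obtain ⟨⟨g, hg⟩, b⟩ := p
    have e1 : g (σ y) = g v := by simpa using hg v
    have e2 : g v = g y := by simpa [hv] using hg y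
    by_cases h1 : x = v
    · subst h1; rw [hv]
    · simp only [Function.update_of_ne h1, Function.update_of_ne (hne x h1)]
      by_cases h3 : x = y
      · subst h3; rw [e1, e2]
      · have := hg x
        rwa [Perm.mul_apply, swap_apply_of_ne_of_ne h3 h1] at this
  · ext x
    simp
  · obtain ⟨⟨g, hg⟩, b⟩ := p
    have e2 : g v = g y := by simpa [hv] using hg y
    ext x
    · by_cases h1 : x = v
      · subst h1; simp [hy, e2]
      · simp [h1]
    · simp

theorem cyc_le {α : Type*} [Fintype α] (σ : Equiv.Perm α) : cyc σ ≤ Fintype.card α := by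
  rw [← Nat.card_eq_fintype_card]
  exact Nat.card_le_card_of_surjective _ Quotient.mk''_surjective

noncomputable def dd {α : Type*} [Fintype α] (σ : Equiv.Perm α) : ℕ := Fintype.card α - cyc σ

theorem dd_swap {α : Type*} [Fintype α] [DecidableEq α] (σ : Equiv.Perm α) (y v : α) (hv : σ v = v)
    (hy : y ≠ v) : dd (σ * swap y v) = dd σ + 1 := by
  have := cyc_swap σ y v hv hy
  have := cyc_le σ
  unfold dd
  omega

theorem dd_conj {α : Type*} [Fintype α] (σ g : Equiv.Perm α) : dd (g * σ * g⁻¹) = dd σ := by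
  unfold dd; rw [cyc_conj]

theorem dd_one {α : Type*} [Fintype α] : dd (1 : Equiv.Perm α) = 0 := by
  have : cyc (1 : Equiv.Perm α) = Fintype.card α := by
    apply Nat.pow_right_injective (le_refl 2)
    show 2 ^ _ = 2 ^ _
    rw [← two_pow_cyc]
    simp [Nat.card_fun]
  unfold dd; omega

/-- weighted sum over the permutations satisfying `T` that fix `V` pointwise -/
noncomputable def Y {α : Type*} [Fintype α] [DecidableEq α] (T : Equiv.Perm α → Prop)
    (w : Equiv.Perm α → ℤ[X]) (V : Finset α) : ℤ[X] := by
  classical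
  exact ∑ σ : Equiv.Perm α with T σ ∧ ∀ x ∈ V, σ x = x, w σ * X ^ dd σ

theorem Y_strip {α : Type*} [Fintype α] [DecidableEq α] (T : Equiv.Perm α → Prop)
    (w : Equiv.Perm α → ℤ[X]) (K K' V : Finset α) (η : ℤ)
    (hK : ∀ σ, T σ → ∀ x, x ∈ K ↔ σ x ∈ K')
    (hT : ∀ σ, ∀ y ∈ K, ∀ v ∈ K, T σ → T (σ * swap y v))
    (hw : ∀ σ, ∀ y ∈ K, ∀ v ∈ K, y ≠ v → T σ → w (σ * swap y v) = η * w σ)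
    (v : α) (hv : v ∈ K) (hv' : v ∈ K') (hvV : v ∉ V) :
    Y T w V = (1 + (η : ℤ[X]) * (((K \ V).card - 1 : ℕ) : ℤ[X]) * X) * Y T w (insert v V) := by
  classical
  have hvKV : v ∈ K \ V := by simp [hv, hvV]
  have key : Y T w V = ∑ p ∈ (K \ V) ×ˢ
      ({σ : Equiv.Perm α | T σ ∧ ∀ x ∈ insert v V, σ x = x} : Finset _),
      w (p.2 * swap p.1 v) * X ^ dd (p.2 * swap p.1 v) := by
    unfold Y
    symm
    refine Finset.sum_bij' (fun p _ => p.2 * swap p.1 v)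
      (fun σ _ => (σ⁻¹ v, σ * swap (σ⁻¹ v) v)) ?_ ?_ ?_ ?_ ?_
    · rintro ⟨y, σ⟩ hp
      simp only [mem_product, mem_sdiff, mem_filter, mem_univ, true_and, mem_insert,
        forall_eq_or_imp] at hp ⊢
      obtain ⟨⟨hy, hyV⟩, hTs, hfv, hfV⟩ := hp
      refine ⟨hT σ y hy v hv hTs, fun x hx => ?_⟩
      rw [Perm.mul_apply, swap_apply_of_ne_of_ne, hfV x hx]
      · rintro rfl; exact hyV hx
      · rintro rfl; exact hvV hx
    · intro σ hσ
      simp only [mem_product, mem_sdiff, mem_filter, mem_univ, true_and, mem_insert,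
        forall_eq_or_imp] at hσ ⊢
      obtain ⟨hTs, hfV⟩ := hσ
      have h1 : σ⁻¹ v ∈ K := by rw [hK σ hTs]; simpa using hv'
      have h2 : σ⁻¹ v ∉ V := by
        intro h
        have := hfV _ h
        rw [show σ (σ⁻¹ v) = v by simp] at this
        rw [← this] at h
        exact hvV h
      refine ⟨⟨h1, h2⟩, hT σ _ h1 v hv hTs, by simp, fun x hx => ?_⟩
      rw [Perm.mul_apply, swap_apply_of_ne_of_ne, hfV x hx]
      · rintro rfl; exact h2 hx
      · rintro rfl; exact hvV hx
    · rintro ⟨y, σ⟩ hp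
      simp only [mem_product, mem_sdiff, mem_filter, mem_univ, true_and, mem_insert,
        forall_eq_or_imp] at hp
      obtain ⟨⟨hy, hyV⟩, hTs, hfv, hfV⟩ := hp
      have h3 : σ⁻¹ v = v := by rw [Perm.inv_eq_iff_eq, hfv]
      have : (σ * swap y v)⁻¹ v = y := by
        rw [mul_inv_rev, Perm.mul_apply, h3, swap_inv, swap_apply_right]
      simp only [this, mul_assoc, swap_mul_self, mul_one]
    · intro σ hσ
      simp [mul_assoc]
    · rintro ⟨y, σ⟩ hp
      rfl
  rw [key, Finset.sum_product, ← Finset.add_sum_erase _ _ hvKV]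
  have h1 : ∀ y ∈ (K \ V).erase v, (∑ σ ∈
      ({σ : Equiv.Perm α | T σ ∧ ∀ x ∈ insert v V, σ x = x} : Finset _),
      w (σ * swap y v) * X ^ dd (σ * swap y v)) = (η : ℤ[X]) * X * Y T w (insert v V) := by
    intro y hy
    simp only [mem_erase, mem_sdiff] at hy
    unfold Y
    rw [Finset.mul_sum]
    refine Finset.sum_congr rfl fun σ hσ => ?_
    simp only [mem_filter, mem_univ, true_and, mem_insert, forall_eq_or_imp] at hσ
    rw [hw σ y hy.2.1 v hv hy.1 hσ.1, dd_swap σ y v hσ.2.1 hy.1]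
    ring
  rw [Finset.sum_congr rfl h1, Finset.sum_const, Finset.card_erase_of_mem hvKV]
  have h2 : (∑ σ ∈ ({σ : Equiv.Perm α | T σ ∧ ∀ x ∈ insert v V, σ x = x} : Finset _),
      w (σ * swap v v) * X ^ dd (σ * swap v v)) = Y T w (insert v V) := by
    unfold Y
    refine Finset.sum_congr rfl fun σ hσ => ?_
    rw [swap_self]; rfl
  simp only [] at h2 ⊢
  rw [h2, nsmul_eq_mul]
  push_cast
  ring

theorem Y_strip_many {α : Type*} [Fintype α] [DecidableEq α] (T : Equiv.Perm α → Prop)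
    (w : Equiv.Perm α → ℤ[X]) (K K' : Finset α) (η : ℤ)
    (hK : ∀ σ, T σ → ∀ x, x ∈ K ↔ σ x ∈ K')
    (hT : ∀ σ, ∀ y ∈ K, ∀ v ∈ K, T σ → T (σ * swap y v))
    (hw : ∀ σ, ∀ y ∈ K, ∀ v ∈ K, y ≠ v → T σ → w (σ * swap y v) = η * w σ)
    (L : Finset α) (a : ℕ) : ∀ (V : Finset α), L ⊆ K → L ⊆ K' → Disjoint L V →
      (K \ V).card = a + L.card →
    Y T w V = (∏ j ∈ range L.card, (1 + (η : ℤ[X]) * ((a + j : ℕ) : ℤ[X]) * X)) * Y T w (L ∪ V) := by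
  induction L using Finset.induction_on with
  | empty => intro V _ _ _ _; simp
  | insert v L hvL ih =>
    intro V h1 h2 h3 h4
    rw [Finset.insert_subset_iff] at h1 h2
    rw [Finset.disjoint_insert_left] at h3
    rw [Finset.card_insert_of_notMem hvL] at h4 ⊢
    rw [Y_strip T w K K' V η hK hT hw v h1.1 h2.1 h3.1, ih (insert v V) h1.2 h2.2,
      Finset.prod_range_succ, h4]
    · rw [Finset.union_insert, Finset.insert_union]
      simp only [← Nat.add_assoc, Nat.add_sub_cancel]
      ring
    · rw [Finset.disjoint_insert_right]; exact ⟨hvL, h3.2⟩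
    · rw [Finset.sdiff_insert, Finset.card_erase_of_mem (by simp [h1.1, h3.1])]
      omega

theorem stirling_poly (m : ℕ) : ∑ σ : Equiv.Perm (Fin m), (X : ℤ[X]) ^ dd σ =
    ∏ j ∈ range m, (1 + (j : ℤ[X]) * X) := by
  have := Y_strip_many (α := Fin m) (fun _ => True) (fun _ => 1) univ univ 1 (by simp)
    (by simp) (by simp) univ 0 ∅ (by simp) (by simp) (by simp) (by simp)
  have h0 : Y (α := Fin m) (fun _ => True) (fun _ => 1) ∅ = ∑ σ : Equiv.Perm (Fin m), X ^ dd σ := by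
    unfold Y; simp
  have h1 : Y (α := Fin m) (fun _ => True) (fun _ => 1) (univ ∪ ∅) = 1 := by
    unfold Y
    rw [Finset.sum_eq_single 1]
    · simp [dd_one]
    · intro b hb hb1
      simp at hb
      exact absurd (Equiv.ext hb) hb1
    · simp
  rw [← h0, this, h1]
  simp

def Pres {α : Type*} (τ : Equiv.Perm α) (I : Finset α) : Prop := ∀ x, x ∈ I ↔ τ x ∈ I

noncomputable def res {α : Type*} [DecidableEq α] (τ : Equiv.Perm α) (I : Finset α) : Equiv.Perm α :=
  haveI := Classical.dec (Pres τ I)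
  if h : Pres τ I then ofSubtype (τ.subtypePerm (fun x => (h x).symm)) else 1

theorem res_apply {α : Type*} [DecidableEq α] {τ : Equiv.Perm α} {I : Finset α} (h : Pres τ I)
    (x : α) : res τ I x = if x ∈ I then τ x else x := by
  unfold res
  rw [dif_pos h]
  split_ifs with hx
  · rw [ofSubtype_apply_of_mem _ hx]; rfl
  · rw [ofSubtype_apply_of_not_mem _ hx]

noncomputable def ww {α : Type*} [Fintype α] [DecidableEq α] (τ : Equiv.Perm α) (I : Finset α) : ℤ :=
  (-1) ^ I.card * (sign (res τ I) : ℤ)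

theorem pres_zpow {α : Type*} {τ : Equiv.Perm α} {I : Finset α} (h : Pres τ I) {x y : α}
    (hxy : SameCycle τ x y) : x ∈ I ↔ y ∈ I := by
  obtain ⟨i, rfl⟩ := hxy
  have := inv_zpow_aux τ (fun x => x ∈ I) (fun x => by simp [← h x]) i x
  simp only [eq_iff_iff] at this
  exact this.symm

theorem pres_swap_mem {α : Type*} [DecidableEq α] {τ : Equiv.Perm α} {I : Finset α} (h : Pres τ I)
    {y v : α} (hyv : y ∈ I ↔ v ∈ I) : Pres (τ * swap y v) I := by
  intro x
  rw [Perm.mul_apply, ← h]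
  by_cases h1 : x = y
  · subst h1; rw [swap_apply_left, hyv]
  · by_cases h2 : x = v
    · subst h2; rw [swap_apply_right, hyv]
    · rw [swap_apply_of_ne_of_ne h1 h2]

theorem pres_swap_mul {α : Type*} [DecidableEq α] {τ : Equiv.Perm α} {I : Finset α} (h : Pres τ I)
    {y v : α} (hyv : y ∈ I ↔ v ∈ I) : Pres (swap y v * τ) I := by
  intro x
  rw [Perm.mul_apply, h]
  generalize τ x = x
  by_cases h1 : x = y
  · subst h1; rw [swap_apply_left, hyv]
  · by_cases h2 : x = v
    · subst h2; rw [swap_apply_right, hyv]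
    · rw [swap_apply_of_ne_of_ne h1 h2]

theorem ww_swap_in {α : Type*} [Fintype α] [DecidableEq α] {τ : Equiv.Perm α} {I : Finset α}
    (h : Pres τ I) {y v : α} (hy : y ∈ I) (hv : v ∈ I) (hyv : y ≠ v) :
    ww (τ * swap y v) I = - ww τ I := by
  have : res (τ * swap y v) I = res τ I * swap y v := by
    ext x
    rw [res_apply (pres_swap_mem h (by simp [hy, hv])), Perm.mul_apply, Perm.mul_apply, res_apply h]
    by_cases h1 : x = y
    · subst h1; simp [hy, hv]
    · by_cases h2 : x = v
      · subst h2; simp [hy, hv]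
      · simp [swap_apply_of_ne_of_ne h1 h2]
  unfold ww
  rw [this, Perm.sign_mul, sign_swap hyv]
  simp

theorem ww_swap_out {α : Type*} [Fintype α] [DecidableEq α] {τ : Equiv.Perm α} {I : Finset α}
    (h : Pres τ I) {y v : α} (hy : y ∉ I) (hv : v ∉ I) :
    ww (τ * swap y v) I = ww τ I := by
  have : res (τ * swap y v) I = res τ I := by
    ext x
    rw [res_apply (pres_swap_mem h (by simp [hy, hv])), Perm.mul_apply, res_apply h]
    by_cases h1 : x = y
    · subst h1; simp [hy]
    · by_cases h2 : x = v
      · subst h2; simp [hv]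
      · simp [swap_apply_of_ne_of_ne h1 h2]
  unfold ww
  rw [this]

theorem ww_swap_mul_out {α : Type*} [Fintype α] [DecidableEq α] {τ : Equiv.Perm α} {I : Finset α}
    (h : Pres τ I) {y v : α} (hy : y ∉ I) (hv : v ∉ I) :
    ww (swap y v * τ) I = ww τ I := by
  have : res (swap y v * τ) I = res τ I := by
    ext x
    rw [res_apply (pres_swap_mul h (by simp [hy, hv])), Perm.mul_apply, res_apply h]
    by_cases h1 : x ∈ I
    · have h2 := (h x).1 h1
      rw [swap_apply_of_ne_of_ne]
      · rintro rfl; exact hy h2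
      · rintro rfl; exact hv h2
    · simp [h1]
  unfold ww
  rw [this]

theorem ww_empty {α : Type*} [Fintype α] [DecidableEq α] (τ : Equiv.Perm α) : ww τ ∅ = 1 := by
  have : res τ ∅ = 1 := by
    ext x
    rw [res_apply (by intro x; simp)]; simp
  simp [ww, this]

open Classical in
theorem ww_union {α : Type*} [Fintype α] [DecidableEq α] {τ : Equiv.Perm α} {I : Finset α}
    (h : Pres τ I) {x : α} (hx : x ∉ I) :
    Pres τ (I ∪ ({y | SameCycle τ x y} : Finset α)) ∧
    Disjoint I ({y | SameCycle τ x y} : Finset α) ∧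
    ww τ (I ∪ ({y | SameCycle τ x y} : Finset α)) = - ww τ I := by
  set Cx : Finset α := {y | SameCycle τ x y} with hC
  have hmem : ∀ y, y ∈ Cx ↔ SameCycle τ x y := by intro y; simp [hC]
  have hP : Pres τ (I ∪ Cx) := by
    intro y
    rw [mem_union, mem_union, hmem, hmem, ← h, sameCycle_apply_right]
  have hD : Disjoint I Cx := by
    rw [Finset.disjoint_left]
    intro y hy hy'
    exact hx ((pres_zpow h ((hmem y).1 hy')).2 hy)
  refine ⟨hP, hD, ?_⟩
  have h1 : res τ (I ∪ Cx) = res τ I * cycleOf τ x := by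
    ext y
    rw [res_apply hP, Perm.mul_apply, res_apply h, cycleOf_apply]
    by_cases hy : SameCycle τ x y
    · have h2 : y ∉ I := fun h3 => hx ((pres_zpow h hy).2 h3)
      simp [hmem, hy, ← h y, h2]
    · simp [hmem, hy]
  have h2 : (-1 : ℤ) ^ Cx.card * (sign (cycleOf τ x) : ℤ) = -1 := by
    by_cases hτ : τ x = x
    · have : Cx = {x} := by
        ext y
        rw [hmem, mem_singleton]
        constructor
        · intro hy; exact (SameCycle.eq_of_left hy hτ).symm
        · rintro rfl; exact SameCycle.refl _ _
      rw [this, (cycleOf_eq_one_iff τ).2 hτ]; simp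
    · have : (cycleOf τ x).support = Cx := by
        ext y
        rw [mem_support_cycleOf_iff, hmem, mem_support]
        simp [hτ]
      rw [(isCycle_cycleOf τ hτ).sign, this]
      push_cast
      rw [mul_neg, ← mul_pow]; simp
  unfold ww
  rw [h1, Perm.sign_mul, card_union_of_disjoint hD, pow_add]
  push_cast
  linear_combination (-1 : ℤ) ^ I.card * (sign (res τ I) : ℤ) * h2

open Classical in
theorem sieve {α : Type*} [Fintype α] [DecidableEq α] (τ : Equiv.Perm α) (x0 : α) :
    ∑ I : Finset α with x0 ∉ I ∧ Pres τ I, ww τ I = if ∀ x, SameCycle τ x0 x then 1 else 0 := by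
  split_ifs with hl
  · rw [Finset.sum_eq_single ∅]
    · exact ww_empty τ
    · intro I hI hne
      simp only [mem_filter, mem_univ, true_and] at hI
      exfalso
      apply hne
      ext x
      simp [← pres_zpow hI.2 (hl x), hI.1]
    · intro h
      exfalso; apply h
      rw [mem_filter]
      exact ⟨mem_univ _, by simp, by intro x; simp⟩
  · push Not at hl
    obtain ⟨x, hx⟩ := hl
    set Cx : Finset α := {y | SameCycle τ x y} with hC
    have hmem : ∀ y, y ∈ Cx ↔ SameCycle τ x y := by intro y; simp [hC]
    have h0 : x0 ∉ Cx := by rw [hmem]; exact fun h => hx h.symm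
    have hPC : ∀ I, Pres τ I → Pres τ (symmDiff I Cx) := by
      intro I hI y
      rw [mem_symmDiff, mem_symmDiff, hmem, hmem, ← hI, sameCycle_apply_right]
    have hneg : ∀ I, Pres τ I → x ∉ I → ww τ (symmDiff I Cx) = - ww τ I := by
      intro I hI hxI
      obtain ⟨_, h2, h3⟩ := ww_union hI hxI
      rw [h2.symmDiff_eq_sup]
      exact h3
    have hxC : x ∈ Cx := by rw [hmem]
    refine Finset.sum_involution (fun I _ => symmDiff I Cx) ?_ ?_ ?_ ?_
    · intro I hI
      simp only [mem_filter, mem_univ, true_and] at hI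
      by_cases hxI : x ∈ I
      · have := hneg (symmDiff I Cx) (hPC I hI.2) (by simp [mem_symmDiff, hxI, hxC])
        rw [symmDiff_symmDiff_cancel_right] at this
        rw [this]; ring
      · rw [hneg I hI.2 hxI]; ring
    · intro I hI _ he
      have : x ∈ symmDiff I Cx ↔ x ∈ I := by rw [he]
      simp [mem_symmDiff, hxC] at this
    · intro I hI
      simp only [mem_filter, mem_univ, true_and] at hI ⊢
      exact ⟨by simp [mem_symmDiff, hI.1, h0], hPC I hI.2⟩
    · intro I hI
      exact symmDiff_symmDiff_cancel_right _ _

/-- contribution of `I` -/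
noncomputable def YI {α : Type*} [Fintype α] [DecidableEq α] (s : Equiv.Perm α) (I : Finset α) :
    ℤ[X] := Y (fun σ => Pres (s⁻¹ * σ) I) (fun σ => ((ww (s⁻¹ * σ) I : ℤ) : ℤ[X])) ∅

theorem YI_empty {α : Type*} [Fintype α] [DecidableEq α] (s : Equiv.Perm α) :
    YI s ∅ = ∑ σ : Equiv.Perm α, X ^ dd σ := by
  unfold YI Y
  simp [ww_empty, Pres]

theorem YI_zero {α : Type*} [Fintype α] [DecidableEq α] (s : Equiv.Perm α) (I : Finset α)
    (a b : α) (hab : a ≠ b) (ha : a ∈ I) (hb : b ∈ I) (ha' : s⁻¹ a ∉ I) (hb' : s⁻¹ b ∉ I) :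
    YI s I = 0 := by
  have key : ∀ σ, s⁻¹ * (swap a b * σ * swap a b) =
      (swap (s⁻¹ a) (s⁻¹ b) * (s⁻¹ * σ)) * swap a b := by
    intro σ
    rw [swap_apply_apply s⁻¹ a b]
    simp [mul_assoc]
  have hP : ∀ σ, Pres (s⁻¹ * σ) I → Pres (s⁻¹ * (swap a b * σ * swap a b)) I := by
    intro σ h
    rw [key]
    exact pres_swap_mem (pres_swap_mul h (iff_of_false ha' hb')) (by simp [ha, hb])
  have h1 : YI s I = - YI s I := by
    conv_rhs => unfold YI Y
    unfold YI Y
    rw [← Finset.sum_neg_distrib]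
    refine Finset.sum_nbij' (fun σ => swap a b * σ * swap a b)
      (fun σ => swap a b * σ * swap a b) ?_ ?_ ?_ ?_ ?_
    · intro σ hσ
      simp only [mem_filter, mem_univ, true_and] at hσ ⊢
      exact ⟨hP σ hσ.1, by simp⟩
    · intro σ hσ
      simp only [mem_filter, mem_univ, true_and] at hσ ⊢
      exact ⟨hP σ hσ.1, by simp⟩
    · intro σ _
      simp [mul_assoc]
    · intro σ _
      simp [mul_assoc]
    · intro σ hσ
      simp only [mem_filter, mem_univ, true_and] at hσ
      have h2 := pres_swap_mul hσ.1 (y := s⁻¹ a) (v := s⁻¹ b) (iff_of_false ha' hb')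
      simp only []
      rw [key, ww_swap_in h2 ha hb hab, ww_swap_mul_out hσ.1 ha' hb']
      have := dd_conj σ (swap a b)
      rw [swap_inv] at this
      rw [this]
      push_cast; ring
  exact self_eq_neg.mp h1

theorem YI_interval {α : Type*} [Fintype α] [DecidableEq α] (s : Equiv.Perm α) (I : Finset α)
    (a b : α) (ha : a ∈ I) (hb : b ∉ I) (ha' : s⁻¹ a ∉ I) (hb' : s⁻¹ b ∈ I)
    (hI : ∀ x ∈ I, x ≠ a → s⁻¹ x ∈ I) (hJ : ∀ x, x ∉ I → x ≠ b → s⁻¹ x ∉ I)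
    (hcyc : ∀ x ∈ I, SameCycle (s⁻¹ * swap a b) a x) :
    YI s I = - X * (∏ j ∈ range (I.card - 1), (1 - ((1 + j : ℕ) : ℤ[X]) * X)) *
      (∏ j ∈ range (Fintype.card α - I.card - 1), (1 + ((1 + j : ℕ) : ℤ[X]) * X)) := by
  classical
  have hab : a ≠ b := by rintro rfl; exact hb ha
  have hmI : ∀ x, x ∈ ({x | s⁻¹ x ∈ I} : Finset α) ↔ s⁻¹ x ∈ I := by intro x; simp
  have hmJ : ∀ x, x ∈ ({x | s⁻¹ x ∉ I} : Finset α) ↔ s⁻¹ x ∉ I := by intro x; simp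
  have e1 := Y_strip_many (fun σ => Pres (s⁻¹ * σ) I) (fun σ => ((ww (s⁻¹ * σ) I : ℤ) : ℤ[X]))
    I ({x | s⁻¹ x ∈ I} : Finset α) (-1)
    (by intro σ h x; rw [hmI]; exact h x)
    (by intro σ y hy v hv h; rw [← mul_assoc]; exact pres_swap_mem h (by simp [hy, hv]))
    (by intro σ y hy v hv hyv h; simp only [← mul_assoc]; rw [ww_swap_in h hy hv hyv]; simp)
    (I.erase a) 1 ∅ (erase_subset _ _)
    (by intro x hx; rw [hmI]; rw [mem_erase] at hx; exact hI x hx.2 hx.1)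
    (by simp)
    (by rw [card_erase_of_mem ha]; have := card_pos.2 ⟨a, ha⟩; simp; omega)
  have hbc : b ∈ Iᶜ := by simpa using hb
  have e2 := Y_strip_many (fun σ => Pres (s⁻¹ * σ) I) (fun σ => ((ww (s⁻¹ * σ) I : ℤ) : ℤ[X]))
    Iᶜ ({x | s⁻¹ x ∉ I} : Finset α) 1
    (by intro σ h x; rw [hmJ, mem_compl]; exact not_congr (h x))
    (by intro σ y hy v hv h; rw [mem_compl] at hy hv; rw [← mul_assoc]
        exact pres_swap_mem h (by simp [hy, hv]))
    (by intro σ y hy v hv hyv h; rw [mem_compl] at hy hv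
        simp only [← mul_assoc]; rw [ww_swap_out h hy hv]; simp)
    (Iᶜ.erase b) 1 (I.erase a ∪ ∅) (erase_subset _ _)
    (by intro x hx; rw [hmJ]; rw [mem_erase, mem_compl] at hx; exact hJ x hx.2 hx.1)
    (by rw [Finset.disjoint_left]; intro x hx; simp at hx ⊢; tauto)
    (by 
        rw [show Iᶜ \ (I.erase a ∪ ∅) = Iᶜ by ext x; simp; tauto]
        rw [card_erase_of_mem hbc]; have := card_pos.2 ⟨b, hbc⟩; omega)
  have e3 : Y (fun σ => Pres (s⁻¹ * σ) I) (fun σ => ((ww (s⁻¹ * σ) I : ℤ) : ℤ[X]))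
      (Iᶜ.erase b ∪ (I.erase a ∪ ∅)) = - X := by
    have hV : ∀ x, x ∈ Iᶜ.erase b ∪ (I.erase a ∪ ∅) ↔ x ≠ a ∧ x ≠ b := by
      intro x
      simp only [mem_union, mem_erase, mem_compl, notMem_empty, or_false]
      constructor
      · rintro (⟨h1, h2⟩ | ⟨h1, h2⟩)
        · exact ⟨by rintro rfl; exact h2 ha, h1⟩
        · exact ⟨h1, by rintro rfl; exact hb h2⟩
      · tauto
    have hst : s⁻¹ * swap a b = s⁻¹ * swap a b := rfl
    have hPr : Pres (s⁻¹ * swap a b) I := by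
      intro x
      rw [Perm.mul_apply]
      by_cases h1 : x = a
      · subst h1; rw [swap_apply_left]; tauto
      · by_cases h2 : x = b
        · subst h2; rw [swap_apply_right]; tauto
        · rw [swap_apply_of_ne_of_ne h1 h2]
          have := hI x; have := hJ x; tauto
    have hw : ww (s⁻¹ * swap a b) I = -1 := by
      obtain ⟨_, _, h3⟩ := ww_union (τ := s⁻¹ * swap a b) (I := ∅) (by simp [Pres]) (x := a) (by simp)
      rw [ww_empty] at h3
      rw [← h3]
      congr 1
      ext x
      simp only [empty_union, mem_filter, mem_univ, true_and]
      exact ⟨hcyc x, fun h => (pres_zpow hPr h).1 ha⟩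
    unfold Y
    rw [Finset.sum_eq_single (swap a b)]
    · have hd := dd_swap 1 a b rfl hab
      rw [one_mul, dd_one] at hd
      simp only []
      rw [hw, hd]; simp
    · intro σ hσ hne
      exfalso; apply hne
      simp only [mem_filter, mem_univ, true_and, hV] at hσ
      obtain ⟨h1, h2⟩ := hσ
      have h3 : σ a ≠ a := by
        intro h
        have := (h1 a).1 ha
        rw [Perm.mul_apply, h] at this
        exact ha' this
      have h4 : σ a = b := by
        by_contra h
        exact h3 (σ.injective (h2 _ ⟨h3, h⟩))
      have h5 : σ b = a := by
        by_contra h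
        have h6 : σ b ≠ b := by
          intro h6; exact hab (σ.injective (h4.trans h6.symm))
        exact h6 (σ.injective (h2 _ ⟨h, h6⟩))
      ext x
      by_cases h7 : x = a
      · subst h7; rw [h4, swap_apply_left]
      · by_cases h8 : x = b
        · subst h8; rw [h5, swap_apply_right]
        · rw [h2 x ⟨h7, h8⟩, swap_apply_of_ne_of_ne h7 h8]
    · intro h
      exfalso; apply h
      simp only [mem_filter, mem_univ, true_and, hV]
      exact ⟨hPr, fun x hx => swap_apply_of_ne_of_ne hx.1 hx.2⟩
  unfold YI
  rw [e1, e2, e3, card_erase_of_mem ha, card_erase_of_mem hbc, card_compl]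
  simp only [Int.cast_neg, Int.cast_one, one_mul, neg_mul, ← sub_eq_add_neg]
  ring

theorem rot_inv_val {n : ℕ} (x : Fin (n+1)) :
    ((finRotate (n+1))⁻¹ x).val = if x.val = 0 then n else x.val - 1 := by
  obtain ⟨y, rfl⟩ := (finRotate (n+1)).surjective x
  rw [Perm.inv_def, Equiv.symm_apply_apply, coe_finRotate]
  by_cases h : y = Fin.last n
  · subst h; simp
  · simp [h]

def Iv (n i j : ℕ) : Finset (Fin (n+1)) := {x | j + 1 ≤ x.val ∧ x.val < j + 1 + (i + 1)}

theorem mem_Iv {n i j : ℕ} (x : Fin (n+1)) :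
    x ∈ Iv n i j ↔ j + 1 ≤ x.val ∧ x.val < j + 1 + (i + 1) := by
  simp [Iv]

theorem card_Iv {n i j : ℕ} (h : j + i + 2 ≤ n + 1) : (Iv n i j).card = i + 1 := by
  rw [← Finset.card_map Fin.valEmbedding]
  have : (Iv n i j).map Fin.valEmbedding = Finset.Ico (j + 1) (j + 1 + (i + 1)) := by
    ext x
    simp only [mem_map, mem_Iv, Fin.valEmbedding_apply, Finset.mem_Ico]
    constructor
    · rintro ⟨y, hy, rfl⟩; exact hy
    · intro hx; exact ⟨⟨x, by omega⟩, hx, rfl⟩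
  rw [this]; simp

theorem YI_Iv {n i j : ℕ} (h : j + i + 2 ≤ n + 1) : YI (finRotate (n+1)) (Iv n i j) =
    - X * (∏ j ∈ range i, (1 - ((1 + j : ℕ) : ℤ[X]) * X)) *
      (∏ j ∈ range (n - 1 - i), (1 + ((1 + j : ℕ) : ℤ[X]) * X)) := by
  set s := finRotate (n+1) with hs
  have hv : ∀ x : Fin (n+1), (s⁻¹ x).val = if x.val = 0 then n else x.val - 1 := rot_inv_val
  obtain ⟨a, hav⟩ : ∃ a : Fin (n+1), a.val = j + 1 := ⟨⟨j+1, by omega⟩, rfl⟩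
  obtain ⟨c, hc⟩ : ∃ c : Fin (n+1), c.val = j + i + 1 := ⟨⟨j+i+1, by omega⟩, rfl⟩
  have hsb : s⁻¹ (s c) = c := by simp
  have hb := hv (s c)
  rw [hsb] at hb
  have hbn := (s c).isLt
  have hbv : (s c).val = 0 ∧ j + i + 1 = n ∨ (s c).val = j + i + 2 := by
    split_ifs at hb <;> omega
  have hne : ∀ x, x ≠ a → x.val ≠ j + 1 := fun x hx h => hx (Fin.ext (h.trans hav.symm))
  have hne2 : ∀ x, x ≠ s c → x.val ≠ (s c).val := fun x hx h => hx (Fin.ext h)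
  have := YI_interval s (Iv n i j) a (s c) (by rw [mem_Iv]; omega) (by rw [mem_Iv]; omega)
    (by rw [mem_Iv, hv]; split_ifs <;> omega) (by rw [mem_Iv, hsb]; omega)
    (by
      intro x hx hxa
      have := hne x hxa
      rw [mem_Iv] at hx ⊢
      rw [hv]
      split_ifs <;> omega)
    (by
      intro x hx hxa
      have := hne2 x hxa
      have := x.isLt
      rw [mem_Iv] at hx ⊢
      rw [hv]
      split_ifs <;> omega)
    (by
      have : ∀ m, ∀ x : Fin (n+1), x.val = j + 1 + m → m ≤ i → SameCycle (s⁻¹ * swap a (s c)) a x := by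
        intro m
        induction m with
        | zero =>
          intro x hx _
          rw [show x = a from Fin.ext (hx.trans hav.symm)]
        | succ m ih =>
          intro x hx hm
          rw [← sameCycle_apply_right]
          apply ih
          · rw [Perm.mul_apply, swap_apply_of_ne_of_ne, hv]
            · split_ifs <;> omega
            · intro h; rw [h] at hx; omega
            · intro h; rw [h] at hx; omega
          · omega
      intro x hx
      rw [mem_Iv] at hx
      exact this (x.val - (j + 1)) x (by omega) (by omega))
  rw [this, card_Iv h, Fintype.card_fin]
  simp only [Nat.add_sub_cancel]
  rw [show n + 1 - (i + 1) - 1 = n - 1 - i by omega]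

theorem YI_not_Iv {n : ℕ} (I : Finset (Fin (n+1))) (h0 : 0 ∉ I) (hI : I.Nonempty)
    (h : ∀ i j, j + i + 2 ≤ n + 1 → Iv n i j ≠ I) : YI (finRotate (n+1)) I = 0 := by
  classical
  let P : ℕ → Prop := fun m => ∃ h : m < n + 1, (⟨m, h⟩ : Fin (n+1)) ∈ I
  have hP : ∀ x : Fin (n+1), x ∈ I ↔ P x.val := fun x => ⟨fun h => ⟨x.2, h⟩, fun ⟨_, h⟩ => h⟩
  have hPn : ∀ m, P m → m < n + 1 := fun m h => h.1
  have hP0 : ¬ P 0 := fun ⟨_, h⟩ => h0 h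
  have ex1 : ∃ m, P m := by
    obtain ⟨x, hx⟩ := hI
    exact ⟨x.val, (hP x).1 hx⟩
  obtain ⟨p, hp, hpmin⟩ : ∃ p, P p ∧ ∀ m < p, ¬ P m :=
    ⟨Nat.find ex1, Nat.find_spec ex1, fun m hm => Nat.find_min ex1 hm⟩
  have ex2 : ∃ e, p < e ∧ ¬ P e := ⟨n+1, hPn p hp, fun h => absurd (hPn _ h) (lt_irrefl _)⟩
  obtain ⟨e, ⟨hpe, hPe⟩, hemin⟩ : ∃ e, (p < e ∧ ¬ P e) ∧ ∀ m < e, ¬ (p < m ∧ ¬ P m) :=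
    ⟨Nat.find ex2, Nat.find_spec ex2, fun m hm => Nat.find_min ex2 hm⟩
  have hp1 : 1 ≤ p := by
    rcases Nat.eq_zero_or_pos p with h | h
    · rw [h] at hp; exact absurd hp hP0
    · exact h
  have hmid : ∀ m, p ≤ m → m < e → P m := by
    intro m h1 h2
    rcases h1.eq_or_lt with h1 | h1
    · rw [← h1]; exact hp
    · by_contra h3; exact hemin m h2 ⟨h1, h3⟩
  have hen : e ≤ n + 1 := by
    by_contra h3
    have := hPn _ (hmid (n+1) (hPn p hp).le (by omega))
    omega
  have ex3 : ∃ f, e < f ∧ P f := by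
    by_contra hcon
    push Not at hcon
    apply h (e - p - 1) (p - 1) (by omega)
    ext x
    rw [mem_Iv, hP]
    constructor
    · intro hx; exact hmid _ (by omega) (by omega)
    · intro hx
      have h1 : ¬ (x.val < p) := fun h => hpmin _ h hx
      have h2 : ¬ (e < x.val) := fun h => hcon _ h hx
      have h3 : x.val ≠ e := fun h => hPe (h ▸ hx)
      omega
  obtain ⟨f, ⟨hef, hPf⟩, hfmin⟩ : ∃ e', (e < e' ∧ P e') ∧ ∀ m < e', ¬ (e < m ∧ P m) :=
    ⟨Nat.find ex3, Nat.find_spec ex3, fun m hm => Nat.find_min ex3 hm⟩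
  have hf1 : ¬ P (f - 1) := by
    intro hh
    by_cases h1 : f - 1 = e
    · rw [h1] at hh; exact hPe hh
    · exact hfmin (f-1) (by omega) ⟨by omega, hh⟩
  refine YI_zero _ I ⟨p, hPn p hp⟩ ⟨f, hPn f hPf⟩ ?_ hp.2 hPf.2 ?_ ?_
  · intro h; have := congrArg Fin.val h; simp at this; omega
  · rw [hP, rot_inv_val, if_neg (by simp; omega)]
    exact hpmin _ (by simp; omega)
  · rw [hP, rot_inv_val, if_neg (by simp; omega)]
    exact hf1

theorem sum_YI (n : ℕ) : ∑ I : Finset (Fin (n+1)) with 0 ∉ I, YI (finRotate (n+1)) I =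
    (∏ j ∈ range (n+1), (1 + (j : ℤ[X]) * X)) - ∑ i ∈ range n, ((n : ℤ[X]) - (i : ℤ[X])) *
     (X * (∏ j ∈ range i, (1 - ((1 + j : ℕ) : ℤ[X]) * X)) *
      (∏ j ∈ range (n - 1 - i), (1 + ((1 + j : ℕ) : ℤ[X]) * X))) := by
  classical
  rw [← Finset.add_sum_erase _ _ (show ∅ ∈ ({I : Finset (Fin (n+1)) | 0 ∉ I} : Finset _) by simp),
    YI_empty, stirling_poly, sub_eq_add_neg]
  congr 1
  rw [← Finset.sum_of_injOn (s := (range n).sigma (fun i => range (n - i)))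
    (fun p : (_ : ℕ) × ℕ => Iv n p.1 p.2) (f := fun p : (_ : ℕ) × ℕ =>
    - X * (∏ j ∈ range p.1, (1 - ((1 + j : ℕ) : ℤ[X]) * X)) *
      (∏ j ∈ range (n - 1 - p.1), (1 + ((1 + j : ℕ) : ℤ[X]) * X)))]
  · rw [Finset.sum_sigma, ← Finset.sum_neg_distrib]
    refine Finset.sum_congr rfl fun i hi => ?_
    rw [mem_range] at hi
    simp only []
    rw [Finset.sum_const, card_range, nsmul_eq_mul, Nat.cast_sub hi.le]
    ring
  · rintro ⟨i, j⟩ hp ⟨i', j'⟩ hp' heq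
    simp only [coe_sigma, Set.mem_sigma_iff, mem_coe, mem_range] at hp hp'
    simp only [] at heq
    have h1 := card_Iv (n := n) (i := i) (j := j) (by omega)
    have h2 := card_Iv (n := n) (i := i') (j := j') (by omega)
    rw [heq, h2] at h1
    have h3 : (⟨j+1, by omega⟩ : Fin (n+1)) ∈ Iv n i' j' := by rw [← heq, mem_Iv]; simp
    have h4 : (⟨j'+1, by omega⟩ : Fin (n+1)) ∈ Iv n i j := by rw [heq, mem_Iv]; simp
    rw [mem_Iv] at h3 h4
    simp only at h3 h4
    obtain rfl : i = i' := by omega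
    obtain rfl : j = j' := by omega
    rfl
  · rintro ⟨i, j⟩ hp
    simp only [coe_sigma, Set.mem_sigma_iff, mem_coe, mem_range] at hp
    simp only [mem_coe, mem_erase, mem_filter, mem_univ, true_and]
    refine ⟨?_, by rw [mem_Iv]; simp⟩
    rw [← Finset.card_pos.trans Finset.nonempty_iff_ne_empty, card_Iv (by omega)]
    omega
  · intro I hI hn
    simp only [mem_erase, mem_filter, mem_univ, true_and] at hI
    refine YI_not_Iv I hI.2 (Finset.nonempty_iff_ne_empty.2 hI.1) ?_
    intro i j hij he
    apply hn
    refine ⟨⟨i, j⟩, ?_, he⟩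
    simp only [coe_sigma, Set.mem_sigma_iff, mem_coe, mem_range]
    omega
  · rintro ⟨i, j⟩ hp
    simp only [mem_sigma, mem_range] at hp
    simp only []
    rw [YI_Iv (by omega)]

theorem final_alg (n : ℕ) : ((n : ℤ[X]) + 1) * ((n : ℤ[X]) + 2) * X *
    ((∏ j ∈ range (n+1), (1 + (j : ℤ[X]) * X)) - ∑ i ∈ range n, ((n : ℤ[X]) - (i : ℤ[X])) *
     (X * (∏ j ∈ range i, (1 - ((1 + j : ℕ) : ℤ[X]) * X)) *
      (∏ j ∈ range (n - 1 - i), (1 + ((1 + j : ℕ) : ℤ[X]) * X)))) =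
    (∏ j ∈ range (n+2), (1 + (j : ℤ[X]) * X)) - ∏ j ∈ range (n+2), (1 - (j : ℤ[X]) * X) := by
  set U : ℕ → ℤ[X] := fun m => ∏ j ∈ range m, (1 + ((1 + j : ℕ) : ℤ[X]) * X) with hU
  set D : ℕ → ℤ[X] := fun m => ∏ j ∈ range m, (1 - ((1 + j : ℕ) : ℤ[X]) * X) with hD
  have hUs : ∀ m, U (m+1) = U m * (1 + ((m : ℤ[X]) + 1) * X) := by
    intro m; simp only [hU]; rw [prod_range_succ]; push_cast; ring
  have hDs : ∀ m, D (m+1) = D m * (1 - ((m : ℤ[X]) + 1) * X) := by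
    intro m; simp only [hD]; rw [prod_range_succ]; push_cast; ring
  have hU' : ∀ m, ∏ j ∈ range (m+1), (1 + (j : ℤ[X]) * X) = U m := by
    intro m; rw [prod_range_succ']; simp [hU, add_comm]
  have hD' : ∀ m, ∏ j ∈ range (m+1), (1 - (j : ℤ[X]) * X) = D m := by
    intro m; rw [prod_range_succ']; simp [hD, add_comm]
  rw [hU', hU', hD']
  let a : ℕ → ℤ[X] := fun k => D k * U (n - k)
  let b : ℕ → ℤ[X] := fun k => D k * U (n + 1 - k)
  have ha : ∀ i ∈ range n, ((n : ℤ[X]) + 1) * (((n : ℤ[X]) - (i : ℤ[X])) * (X * D i * U (n - 1 - i))) =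
      ((n : ℤ[X]) - (i : ℤ[X])) * (a i - a (i+1)) := by
    intro i hi
    rw [mem_range] at hi
    obtain ⟨r, rfl⟩ : ∃ r, n = i + 1 + r := ⟨n - (i + 1), by omega⟩
    simp only [a]
    rw [show i + 1 + r - i = r + 1 by omega, show i + 1 + r - (i + 1) = r by omega,
      show i + 1 + r - 1 - i = r by omega, hUs, hDs]
    push_cast
    ring
  have hab : ∀ m, m ≤ n → ∑ i ∈ range m, ((n : ℤ[X]) - (i : ℤ[X])) * (a i - a (i+1)) =
      n * a 0 - (n - m) * a m - ∑ i ∈ range m, a (i+1) := by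
    intro m
    induction m with
    | zero => intro _; simp
    | succ m ih =>
      intro hm
      rw [sum_range_succ, ih (by omega), sum_range_succ _ m]
      push_cast; ring
  have hb : ∀ m, m ≤ n + 1 → ∑ k ∈ range m, ((n : ℤ[X]) + 2) * X * a k = b 0 - b m := by
    intro m
    induction m with
    | zero => intro _; simp
    | succ m ih =>
      intro hm
      rw [sum_range_succ, ih (by omega)]
      obtain ⟨r, rfl⟩ : ∃ r, n = m + r := ⟨n - m, by omega⟩
      simp only [a, b]
      rw [show m + r + 1 - m = r + 1 by omega, show m + r + 1 - (m + 1) = r by omega,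
        show m + r - m = r by omega, hUs, hDs]
      push_cast
      ring
  have hN : ((n : ℤ[X]) + 1) * (U n - ∑ i ∈ range n, ((n : ℤ[X]) - (i : ℤ[X])) *
     (X * D i * U (n - 1 - i))) = ∑ k ∈ range (n+1), a k := by
    rw [mul_sub, Finset.mul_sum, Finset.sum_congr rfl ha, hab n le_rfl, sum_range_succ']
    have : a 0 = U n := by simp [a, hD]
    rw [this]; ring
  have h1 := hb (n+1) le_rfl
  rw [← Finset.mul_sum, ← hN] at h1
  have h2 : b 0 = U (n+1) := by simp [b, hD]
  have h3 : b (n+1) = D (n+1) := by simp [b, hU]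
  rw [h2, h3] at h1
  rw [← h1]
  simp only [hU, hD]
  ring

def Long {n : ℕ} (τ : Equiv.Perm (Fin (n+1))) : Prop := ∀ x, SameCycle τ 0 x

theorem long_rot (n : ℕ) : Long (finRotate (n+1))⁻¹ := by
  have : ∀ m, ∀ x : Fin (n+1), x.val = m → SameCycle (finRotate (n+1))⁻¹ 0 x := by
    intro m
    induction m with
    | zero => intro x hx; rw [show x = 0 from Fin.ext hx]
    | succ m ih =>
      intro x hx
      rw [← sameCycle_apply_right]
      apply ih
      rw [rot_inv_val, if_neg (by omega)]; omega
  exact fun x => this _ x rfl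

theorem long_conj_iff {n : ℕ} (τ g : Equiv.Perm (Fin (n+1))) (h : Long τ) : Long (g * τ * g⁻¹) := by
  intro x
  rw [sameCycle_conj]
  exact ((h _).symm).trans (h _)

theorem long_cycle {n : ℕ} (hn : n ≠ 0) (τ : Equiv.Perm (Fin (n+1))) (h : Long τ) :
    IsCycle τ ∧ τ.support = univ := by
  have h1 : ∀ x, τ x ≠ x := by
    intro x hx
    have h2 : ∀ y, x = y := fun y => SameCycle.eq_of_left (((h x).symm).trans (h y)) hx
    have h3 : (0 : Fin (n+1)) = Fin.last n := (h2 _).symm.trans (h2 _)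
    have := congrArg Fin.val h3
    simp at this
    omega
  refine ⟨⟨0, h1 0, fun y _ => h y⟩, ?_⟩
  ext x; simp [h1 x]

theorem long_isConj {n : ℕ} (τ ρ : Equiv.Perm (Fin (n+1))) (h : Long τ) (h' : Long ρ) :
    ∃ g, g * τ * g⁻¹ = ρ := by
  rcases eq_or_ne n 0 with rfl | hn
  · exact ⟨1, Subsingleton.elim (α := Equiv.Perm (Fin 1)) _ _⟩
  · obtain ⟨h1, h2⟩ := long_cycle hn τ h
    obtain ⟨h3, h4⟩ := long_cycle hn ρ h'
    exact isConj_iff.1 (h1.isConj h3 (by rw [h2, h4]))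

def ph {n : ℕ} (π : Equiv.Perm (Fin n)) : Equiv.Perm (Fin (n+1)) := decomposeFin.symm (0, π)

theorem ph_zero {n : ℕ} (π : Equiv.Perm (Fin n)) : ph π 0 = 0 := by
  unfold ph; simp

theorem ph_inj {n : ℕ} {π ρ : Equiv.Perm (Fin n)} (h : ph π = ph ρ) : π = ρ := by
  have := decomposeFin.symm.injective h
  simpa using this

theorem ph_surj {n : ℕ} (p : Equiv.Perm (Fin (n+1))) (h : p 0 = 0) : ∃ π, ph π = p := by
  obtain ⟨⟨k, π⟩, rfl⟩ := decomposeFin.symm.surjective p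
  rw [decomposeFin_symm_apply_zero] at h
  subst h
  exact ⟨π, rfl⟩

def cp {n : ℕ} (π : Equiv.Perm (Fin n)) : Equiv.Perm (Fin (n+1)) := cpi π

theorem A_eq (n : ℕ) (π : Equiv.Perm (Fin n)) : A n π = cyc (cp π) := rfl

theorem rot_inv_apply {n : ℕ} (x : Fin (n+1)) : (finRotate (n+1))⁻¹ x = x - 1 := by
  rw [Perm.inv_eq_iff_eq, finRotate_apply, sub_add_cancel]

theorem cp_eq {n : ℕ} (π : Equiv.Perm (Fin n)) :
    cp π = ph π * (finRotate (n+1))⁻¹ * (ph π)⁻¹ * finRotate (n+1) := by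
  apply Equiv.ext
  intro x
  simp only [Perm.mul_apply]
  rw [finRotate_apply, rot_inv_apply]
  rfl

open Classical in
theorem sum_cp (n : ℕ) : ∑ π : Equiv.Perm (Fin n), (X : ℤ[X]) ^ dd (cp π) =
    ∑ σ : Equiv.Perm (Fin (n+1)) with Long ((finRotate (n+1))⁻¹ * σ), X ^ dd σ := by
  set s := finRotate (n+1) with hs
  have hl : Long s⁻¹ := long_rot n
  refine Finset.sum_bij (fun π _ => s * (ph π * s⁻¹ * (ph π)⁻¹)) ?_ ?_ ?_ ?_
  · intro π _
    simp only [mem_filter, mem_univ, true_and, inv_mul_cancel_left]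
    exact long_conj_iff _ _ hl
  · intro π _ ρ _ h
    simp only [mul_right_inj] at h
    apply ph_inj
    set g := (ph ρ)⁻¹ * ph π with hg
    have hc : g * s⁻¹ = s⁻¹ * g := by
      have : (ph ρ)⁻¹ * (ph π * s⁻¹ * (ph π)⁻¹) * ph π = (ph ρ)⁻¹ * (ph ρ * s⁻¹ * (ph ρ)⁻¹) * ph π := by
        rw [h]
      simpa [hg, mul_assoc] using this
    have hc' : Commute g s⁻¹ := hc
    have g0 : g 0 = 0 := by
      rw [hg, Perm.mul_apply, ph_zero, Perm.inv_eq_iff_eq, ph_zero]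
    have : g = 1 := by
      ext x
      obtain ⟨i, rfl⟩ := hl x
      have h2 : g * s⁻¹ ^ i = s⁻¹ ^ i * g := hc'.zpow_right i
      rw [← Perm.mul_apply, h2, Perm.mul_apply, g0]; rfl
    rw [hg, inv_mul_eq_one] at this
    exact this.symm
  · intro σ hσ
    simp only [mem_filter, mem_univ, true_and] at hσ
    obtain ⟨g, hg⟩ := long_isConj _ _ hl hσ
    obtain ⟨i, hi⟩ := hl (g⁻¹ 0)
    obtain ⟨π, hπ⟩ := ph_surj (g * s⁻¹ ^ i) (by rw [Perm.mul_apply, hi]; simp)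
    refine ⟨π, mem_univ _, ?_⟩
    have h3 : s⁻¹ ^ i * s⁻¹ * (s⁻¹ ^ i)⁻¹ = s⁻¹ := by
      have h5 : Commute (s⁻¹ ^ i) s⁻¹ := (Commute.refl s⁻¹).zpow_left i
      rw [h5.eq, mul_inv_cancel_right]
    calc s * (ph π * s⁻¹ * (ph π)⁻¹) = s * (g * (s⁻¹ ^ i * s⁻¹ * (s⁻¹ ^ i)⁻¹) * g⁻¹) := by
          rw [hπ, mul_inv_rev]; simp only [mul_assoc]
      _ = σ := by rw [h3, hg, mul_inv_cancel_left]
  · intro π _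
    rw [← dd_conj (cp π) s, cp_eq]
    congr 2
    simp [mul_assoc, hs]

theorem sum_cp_eq (n : ℕ) : ∑ π : Equiv.Perm (Fin n), (X : ℤ[X]) ^ dd (cp π) =
    ∑ I : Finset (Fin (n+1)) with 0 ∉ I, YI (finRotate (n+1)) I := by
  classical
  rw [sum_cp]
  set s := finRotate (n+1) with hs
  have h1 : ∀ I : Finset (Fin (n+1)), YI s I = ∑ σ : Equiv.Perm (Fin (n+1)),
      if Pres (s⁻¹ * σ) I then ((ww (s⁻¹ * σ) I : ℤ) : ℤ[X]) * X ^ dd σ else 0 := by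
    intro I
    unfold YI Y
    rw [← Finset.sum_filter]
    refine Finset.sum_congr ?_ fun _ _ => rfl
    ext σ; simp
  rw [Finset.sum_congr rfl fun I _ => h1 I, Finset.sum_comm, Finset.sum_filter]
  refine Finset.sum_congr rfl fun σ _ => ?_
  have h2 := sieve (s⁻¹ * σ) 0
  rw [← Finset.sum_filter, Finset.filter_filter, ← Finset.sum_mul, ← Int.cast_sum]
  have h3 : (∑ I : Finset (Fin (n+1)) with 0 ∉ I ∧ Pres (s⁻¹ * σ) I, ww (s⁻¹ * σ) I) =
    if Long (s⁻¹ * σ) then 1 else 0 := by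
    refine Eq.trans ?_ (h2.trans ?_)
    · congr
    · unfold Long; congr
  rw [h3]
  split_ifs <;> simp

theorem hultman_poly (n : ℕ) : ((n : ℤ[X]) + 1) * ((n : ℤ[X]) + 2) *
    ((∑ π : Equiv.Perm (Fin n), (X : ℤ[X]) ^ dd (cp π)) * X) =
    (∑ σ : Equiv.Perm (Fin (n+2)), (X : ℤ[X]) ^ dd σ) -
      (∑ σ : Equiv.Perm (Fin (n+2)), (X : ℤ[X]) ^ dd σ).comp (-X) := by
  have h := final_alg n
  rw [← sum_YI, ← sum_cp_eq] at h
  rw [stirling_poly, Polynomial.prod_comp]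
  simp only [add_comp, one_comp, mul_comp, natCast_comp, X_comp, mul_neg, ← sub_eq_add_neg]
  rw [← h]
  ring

theorem coeff_count {β : Type*} [Fintype β] (f : β → ℕ) (k : ℕ) :
    (∑ b : β, (X : ℤ[X]) ^ f b).coeff k = (Nat.card {b : β // f b = k} : ℤ) := by
  classical
  rw [Polynomial.finsetSum_coeff, Nat.card_eq_fintype_card, Fintype.card_subtype]
  simp [coeff_X_pow, eq_comm]

theorem comp_neg_X_coeff (p : ℤ[X]) (k : ℕ) : (p.comp (-X)).coeff k = (-1) ^ k * p.coeff k := by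
  have : (-X : ℤ[X]) = C (-1) * X := by simp
  rw [this, comp_C_mul_X_coeff, mul_comm]

/-- The Hultman numbers in terms of the unsigned Stirling numbers of the first kind:
`(n+1)(n+2) H(n,k) = 2 S(n+2,k)` when `n - k` is odd, and `H(n,k) = 0` when `n - k` is even. -/
theorem hultman_eq_stirling (n k : ℕ) :
    (Odd ((n : ℤ) - (k : ℤ)) → (n + 1) * (n + 2) * H n k = 2 * S (n + 2) k) ∧
    (Even ((n : ℤ) - (k : ℤ)) → H n k = 0) := by
  have hA : ∀ π : Equiv.Perm (Fin n), A n π ≤ n + 1 := by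
    intro π
    rw [A_eq]
    simpa using cyc_le (cp π)
  have hC : ∀ σ : Equiv.Perm (Fin (n+2)), cyc σ ≤ n + 2 := by
    intro σ
    simpa using cyc_le σ
  by_cases hk : k ≤ n + 1
  · have hH : H n k = Nat.card {π : Equiv.Perm (Fin n) // dd (cp π) = n + 1 - k} := by
      refine Nat.card_congr (Equiv.subtypeEquivRight fun π => ?_)
      have := hA π
      rw [A_eq] at this ⊢
      unfold dd
      rw [Fintype.card_fin]
      omega
    have hS : S (n+2) k = Nat.card {σ : Equiv.Perm (Fin (n+2)) // dd σ = n + 1 - k + 1} := by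
      refine Nat.card_congr (Equiv.subtypeEquivRight fun σ => ?_)
      have := hC σ
      change cyc σ = k ↔ _
      unfold dd
      rw [Fintype.card_fin]
      omega
    have h := congrArg (fun p : ℤ[X] => p.coeff (n + 1 - k + 1)) (hultman_poly n)
    have hc : ((n : ℤ[X]) + 1) * ((n : ℤ[X]) + 2) = C (((n : ℤ) + 1) * ((n : ℤ) + 2)) := by
      simp
    simp only [coeff_sub] at h
    rw [hc, coeff_C_mul, coeff_mul_X, coeff_count, comp_neg_X_coeff, coeff_count, ← hH, ← hS] at h
    constructor
    · intro ho
      have : Odd (n + 1 - k + 1) := by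
        rw [Int.odd_iff] at ho; rw [Nat.odd_iff]; omega
      rw [this.neg_one_pow] at h
      zify
      linarith
    · intro he
      have : Even (n + 1 - k + 1) := by
        rw [Int.even_iff] at he; rw [Nat.even_iff]; omega
      rw [this.neg_one_pow, one_mul, sub_self] at h
      have h2 : ((n : ℤ) + 1) * ((n : ℤ) + 2) ≠ 0 := by positivity
      have := (mul_eq_zero.1 h).resolve_left h2
      exact_mod_cast this
  · have hH : H n k = 0 := by
      unfold H
      rw [Nat.card_eq_zero]
      left
      exact ⟨fun ⟨π, h⟩ => by have := hA π; omega⟩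
    refine ⟨fun ho => ?_, fun _ => hH⟩
    have hS : S (n+2) k = 0 := by
      unfold S
      rw [Nat.card_eq_zero]
      left
      refine ⟨fun ⟨σ, h⟩ => ?_⟩
      have h1 := hC σ
      change cyc σ = k at h
      rw [Int.odd_iff] at ho
      omega
    rw [hH, hS]
    rfl
end

section
/- Let N ≥ 1 and let μ_N be the Gaussian probability measure on the space Matrix (Fin N) (Fin N) ℂ of complex N×N matrices, defined as the pushforward under the natural identification ((Fin N × Fin N) → ℂ) ≃ Matrix (Fin N) (Fin N) ℂ of the product measure Measure.pi in which each coordinate carries the measure on ℂ with density z ↦ π⁻¹·exp(−‖z‖²) with respect to Lebesgue measure (volume) on ℂ. Then for every n ≥ 0, ∫ Matrix.trace (X^n * (X^n)ᴴ) dμ_N(X) = p_n(N), where p_n(N) = Σ_{g=0}^{⌊n/2⌋} H(n, n+1−2g)·N^{n+1−2g} (the equality holding in ℂ, the left-hand integral having value the real number p_n(N)). -/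
open MeasureTheory Matrix

noncomputable instance matrixMeasurableSpace {m n α : Type*} [MeasurableSpace α] :
    MeasurableSpace (Matrix m n α) :=
  inferInstanceAs (MeasurableSpace (m → n → α))

/-- The standard Gaussian probability measure on `ℂ`, with density
`z ↦ π⁻¹ exp (-‖z‖²)` with respect to Lebesgue measure on `ℂ`. -/
noncomputable def gaussianC : Measure ℂ :=
  (volume : Measure ℂ).withDensity fun z => ENNReal.ofReal (Real.pi⁻¹ * Real.exp (-‖z‖ ^ 2))

/-- The Gaussian measure on the space of complex `N × N` matrices (the complex Ginibre
ensemble): the pushforward of the product of the Gaussian measures on the entries under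
the natural identification of `(Fin N × Fin N) → ℂ` with `Matrix (Fin N) (Fin N) ℂ`. -/
noncomputable def ginibre (N : ℕ) : Measure (Matrix (Fin N) (Fin N) ℂ) :=
  Measure.map (fun f => Matrix.of fun i j => f (i, j))
    (Measure.pi fun _ : Fin N × Fin N => gaussianC)

/-- `pn n N = Σ_{g=0}^{⌊n/2⌋} H(n, n+1-2g) N^{n+1-2g}`. -/
noncomputable def pn (n N : ℕ) : ℕ :=
  ∑ g ∈ Finset.range (n / 2 + 1), H n (n + 1 - 2 * g) * N ^ (n + 1 - 2 * g)


section helpers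

open Finset

theorem card_orbits_add_aux {α : Type*} [Fintype α] [DecidableEq α] (f : Equiv.Perm α) :
    Nat.card (MulAction.orbitRel.Quotient (Subgroup.zpowers f) α) + f.cycleType.sum
      = Fintype.card α + f.cycleType.card := by
  classical
  let g : α → α ⊕ Equiv.Perm α := fun x => if f x = x then Sum.inl x else Sum.inr (f.cycleOf x)
  have hrel : MulAction.orbitRel (Subgroup.zpowers f) α = Setoid.ker g := by
    ext x y
    rw [MulAction.orbitRel_apply, Setoid.ker_def]
    have h1 : x ∈ MulAction.orbit (Subgroup.zpowers f) y ↔ f.SameCycle y x := by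
      constructor
      · rintro ⟨⟨_, k, rfl⟩, h⟩
        exact ⟨k, h⟩
      · rintro ⟨k, h⟩
        exact ⟨⟨f ^ k, k, rfl⟩, h⟩
    rw [h1]
    constructor
    · intro h
      have h2 : f y = y ↔ f x = x := h.apply_eq_self_iff
      by_cases hy : f y = y
      · have := h.eq_of_left hy
        subst this
        rfl
      · have hx : ¬ f x = x := fun h' => hy (h2.2 h')
        simp only [g, hx, hy, if_false]
        rw [h.cycleOf_eq]
    · intro h
      by_cases hy : f y = y <;> by_cases hx : f x = x <;> simp only [g, hx, hy, if_true, if_false] at h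
      · have := Sum.inl.inj h
        subst this; exact Equiv.Perm.SameCycle.refl _ _
      · cases h
      · cases h
      · have h3 := Sum.inr.inj h
        have := (Equiv.Perm.sameCycle_iff_cycleOf_eq_of_mem_support (g := f)
          (Equiv.Perm.mem_support.2 hx) (Equiv.Perm.mem_support.2 hy)).2 h3
        exact this.symm
  have hcard : Nat.card (MulAction.orbitRel.Quotient (Subgroup.zpowers f) α)
      = (univ.image g).card := by
    have : Nat.card (MulAction.orbitRel.Quotient (Subgroup.zpowers f) α)
        = Nat.card (Quotient (Setoid.ker g)) := by
      unfold MulAction.orbitRel.Quotient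
      rw [hrel]
    rw [this, Nat.card_congr (Setoid.quotientKerEquivRange g), Nat.card_eq_fintype_card,
      ← Set.toFinset_card, Set.toFinset_range]
  have himg : univ.image g = (univ.filter fun x => f x = x).disjSum f.cycleFactorsFinset := by
    ext y
    simp only [Finset.mem_image, Finset.mem_univ, true_and, Finset.mem_disjSum, Finset.mem_filter]
    constructor
    · rintro ⟨x, rfl⟩
      by_cases hx : f x = x
      · left; exact ⟨x, hx, by simp [g, hx]⟩
      · right
        refine ⟨f.cycleOf x, ?_, by simp [g, hx]⟩
        rw [Equiv.Perm.cycleOf_mem_cycleFactorsFinset_iff, Equiv.Perm.mem_support]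
        exact hx
    · rintro (⟨x, hx, rfl⟩ | ⟨c, hc, rfl⟩)
      · exact ⟨x, by simp [g, hx]⟩
      · obtain ⟨x, hx⟩ :=
          Equiv.Perm.IsCycle.nonempty_support (Equiv.Perm.mem_cycleFactorsFinset_iff.mp hc).1
        refine ⟨x, ?_⟩
        have h1 : c = f.cycleOf x := Equiv.Perm.cycle_is_cycleOf hx hc
        have h2 : ¬ f x = x :=
          Equiv.Perm.mem_support.1 (Equiv.Perm.mem_cycleFactorsFinset_support_le hc hx)
        simp [g, h2, h1]
  have hsupp : (univ.filter fun x => f x = x).card + f.support.card = Fintype.card α := by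
    have := Finset.card_filter_add_card_filter_not (s := (univ : Finset α)) (fun x => f x = x)
    rw [Finset.card_univ] at this
    exact this
  have hcc : f.cycleType.card = f.cycleFactorsFinset.card := by
    rw [Equiv.Perm.cycleType_def]; simp
  rw [hcard, himg, Finset.card_disjSum, Equiv.Perm.sum_cycleType, hcc]
  omega

theorem card_orbits_parity {α : Type*} [Fintype α] [DecidableEq α] (f : Equiv.Perm α)
    (hf : Equiv.Perm.sign f = 1) :
    Nat.card (MulAction.orbitRel.Quotient (Subgroup.zpowers f) α) ≤ Fintype.card α ∧
    Nat.card (MulAction.orbitRel.Quotient (Subgroup.zpowers f) α) % 2 = Fintype.card α % 2 := by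
  have h := card_orbits_add_aux f
  constructor
  · rw [← Nat.card_eq_fintype_card]
    exact Nat.card_le_card_of_surjective _ Quotient.mk_surjective
  · rw [Equiv.Perm.sign_of_cycleType] at hf
    have : Even (f.cycleType.sum + f.cycleType.card) := by
      by_contra hc
      rw [Nat.not_even_iff_odd] at hc
      rw [hc.neg_one_pow] at hf
      exact absurd hf (by decide)
    obtain ⟨r, hr⟩ := this
    omega

theorem sign_cpi {n : ℕ} (π : Equiv.Perm (Fin n)) :
    @Equiv.Perm.sign (ZMod (n+1)) (inferInstance) (inferInstance) (cpi π) = 1 := by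
  have : cpi π = pihat π * (Equiv.addRight (1 : ZMod (n+1)))⁻¹ * (pihat π)⁻¹ *
      Equiv.addRight (1 : ZMod (n+1)) := by
    ext v
    simp [cpi, Equiv.Perm.inv_def]
    exact sub_eq_add_neg _ _
  rw [this]
  simp only [map_mul, map_inv]
  rw [mul_comm (Equiv.Perm.sign (pihat π))]
  rw [mul_assoc _ (Equiv.Perm.sign (pihat π)), mul_inv_cancel, mul_one, inv_mul_cancel]

theorem card_perm_fiber {ι : Type*} [Fintype ι] [DecidableEq ι] {n : ℕ} (a b : Fin n → ι) :
    Fintype.card {σ : Equiv.Perm (Fin n) // ∀ k, a k = b (σ k)} =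
      ∏ e, if Fintype.card {k // a k = e} = Fintype.card {k // b k = e} then
        (Fintype.card {k // a k = e}).factorial else 0 := by
  by_cases h : ∀ e, Fintype.card {k // a k = e} = Fintype.card {k // b k = e}
  · have E : ∀ e, {k // a k = e} ≃ {k // b k = e} := fun e => Fintype.equivOfCardEq (h e)
    let σ0 : Equiv.Perm (Fin n) := (Equiv.sigmaFiberEquiv a).symm.trans
      ((Equiv.sigmaCongrRight E).trans (Equiv.sigmaFiberEquiv b))
    have h0 : ∀ k, b (σ0 k) = a k := fun k => (E (a k) ⟨k, rfl⟩).2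
    simp only [h, if_true]
    rw [← DomMulAct.stabilizer_card b]
    refine Fintype.card_congr ((Equiv.mulRight σ0⁻¹).subtypeEquiv ?_)
    intro σ
    rw [funext_iff]
    simp only [Function.comp, Equiv.coe_mulRight, Equiv.Perm.mul_apply]
    constructor
    · intro hh k
      rw [← hh, ← h0]; simp
    · intro hh k
      rw [← h0, ← hh (σ0 k)]; simp
  · push Not at h
    obtain ⟨e, he⟩ := h
    rw [Finset.prod_eq_zero (Finset.mem_univ e) (if_neg he), Fintype.card_eq_zero_iff]
    refine ⟨fun σ => he ?_⟩
    refine Fintype.card_congr (σ.1.subtypeEquiv ?_)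
    intro k
    rw [σ.2 k]

end helpers

section helpers2

open Finset ComplexConjugate

theorem gaussC_density_meas : Measurable
    (fun z : ℂ => ENNReal.ofReal (Real.pi⁻¹ * Real.exp (-‖z‖ ^ 2))) := by
  fun_prop

theorem gaussC_norm_int (m : ℕ) :
    ∫ z : ℂ, ‖z‖ ^ m * Real.exp (-‖z‖ ^ 2) = Real.pi * Real.Gamma ((m + 2) / 2) := by
  have h := Complex.integral_rpow_mul_exp_neg_rpow (p := 2) (q := m) (by norm_num)
    (by have : (0:ℝ) ≤ m := Nat.cast_nonneg m
        linarith)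
  have e : ∀ z : ℂ, ‖z‖ ^ (m : ℝ) * Real.exp (-‖z‖ ^ (2:ℝ)) = ‖z‖ ^ m * Real.exp (-‖z‖ ^ 2) := by
    intro z
    rw [Real.rpow_natCast, Real.rpow_two]
  simp only [e] at h
  rw [h]; ring

theorem gaussC_norm_integrable (m : ℕ) :
    Integrable (fun z : ℂ => ‖z‖ ^ m * Real.exp (-‖z‖ ^ 2)) := by
  by_contra h
  have h1 := gaussC_norm_int m
  rw [integral_undef h] at h1
  have : 0 < Real.pi * Real.Gamma ((m + 2) / 2) :=
    mul_pos Real.pi_pos (Real.Gamma_pos_of_pos (by positivity))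
  linarith

theorem gaussC_integrable (p q : ℕ) :
    Integrable (fun z : ℂ => z ^ p * (conj z) ^ q) gaussianC := by
  unfold gaussianC
  rw [integrable_withDensity_iff_integrable_smul' gaussC_density_meas (by simp)]
  refine ((gaussC_norm_integrable (p + q)).const_mul (Real.pi⁻¹)).mono' ?_ ?_
  · apply Continuous.aestronglyMeasurable
    have : ∀ z : ℂ, (ENNReal.ofReal (Real.pi⁻¹ * Real.exp (-‖z‖ ^ 2))).toReal =
      Real.pi⁻¹ * Real.exp (-‖z‖ ^ 2) := fun z => ENNReal.toReal_ofReal (by positivity)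
    simp only [this]
    fun_prop
  · refine Filter.Eventually.of_forall fun z => ?_
    rw [ENNReal.toReal_ofReal (by positivity), norm_smul, Real.norm_of_nonneg (by positivity), norm_mul,
      norm_pow, norm_pow, RCLike.norm_conj, pow_add]
    apply le_of_eq; ring

theorem gaussC_integral_eq (p q : ℕ) :
    ∫ z, z ^ p * (conj z) ^ q ∂gaussianC =
      ∫ z : ℂ, (Real.pi⁻¹ * Real.exp (-‖z‖ ^ 2)) • (z ^ p * (conj z) ^ q) := by
  unfold gaussianC
  rw [integral_withDensity_eq_integral_toReal_smul gaussC_density_meas (by simp)]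
  congr 1
  ext z
  rw [ENNReal.toReal_ofReal (by positivity)]

theorem gaussC_moment (p q : ℕ) :
    ∫ z, z ^ p * (conj z) ^ q ∂gaussianC = ((if p = q then p.factorial else 0 : ℕ) : ℂ) := by
  rw [gaussC_integral_eq]
  split_ifs with h
  · subst h
    have e : ∀ z : ℂ, (Real.pi⁻¹ * Real.exp (-‖z‖ ^ 2)) • (z ^ p * (conj z) ^ p) =
        ((Real.pi⁻¹ * (‖z‖ ^ (2 * p) * Real.exp (-‖z‖ ^ 2)) : ℝ) : ℂ) := by
      intro z
      rw [← mul_pow, Complex.mul_conj, Complex.normSq_eq_norm_sq, Complex.real_smul]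
      push_cast
      ring
    simp only [e]
    rw [integral_complex_ofReal, integral_const_mul, gaussC_norm_int]
    have : (((2 * p : ℕ) : ℝ) + 2) / 2 = p + 1 := by push_cast; ring
    rw [this, Real.Gamma_nat_eq_factorial, ← mul_assoc, inv_mul_cancel₀ Real.pi_ne_zero, one_mul]
    simp
  · have hpq : ((p : ℝ) - q) ≠ 0 := sub_ne_zero.2 (by exact_mod_cast h)
    let w : Circle := Circle.exp (Real.pi / (p - q))
    have hw : (w : ℂ) ^ p * (conj (w : ℂ)) ^ q = -1 := by
      simp only [w]
      rw [← Circle.coe_inv_eq_conj, ← Circle.exp_neg, Circle.coe_exp, Circle.coe_exp,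
        ← Complex.exp_nat_mul, ← Complex.exp_nat_mul, ← Complex.exp_add, ← Complex.exp_pi_mul_I]
      congr 1
      have : ((p : ℂ) - q) ≠ 0 := by exact_mod_cast hpq
      push_cast
      field_simp
      ring
    have hmp := (rotation w).measurePreserving
    have := hmp.integral_comp (rotation w).toHomeomorph.measurableEmbedding
      (fun z : ℂ => (Real.pi⁻¹ * Real.exp (-‖z‖ ^ 2)) • (z ^ p * (conj z) ^ q))
    have e : ∀ z : ℂ, (Real.pi⁻¹ * Real.exp (-‖rotation w z‖ ^ 2)) •
        ((rotation w z) ^ p * (conj (rotation w z)) ^ q) =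
        - ((Real.pi⁻¹ * Real.exp (-‖z‖ ^ 2)) • (z ^ p * (conj z) ^ q)) := by
      intro z
      rw [LinearIsometryEquiv.norm_map, rotation_apply, map_mul, mul_pow, mul_pow, ← smul_neg]
      congr 1
      linear_combination (z ^ p * (conj z) ^ q) * hw
    simp only [e] at this
    rw [integral_neg] at this
    rw [Nat.cast_zero]
    exact self_eq_neg.1 this.symm

instance gaussC_finite : IsFiniteMeasure gaussianC := by
  have := gaussC_integrable 0 0
  simp only [pow_zero, mul_one] at this
  rw [integrable_const_iff] at this
  simpa using this

theorem gaussC_wick {ι : Type*} [Fintype ι] [DecidableEq ι] {n : ℕ} (a b : Fin n → ι) :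
    Integrable (fun f : ι → ℂ => (∏ k, f (a k)) * conj (∏ k, f (b k)))
      (Measure.pi fun _ => gaussianC) ∧
    ∫ f : ι → ℂ, (∏ k, f (a k)) * conj (∏ k, f (b k)) ∂(Measure.pi fun _ => gaussianC) =
      (Fintype.card {σ : Equiv.Perm (Fin n) // ∀ k, a k = b (σ k)} : ℂ) := by
  have e0 : ∀ (c : Fin n → ι) (f : ι → ℂ), ∏ k, f (c k) =
      ∏ e, f e ^ Fintype.card {k // c k = e} := by
    intro c f
    rw [← Finset.prod_fiberwise' univ c f]
    refine Finset.prod_congr rfl fun e _ => ?_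
    rw [Finset.prod_const, Fintype.card_subtype]
  have e1 : ∀ f : ι → ℂ, (∏ k, f (a k)) * conj (∏ k, f (b k)) =
      ∏ e, (f e ^ Fintype.card {k // a k = e} * (conj (f e)) ^ Fintype.card {k // b k = e}) := by
    intro f
    rw [e0, e0, map_prod, ← Finset.prod_mul_distrib]
    simp only [map_pow]
  simp only [e1]
  constructor
  · exact Integrable.fintype_prod (f := fun e z => z ^ Fintype.card {k // a k = e} *
      (conj z) ^ Fintype.card {k // b k = e}) (fun e => gaussC_integrable _ _)
  · rw [integral_fintype_prod_eq_prod (fun e z => z ^ Fintype.card {k // a k = e} *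
      (conj z) ^ Fintype.card {k // b k = e}), card_perm_fiber]
    push_cast
    refine Finset.prod_congr rfl fun e _ => ?_
    rw [gaussC_moment]
    push_cast
    rfl

end helpers2

section helpers3

open Finset ComplexConjugate

theorem card_invariant_fun {α : Type*} [Fintype α] [DecidableEq α] (c : Equiv.Perm α) (N : ℕ) :
    Nat.card {q : α → Fin N // ∀ v, q (c v) = q v} =
      N ^ Nat.card (MulAction.orbitRel.Quotient (Subgroup.zpowers c) α) := by
  have E : {q : α → Fin N // ∀ v, q (c v) = q v} ≃
      (MulAction.orbitRel.Quotient (Subgroup.zpowers c) α → Fin N) :=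
    { toFun := fun q => Quotient.lift q.1 (by
        rintro x y ⟨⟨_, k, rfl⟩, h⟩
        have key : ∀ (m : ℕ) v, q.1 ((c ^ m) v) = q.1 v := by
          intro m
          induction m with
          | zero => simp
          | succ m ih => intro v; rw [pow_succ', Equiv.Perm.mul_apply, q.2, ih]
        have h' : (c ^ k) y = x := h
        rw [← h']
        obtain ⟨m, rfl | rfl⟩ := Int.eq_nat_or_neg k
        · rw [zpow_natCast, key]
        · rw [← key m]; simp)
      invFun := fun r => ⟨fun v => r (Quotient.mk _ v), fun v => by
        refine congrArg r (Quotient.sound ?_)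
        exact ⟨⟨c, 1, by simp⟩, rfl⟩⟩
      left_inv := fun q => by ext v; rfl
      right_inv := fun r => by
        ext x
        induction x using Quotient.inductionOn
        rfl }
  rw [Nat.card_congr E, Nat.card_fun, Nat.card_fin]

theorem pow_apply_path {N : ℕ} (X : Matrix (Fin N) (Fin N) ℂ) (n : ℕ) (i j : Fin N) :
    (X ^ n) i j = ∑ p : Fin (n+1) → Fin N, if p 0 = i ∧ p (Fin.last n) = j then
      ∏ k : Fin n, X (p k.castSucc) (p k.succ) else 0 := by
  induction n generalizing i with
  | zero =>
    rw [← (Equiv.funUnique (Fin 1) (Fin N)).symm.sum_comp, Finset.sum_eq_single i]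
    · simp [Matrix.one_apply]
    · intro b _ hb
      rw [if_neg]
      rintro ⟨h, _⟩; exact hb h
    · simp
  | succ n ih =>
    rw [pow_succ', Matrix.mul_apply]
    simp only [ih]
    rw [← (Fin.consEquiv (fun _ : Fin (n+2) => Fin N)).sum_comp, Fintype.sum_prod_type]
    symm
    rw [Finset.sum_eq_single i]
    symm
    · simp only [Finset.mul_sum]
      rw [Finset.sum_comm]
      refine Finset.sum_congr rfl fun p _ => ?_
      rw [Finset.sum_eq_single (p 0)]
      · simp only [Fin.consEquiv, Equiv.coe_fn_mk, Fin.cons_zero, true_and]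
        rw [← Fin.succ_last, Fin.cons_succ, Fin.prod_univ_succ]
        simp [Fin.cons_succ, ← Fin.succ_castSucc]
      · intro b _ hb
        rw [if_neg, mul_zero]
        rintro ⟨h, _⟩; exact hb h.symm
      · simp
    · intro b _ hb
      refine Finset.sum_eq_zero fun p _ => ?_
      rw [if_neg]
      rintro ⟨h, _⟩; exact hb h
    · simp

theorem trace_path {N : ℕ} (X : Matrix (Fin N) (Fin N) ℂ) (n : ℕ) :
    Matrix.trace (X ^ n * (X ^ n)ᴴ) = ∑ p : Fin (n+1) → Fin N, ∑ q : Fin (n+1) → Fin N,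
      if p 0 = q 0 ∧ p (Fin.last n) = q (Fin.last n) then
      (∏ k : Fin n, X (p k.castSucc) (p k.succ)) *
        conj (∏ k : Fin n, X (q k.castSucc) (q k.succ)) else 0 := by
  simp only [Matrix.trace, Matrix.diag_apply, Matrix.mul_apply, Matrix.conjTranspose_apply]
  simp only [pow_apply_path, star_sum, Finset.sum_mul_sum]
  rw [← Fintype.sum_prod_type', Finset.sum_comm]
  refine Finset.sum_congr rfl fun p _ => ?_
  rw [Finset.sum_comm]
  refine Finset.sum_congr rfl fun q _ => ?_
  rw [Finset.sum_eq_single (p 0, p (Fin.last n))]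
  · simp only [and_self, if_true]
    by_cases h : p 0 = q 0 ∧ p (Fin.last n) = q (Fin.last n)
    · rw [if_pos h, if_pos ⟨h.1.symm, h.2.symm⟩]; rfl
    · rw [if_neg h, if_neg (fun h' => h ⟨h'.1.symm, h'.2.symm⟩)]; simp
  · rintro ⟨x, y⟩ _ hb
    rw [if_neg, zero_mul]
    rintro ⟨rfl, rfl⟩; exact hb rfl
  · simp

theorem trace_measurable (N n : ℕ) :
    Measurable fun X : Matrix (Fin N) (Fin N) ℂ => Matrix.trace (X ^ n * (X ^ n)ᴴ) := by
  simp only [trace_path]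
  have h : ∀ i j, Measurable fun X : Matrix (Fin N) (Fin N) ℂ => X i j := fun i j =>
    (measurable_pi_apply j).comp (measurable_pi_apply i)
  refine Finset.measurable_fun_sum _ fun p _ => Finset.measurable_fun_sum _ fun q _ => ?_
  split_ifs
  · refine Measurable.mul ?_ (Complex.continuous_conj.measurable.comp ?_)
    · exact Finset.measurable_fun_prod _ fun k _ => h _ _
    · exact Finset.measurable_fun_prod _ fun k _ => h _ _
  · exact measurable_const

theorem succ_sub_one_aux {n : ℕ} (k : Fin n) : (k.succ : Fin (n+1)) - 1 = k.castSucc := by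
  rw [sub_eq_iff_eq_add, Fin.coeSucc_eq_succ]

theorem zero_sub_one_aux (n : ℕ) : (0 : Fin (n+1)) - 1 = Fin.last n := by
  rw [sub_eq_iff_eq_add, Fin.last_add_one]

theorem path_cond_abs {N n : ℕ} (P : Equiv.Perm (Fin (n+1))) (π : Equiv.Perm (Fin n))
    (h0 : P 0 = 0) (hs : ∀ k : Fin n, P k.succ = (π k).succ) (p q : Fin (n+1) → Fin N) :
    ((p 0 = q 0 ∧ p (Fin.last n) = q (Fin.last n)) ∧
      ∀ k : Fin n, (p k.castSucc, p k.succ) = (q (π k).castSucc, q (π k).succ)) ↔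
    (p = (fun k => q (P k)) ∧ ∀ v, q (P (P.symm (v + 1) - 1)) = q v) := by
  have h1 : ((p 0 = q 0 ∧ p (Fin.last n) = q (Fin.last n)) ∧
      ∀ k : Fin n, (p k.castSucc, p k.succ) = (q (π k).castSucc, q (π k).succ)) ↔
      ∀ k : Fin (n+1), p k = q (P k) ∧ p (k - 1) = q (P k - 1) := by
    rw [Fin.forall_fin_succ, h0, zero_sub_one_aux]
    refine and_congr Iff.rfl (forall_congr' fun k => ?_)
    rw [hs, succ_sub_one_aux, succ_sub_one_aux, Prod.mk.injEq, and_comm]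
  rw [h1, forall_and, ← funext_iff]
  refine and_congr_right fun hp => ?_
  subst hp
  constructor
  · intro h v
    have := h (P.symm (v + 1))
    rw [Equiv.apply_symm_apply, add_sub_cancel_right] at this
    exact this
  · intro h k
    have := h (P k - 1)
    rw [sub_add_cancel, Equiv.symm_apply_apply] at this
    exact this

theorem path_cond {N n : ℕ} (π : Equiv.Perm (Fin n)) (p q : Fin (n+1) → Fin N) :
    ((p 0 = q 0 ∧ p (Fin.last n) = q (Fin.last n)) ∧
      ∀ k : Fin n, (p k.castSucc, p k.succ) = (q (π k).castSucc, q (π k).succ)) ↔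
    (p = (fun k => q (pihat π k)) ∧ ∀ v, q (cpi π v) = q v) :=
  path_cond_abs (Equiv.Perm.decomposeFin.symm (0, π)) π
    (Equiv.Perm.decomposeFin_symm_apply_zero 0 π)
    (fun k => (Equiv.Perm.decomposeFin_symm_apply_succ π 0 k).trans (by simp)) p q

theorem card_pairs {N n : ℕ} (π : Equiv.Perm (Fin n)) :
    Nat.card {pq : (Fin (n+1) → Fin N) × (Fin (n+1) → Fin N) //
      (pq.1 0 = pq.2 0 ∧ pq.1 (Fin.last n) = pq.2 (Fin.last n)) ∧
      ∀ k : Fin n, (pq.1 k.castSucc, pq.1 k.succ) = (pq.2 (π k).castSucc, pq.2 (π k).succ)} =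
    N ^ A n π := by
  unfold A
  rw [← card_invariant_fun (α := ZMod (n+1))]
  refine Nat.card_congr
    { toFun := fun x => ⟨x.1.2, ((path_cond π x.1.1 x.1.2).1 x.2).2⟩
      invFun := fun q => ⟨(fun k => q.1 (pihat π k), q.1), (path_cond π _ _).2 ⟨rfl, q.2⟩⟩
      left_inv := ?_
      right_inv := fun q => rfl }
  rintro ⟨⟨p, q⟩, h⟩
  have := ((path_cond π p q).1 h).1
  subst this
  rfl

theorem sum_pow_A (n N : ℕ) : ∑ π : Equiv.Perm (Fin n), N ^ A n π = pn n N := by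
  classical
  have hA : ∀ π : Equiv.Perm (Fin n), 1 ≤ A n π ∧ A n π ≤ n + 1 ∧ A n π % 2 = (n + 1) % 2 := by
    intro π
    have h := card_orbits_parity (cpi π) (sign_cpi π)
    rw [ZMod.card] at h
    refine ⟨?_, h⟩
    unfold A
    have : Nonempty (MulAction.orbitRel.Quotient (Subgroup.zpowers (cpi π)) (ZMod (n+1))) :=
      ⟨Quotient.mk _ 0⟩
    have : Finite (MulAction.orbitRel.Quotient (Subgroup.zpowers (cpi π)) (ZMod (n+1))) :=
      Quotient.finite _
    exact Nat.card_pos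
  unfold pn
  rw [← Finset.sum_fiberwise_of_maps_to (s := univ) (t := Finset.range (n / 2 + 1))
    (g := fun π => (n + 1 - A n π) / 2)]
  · refine Finset.sum_congr rfl fun g hg => ?_
    rw [Finset.mem_range] at hg
    have hH : H n (n + 1 - 2 * g) =
        (univ.filter fun π : Equiv.Perm (Fin n) => (n + 1 - A n π) / 2 = g).card := by
      unfold H
      rw [Nat.card_eq_fintype_card, Fintype.card_subtype]
      congr 1
      ext π
      simp only [Finset.mem_filter, Finset.mem_univ, true_and]
      have := hA π
      omega
    rw [hH, Finset.sum_congr rfl (g := fun _ => N ^ (n + 1 - 2 * g)), Finset.sum_const, smul_eq_mul]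
    intro π hπ
    simp only [Finset.mem_filter, Finset.mem_univ, true_and] at hπ
    have := hA π
    congr 1
    omega
  · intro π _
    have := hA π
    rw [Finset.mem_range]
    omega

end helpers3

/-- The Gaussian matrix integral of `Tr (Xⁿ (Xⁿ)ᴴ)` over the complex Ginibre ensemble is
the polynomial `pn n N` whose coefficients are the Hultman numbers. -/
theorem ginibre_integral_trace_eq_hultman_polynomial (N : ℕ) (hN : 1 ≤ N) (n : ℕ) :
    ∫ X, Matrix.trace (X ^ n * (X ^ n)ᴴ) ∂(ginibre N) = (pn n N : ℂ) := by
  classical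
  unfold ginibre
  have hm : Measurable (fun f : Fin N × Fin N → ℂ => Matrix.of fun i j => f (i, j)) :=
    measurable_pi_lambda _ fun i => measurable_pi_lambda _ fun j => measurable_pi_apply (i, j)
  rw [integral_map hm.aemeasurable (trace_measurable N n).aestronglyMeasurable]
  simp only [trace_path, Matrix.of_apply]
  have hw := fun p q : Fin (n+1) → Fin N => gaussC_wick
    (fun k : Fin n => (p k.castSucc, p k.succ)) (fun k : Fin n => (q k.castSucc, q k.succ))
  have hI : ∀ p q : Fin (n+1) → Fin N, Integrable (fun f : Fin N × Fin N → ℂ =>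
      if p 0 = q 0 ∧ p (Fin.last n) = q (Fin.last n) then
      (∏ k : Fin n, f (p k.castSucc, p k.succ)) *
        (starRingEnd ℂ) (∏ k : Fin n, f (q k.castSucc, q k.succ)) else 0)
      (Measure.pi fun _ => gaussianC) := by
    intro p q
    split_ifs
    · exact (hw p q).1
    · exact integrable_zero _ _ _
  rw [integral_finsetSum _ fun p _ => integrable_finsetSum _ fun q _ => hI p q]
  simp only [integral_finsetSum _ fun q _ => hI _ q]
  have hv : ∀ p q : Fin (n+1) → Fin N, (∫ f : Fin N × Fin N → ℂ, (
      if p 0 = q 0 ∧ p (Fin.last n) = q (Fin.last n) then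
      (∏ k : Fin n, f (p k.castSucc, p k.succ)) *
        (starRingEnd ℂ) (∏ k : Fin n, f (q k.castSucc, q k.succ)) else 0)
      ∂(Measure.pi fun _ => gaussianC)) = ((∑ π : Equiv.Perm (Fin n),
        if (p 0 = q 0 ∧ p (Fin.last n) = q (Fin.last n)) ∧
          ∀ k : Fin n, (p k.castSucc, p k.succ) = (q (π k).castSucc, q (π k).succ)
        then 1 else 0 : ℕ) : ℂ) := by
    intro p q
    split_ifs with h
    · rw [(hw p q).2, Fintype.card_subtype, Finset.card_filter]
      simp only [h, and_self, true_and]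
    · simp [h]
  simp only [hv]
  rw [← sum_pow_A]
  norm_cast
  rw [← Fintype.sum_prod_type', Finset.sum_comm]
  refine Finset.sum_congr rfl fun π _ => ?_
  rw [← card_pairs, Nat.card_eq_fintype_card, Fintype.card_subtype, Finset.card_filter]
end

section
/- For every n ≥ 0 and every natural number N, Σ_{g=0}^{⌊n/2⌋} H(n, n+1−2g)·N^{n+1−2g} = n!·(Nat.choose (N+n+1) (n+2) − Nat.choose N (n+2)). Equivalently, the exponential generating function F(x,N) = Σ_{g≥0} Σ_{n≥2g} H(n,n+1−2g)·N^{n−2g+1}·x^n/n! equals x⁻²·((1−x)^{−N} − (1+x)^N). -/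
open Equiv.Perm in
theorem hu_trans_sign {Y : Type*} [Fintype Y] [DecidableEq Y] [Nonempty Y] (f : Equiv.Perm Y)
    (h : ∀ x y, SameCycle f x y) :
    (sign f : ℤˣ) = (-1) ^ (Fintype.card Y + 1) := by
  by_cases hs : Subsingleton Y
  · have : f = 1 := Subsingleton.elim _ _
    subst this
    have : Fintype.card Y = 1 := by
      rw [Fintype.card_eq_one_iff_nonempty_unique]
      exact ⟨⟨Classical.arbitrary Y⟩, fun _ => Subsingleton.elim _ _⟩
    simp [this]
  · rw [not_subsingleton_iff_nontrivial] at hs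
    have hne : ∀ x, f x ≠ x := by
      intro x hx
      obtain ⟨y, hy⟩ := exists_ne x
      obtain ⟨k, hk⟩ := h x y
      have : (f ^ k) x = x := by
        exact zpow_apply_eq_self_of_apply_eq_self hx k
      exact hy (by rw [← hk, this])
    have hc : IsCycle f := by
      let x := Classical.arbitrary Y
      exact ⟨x, hne x, fun y _ => h x y⟩
    rw [hc.sign]
    have : f.support = Finset.univ := by
      ext x; simp [hne x]
    rw [this, Finset.card_univ, pow_succ]
    simp

abbrev HuInv {X : Type*} (S : Finset X) (ζ : Equiv.Perm X) : Prop := ∀ x, ζ x ∈ S ↔ x ∈ S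

open Classical in
noncomputable def hurs {X : Type*} (S : Finset X) (ζ : Equiv.Perm X) : Equiv.Perm X :=
  if h : ∀ x, ζ x ∈ S ↔ x ∈ S then Equiv.Perm.ofSubtype (ζ.subtypePerm (p := fun x => x ∈ S) h)
    else 1

theorem hurs_mem {X : Type*} {S : Finset X} {ζ : Equiv.Perm X} (h : HuInv S ζ) {x : X}
    (hx : x ∈ S) : hurs S ζ x = ζ x := by
  unfold hurs
  rw [dif_pos h]
  classical
  exact Equiv.Perm.ofSubtype_apply_of_mem _ hx

theorem hurs_not_mem {X : Type*} {S : Finset X} {ζ : Equiv.Perm X} {x : X}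
    (hx : x ∉ S) : hurs S ζ x = x := by
  classical
  unfold hurs
  split_ifs with h
  · convert Equiv.Perm.ofSubtype_apply_of_not_mem _ hx
  · rfl

theorem HuInv.mul {X : Type*} {S : Finset X} {ζ ξ : Equiv.Perm X} (h : HuInv S ζ)
    (h' : HuInv S ξ) : HuInv S (ζ * ξ) := fun x => (h _).trans (h' x)

theorem HuInv.inv {X : Type*} {S : Finset X} {ζ : Equiv.Perm X} (h : HuInv S ζ) :
    HuInv S ζ⁻¹ := fun x => by
  have := h (ζ⁻¹ x)
  simpa using this.symm

theorem hurs_mul {X : Type*} {S : Finset X} {ζ ξ : Equiv.Perm X} (h : HuInv S ζ)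
    (h' : HuInv S ξ) : hurs S (ζ * ξ) = hurs S ζ * hurs S ξ := by
  ext x
  by_cases hx : x ∈ S
  · rw [hurs_mem (h.mul h') hx, Equiv.Perm.mul_apply, Equiv.Perm.mul_apply, hurs_mem h' hx,
      hurs_mem h ((h' x).2 hx)]
  · rw [hurs_not_mem hx, Equiv.Perm.mul_apply, hurs_not_mem hx, hurs_not_mem hx]

theorem hurs_union {X : Type*} [DecidableEq X] {S O : Finset X} {ζ : Equiv.Perm X}
    (h : HuInv S ζ) (h' : HuInv O ζ) (hd : Disjoint S O) :
    hurs (S ∪ O) ζ = hurs S ζ * hurs O ζ := by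
  have hu : HuInv (S ∪ O) ζ := fun x => by simp [h x, h' x]
  ext x
  rw [Equiv.Perm.mul_apply]
  by_cases hx : x ∈ O
  · rw [hurs_mem h' hx, hurs_mem hu (by simp [hx]), hurs_not_mem]
    exact fun hs => Finset.disjoint_left.1 hd hs ((h' x).2 hx)
  · rw [hurs_not_mem hx]
    by_cases hs : x ∈ S
    · rw [hurs_mem h hs, hurs_mem hu (by simp [hs])]
    · rw [hurs_not_mem hs, hurs_not_mem (by simp [hs, hx])]

theorem hurs_univ {X : Type*} [Fintype X] (ζ : Equiv.Perm X) : hurs Finset.univ ζ = ζ := by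
  ext x
  rw [hurs_mem (fun _ => by simp) (by simp)]

open Equiv.Perm in
theorem hurs_sign {X : Type*} [Fintype X] [DecidableEq X] {S : Finset X} {ζ : Equiv.Perm X}
    (h : HuInv S ζ) :
    sign (hurs S ζ) = sign (ζ.subtypePerm (p := fun x => x ∈ S) h) := by
  unfold hurs
  rw [dif_pos h]
  convert Equiv.Perm.sign_ofSubtype _

open Equiv.Perm in
theorem hurs_trans_sign {X : Type*} [Fintype X] [DecidableEq X] {S : Finset X} {ζ : Equiv.Perm X}
    (h : HuInv S ζ) (hne : S.Nonempty) (ht : ∀ x ∈ S, ∀ y ∈ S, SameCycle ζ x y) :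
    sign (hurs S ζ) = (-1) ^ (S.card + 1) := by
  rw [hurs_sign h]
  have : Nonempty {x // x ∈ S} := hne.coe_sort
  rw [hu_trans_sign]
  · simp
  · rintro ⟨x, hx⟩ ⟨y, hy⟩
    rw [Equiv.Perm.sameCycle_subtypePerm]
    exact ht x hx y hy

/-- parity of number of orbits -/
theorem hu_sign_orbits {X : Type*} [Fintype X] [DecidableEq X] (σ : Equiv.Perm X) :
    Equiv.Perm.sign σ = (-1) ^ (Fintype.card X +
      Nat.card (MulAction.orbitRel.Quotient (Subgroup.zpowers σ) X)) := by
  classical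
  let Q := MulAction.orbitRel.Quotient (Subgroup.zpowers σ) X
  let _i : Fintype Q := Fintype.ofFinite Q
  let mk : X → Q := fun x => Quotient.mk _ x
  have hmk : ∀ x y, mk x = mk y ↔ Equiv.Perm.SameCycle σ x y := by
    intro x y
    show (Quotient.mk _ x = Quotient.mk _ y) ↔ _
    rw [Quotient.eq]
    rw [MulAction.orbitRel_apply, MulAction.mem_orbit_iff]
    constructor
    · rintro ⟨⟨g, k, rfl⟩, hg⟩
      exact Equiv.Perm.SameCycle.symm ⟨k, hg⟩
    · intro h
      obtain ⟨k, hk⟩ := h.symm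
      exact ⟨⟨σ ^ k, k, rfl⟩, hk⟩
  have hms : ∀ x, mk (σ x) = mk x := fun x => by
    rw [hmk]; exact (Equiv.Perm.sameCycle_apply_left).2 (Equiv.Perm.SameCycle.refl _ _)
  have key : ∀ U : Finset Q, Equiv.Perm.sign (hurs (Finset.univ.filter fun x => mk x ∈ U) σ) =
      (-1) ^ ((Finset.univ.filter fun x => mk x ∈ U).card + U.card) := by
    intro U
    induction U using Finset.induction_on with
    | empty =>
      have : hurs (∅ : Finset X) σ = 1 := by ext x; rw [hurs_not_mem (by simp)]; rfl
      simp [this]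
    | insert q U hq ih =>
      have h1 : (Finset.univ.filter fun x => mk x ∈ insert q U) =
        (Finset.univ.filter fun x => mk x ∈ U) ∪ (Finset.univ.filter fun x => mk x = q) := by
        ext x; simp [or_comm]
      have hd : Disjoint (Finset.univ.filter fun x => mk x ∈ U)
          (Finset.univ.filter fun x => mk x = q) := by
        rw [Finset.disjoint_left]
        intro x hx hx'
        simp at hx hx'
        exact hq (hx' ▸ hx)
      rw [h1, hurs_union _ _ hd, Equiv.Perm.sign_mul, ih, hurs_trans_sign,
        Finset.card_union_of_disjoint hd, Finset.card_insert_of_notMem hq, ← pow_add]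
      · congr 1; ring
      · intro x; simp [hms]
      · obtain ⟨x, hx⟩ := Quotient.exists_rep q
        exact ⟨x, by simpa using hx⟩
      · intro x hx y hy
        simp at hx hy
        rw [← hmk, hx, hy]
      · intro x; simp [hms]
      · intro x; simp [hms]
  have := key Finset.univ
  simp only [Finset.mem_univ, Finset.filter_true, hurs_univ, Finset.card_univ] at this
  rw [this, Nat.card_eq_fintype_card]

theorem HuInv.zpow {X : Type*} {S : Finset X} {ζ : Equiv.Perm X} (h : HuInv S ζ) (k : ℤ) :
    HuInv S (ζ ^ k) := by
  induction k using Int.induction_on with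
  | zero => intro x; simp
  | succ i ih => rw [zpow_add, zpow_one]; exact ih.mul h
  | pred i ih => rw [zpow_sub, zpow_one]; exact ih.mul h.inv

theorem HuInv.sameCycle {X : Type*} {S : Finset X} {ζ : Equiv.Perm X} (h : HuInv S ζ) {x y : X}
    (hxy : Equiv.Perm.SameCycle ζ x y) : y ∈ S ↔ x ∈ S := by
  obtain ⟨k, rfl⟩ := hxy
  exact h.zpow k x

open Classical in
noncomputable def hue {X : Type*} [Fintype X] [DecidableEq X] (S : Finset X) (ζ : Equiv.Perm X) : ℤ :=
  if HuInv S ζ then (Equiv.Perm.sign (hurs S ζ) : ℤ) else 0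

open Classical in
theorem hu_newton {X : Type*} [Fintype X] [DecidableEq X] (x0 : X) (ζ : Equiv.Perm X) :
    ∑ S ∈ (Finset.univ : Finset (Finset X)).filter (fun S => x0 ∈ S),
      (-1 : ℤ) ^ (S.card + 1) * hue S ζ
    = if (∀ x y, Equiv.Perm.SameCycle ζ x y) then 1 else 0 := by
  split_ifs with ht
  · rw [Finset.sum_eq_single_of_mem Finset.univ (by simp)]
    · unfold hue
      rw [if_pos (fun x => by simp), hurs_univ]
      have : Nonempty X := ⟨x0⟩
      rw [hu_trans_sign ζ ht, Finset.card_univ]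
      push_cast
      rw [← mul_pow]
      simp
    · intro S hS hne
      simp only [Finset.mem_filter, Finset.mem_univ, true_and] at hS
      unfold hue
      rw [if_neg, mul_zero]
      intro h
      apply hne
      ext y
      simp [h.sameCycle (ht x0 y), hS]
  · obtain ⟨x, hx⟩ : ∃ x, ¬ Equiv.Perm.SameCycle ζ x x0 := by
      by_contra hcon
      push Not at hcon
      exact ht fun x y => (hcon x).trans (hcon y).symm
    set O : Finset X := Finset.univ.filter fun y => Equiv.Perm.SameCycle ζ x y with hO
    have hOi : HuInv O ζ := fun y => by simp [hO]
    have hxO : x ∈ O := by simp [hO, Equiv.Perm.SameCycle.refl]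
    have hx0O : x0 ∉ O := by simpa [hO] using hx
    have hOs : Equiv.Perm.sign (hurs O ζ) = (-1) ^ (O.card + 1) := by
      apply hurs_trans_sign hOi ⟨x, hxO⟩
      intro y hy z hz
      simp [hO] at hy hz
      exact hy.symm.trans hz
    have hOsub : ∀ S, HuInv S ζ → x ∈ S → O ⊆ S := by
      intro S hS hxS y hy
      simp [hO] at hy
      exact (hS.sameCycle hy).2 hxS
    have hOdis : ∀ S, HuInv S ζ → x ∉ S → Disjoint S O := by
      intro S hS hxS
      rw [Finset.disjoint_left]
      intro y hyS hy
      simp [hO] at hy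
      exact hxS ((hS.sameCycle hy).1 hyS)
    have hU : ∀ S, HuInv S ζ → HuInv (S ∪ O) ζ := fun S hS y => by simp only [Finset.mem_union, hS y, hOi y]
    have hD : ∀ S, HuInv S ζ → HuInv (S \ O) ζ := fun S hS y => by simp only [Finset.mem_sdiff, hS y, hOi y]
    have hflip : ∀ S, HuInv S ζ → Disjoint S O →
        (-1 : ℤ) ^ ((S ∪ O).card + 1) * hue (S ∪ O) ζ = - ((-1 : ℤ) ^ (S.card + 1) * hue S ζ) := by
      intro S hS hd
      unfold hue
      rw [if_pos hS, if_pos (hU S hS), hurs_union hS hOi hd, Equiv.Perm.sign_mul, hOs,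
        Finset.card_union_of_disjoint hd]
      push_cast
      have : (-1 : ℤ) ^ O.card * (-1) ^ O.card = 1 := by rw [← mul_pow]; simp
      linear_combination (- (-1 : ℤ) ^ (S.card + 1) * (Equiv.Perm.sign (hurs S ζ) : ℤ)) * this
    have hsplit : ∀ S ∈ (Finset.univ : Finset (Finset X)).filter (fun S => x0 ∈ S),
        S ∉ (Finset.univ : Finset (Finset X)).filter (fun S => x0 ∈ S ∧ HuInv S ζ) →
        (-1 : ℤ) ^ (S.card + 1) * hue S ζ = 0 := by
      intro S h1 h2
      have : ¬ HuInv S ζ := by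
        simp only [Finset.mem_filter, Finset.mem_univ, true_and] at h1 h2
        tauto
      unfold hue
      rw [if_neg this, mul_zero]
    rw [← Finset.sum_subset _ hsplit]
    · refine Finset.sum_involution (fun S _ => if x ∈ S then S \ O else S ∪ O) ?_ ?_ ?_ ?_
      · intro S hS
        simp only [Finset.mem_filter, Finset.mem_univ, true_and] at hS
        split_ifs with hxS
        · have := hflip (S \ O) (hD S hS.2) Finset.sdiff_disjoint
          rw [Finset.sdiff_union_of_subset (hOsub S hS.2 hxS)] at this
          rw [this]; ring
        · rw [hflip S hS.2 (hOdis S hS.2 hxS)]; ring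
      · intro S hS _ heq
        split_ifs at heq with hxS
        · rw [← heq] at hxS
          simp [hxO] at hxS
        · rw [← heq] at hxS
          simp [hxO] at hxS
      · intro S hS
        simp only [Finset.mem_filter, Finset.mem_univ, true_and] at hS ⊢
        split_ifs with hxS
        · exact ⟨by simp [hS.1, hx0O], hD S hS.2⟩
        · exact ⟨by simp [hS.1], hU S hS.2⟩
      · intro S hS
        simp only [Finset.mem_filter, Finset.mem_univ, true_and] at hS
        by_cases hxS : x ∈ S
        · simp only [if_pos hxS]
          rw [if_neg (by simp [hxO]), Finset.sdiff_union_of_subset (hOsub S hS.2 hxS)]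
        · simp only [if_neg hxS]
          rw [if_pos (by simp [hxO]), Finset.union_sdiff_cancel_right (hOdis S hS.2 hxS)]
    · intro S hS
      simp only [Finset.mem_filter, Finset.mem_univ, true_and] at hS ⊢
      exact hS.1

noncomputable def huW (N : ℕ) {X : Type*} (σ : Equiv.Perm X) : ℕ :=
  Nat.card {f : X → ZMod N // ∀ x, f (σ x) = f x}

theorem huW_comm (N : ℕ) {X : Type*} (σ τ : Equiv.Perm X) : huW N (σ * τ) = huW N (τ * σ) := by
  apply Nat.card_congr
  refine ⟨fun f => ⟨fun x => f.1 (σ x), fun x => by simpa using f.2 (σ x)⟩,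
    fun f => ⟨fun x => f.1 (σ⁻¹ x), fun x => ?_⟩, ?_, ?_⟩
  · have := f.2 (σ⁻¹ x)
    simpa using this
  · intro f; ext x; simp
  · intro f; ext x; simp

theorem huW_permCongr (N : ℕ) {X Y : Type*} (e : X ≃ Y) (σ : Equiv.Perm X) :
    huW N (e.permCongr σ) = huW N σ := by
  apply Nat.card_congr
  refine ⟨fun f => ⟨fun x => f.1 (e x), fun x => by simpa using f.2 (e x)⟩,
    fun f => ⟨fun x => f.1 (e.symm x), fun x => ?_⟩, ?_, ?_⟩
  · have := f.2 (e.symm x)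
    simpa using this
  · intro f; ext x; simp
  · intro f; ext x; simp

theorem huW_swap (N : ℕ) {X : Type*} [DecidableEq X] {T : Finset X} {ζ : Equiv.Perm X}
    (h : HuInv T ζ) {a b : X} (ha : a ∈ T) (hb : b ∉ T) :
    N * huW N (ζ * Equiv.swap a b) = huW N ζ := by
  have hab : a ≠ b := fun h => hb (h ▸ ha)
  have key : ∀ f : X → ZMod N, (∀ x, f ((ζ * Equiv.swap a b) x) = f x) ↔
      (∀ x, f (ζ x) = f x) ∧ f a = f b := by
    intro f
    constructor
    · intro hf
      have hf' : ∀ x, f (ζ x) = f (Equiv.swap a b x) := by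
        intro x
        have := hf (Equiv.swap a b x)
        simpa using this
      have hm : ∑ x ∈ T, Finsupp.single (f (Equiv.swap a b x)) (1:ℕ) =
          ∑ x ∈ T, Finsupp.single (f x) (1:ℕ) := by
        simp_rw [← hf']
        refine Finset.sum_equiv ζ (fun x => (h x).symm) (fun x _ => rfl)
      rw [← Finset.add_sum_erase T _ ha, ← Finset.add_sum_erase T _ ha] at hm
      have hr : ∑ x ∈ T.erase a, Finsupp.single (f (Equiv.swap a b x)) (1:ℕ) =
          ∑ x ∈ T.erase a, Finsupp.single (f x) (1:ℕ) := by
        apply Finset.sum_congr rfl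
        intro x hx
        rw [Equiv.swap_apply_of_ne_of_ne (Finset.ne_of_mem_erase hx)]
        rintro rfl
        exact hb (Finset.mem_of_mem_erase hx)
      rw [hr, Equiv.swap_apply_left] at hm
      have hm' := add_right_cancel hm
      have hfab : f a = f b := ((Finsupp.single_left_inj one_ne_zero).1 hm').symm
      refine ⟨fun x => ?_, hfab⟩
      rw [hf']
      by_cases hxa : x = a
      · subst hxa; simp [hfab]
      · by_cases hxb : x = b
        · subst hxb; simp [hfab]
        · rw [Equiv.swap_apply_of_ne_of_ne hxa hxb]
    · rintro ⟨hf, hfab⟩ x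
      rw [Equiv.Perm.mul_apply, hf]
      by_cases hxa : x = a
      · subst hxa; simp [hfab]
      · by_cases hxb : x = b
        · subst hxb; simp [hfab]
        · rw [Equiv.swap_apply_of_ne_of_ne hxa hxb]
  have hN : N = Nat.card (ZMod N) := by simp
  unfold huW
  refine (congrArg (· * _) hN).trans ?_
  rw [← Nat.card_prod]
  apply Nat.card_congr
  refine ⟨fun p => ⟨fun x => p.2.1 x + if x ∈ T then p.1 else 0, fun x => ?_⟩,
    fun f => (f.1 a - f.1 b, ⟨fun x => f.1 x - if x ∈ T then f.1 a - f.1 b else 0, ?_⟩), ?_, ?_⟩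
  · have := ((key _).1 p.2.2).1 x
    simp [this, h x]
  · refine (key (fun x => f.1 x - if x ∈ T then f.1 a - f.1 b else 0)).2 ⟨fun x => ?_, ?_⟩
    · have := f.2 x
      simp [this, h x]
    · simp [ha, hb]
  · rintro ⟨c, f, hf⟩
    have := ((key _).1 hf).2
    have hc : f a + c - f b = c := by rw [this]; ring
    ext
    · simp [ha, hb, hc]
    · simp [ha, hb, hc]
  · rintro ⟨f, hf⟩
    ext
    simp

theorem huW_orbits (N : ℕ) {X : Type*} [Finite X] (σ : Equiv.Perm X) :
    huW N σ = N ^ Nat.card (MulAction.orbitRel.Quotient (Subgroup.zpowers σ) X) := by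
  have hN : N = Nat.card (ZMod N) := by simp
  conv_rhs => rw [hN]
  have : Finite (MulAction.orbitRel.Quotient (Subgroup.zpowers σ) X) := Quotient.finite _
  rw [← Nat.card_fun]
  apply Nat.card_congr
  refine ⟨fun f => Quotient.lift f.1 ?_, fun g => ⟨fun x => g (Quotient.mk _ x), ?_⟩, ?_, ?_⟩
  · intro x y hxy
    obtain ⟨⟨g, k, rfl⟩, hg⟩ := MulAction.mem_orbit_iff.1 (MulAction.orbitRel_apply.1 hxy)
    have : ∀ (k : ℤ) (y : X), f.1 ((σ ^ k) y) = f.1 y := by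
      intro k
      induction k using Int.induction_on with
      | zero => intro y; simp
      | succ i ih => intro y; rw [zpow_add, zpow_one, Equiv.Perm.mul_apply, ih, f.2]
      | pred i ih =>
        intro y
        rw [zpow_sub, zpow_one, Equiv.Perm.mul_apply, ih]
        have := f.2 (σ⁻¹ y)
        simpa using this.symm
    rw [← this k y]
    exact congrArg f.1 hg.symm
  · intro x
    refine congrArg g ?_
    apply Quotient.sound
    show (MulAction.orbitRel _ _) _ _
    rw [MulAction.orbitRel_apply, MulAction.mem_orbit_iff]
    exact ⟨⟨σ, Subgroup.mem_zpowers σ⟩, rfl⟩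
  · intro f; rfl
  · intro g; ext q
    induction q using Quotient.inductionOn
    rfl

noncomputable def huSplit {X : Type*} [DecidableEq X] (S : Finset X) :
    {ζ : Equiv.Perm X // HuInv S ζ} ≃ Equiv.Perm {x // x ∈ S} × Equiv.Perm {x // ¬ x ∈ S} where
  toFun ζ := (ζ.1.subtypePerm (p := fun x => x ∈ S) ζ.2,
    ζ.1.subtypePerm (p := fun x => ¬ x ∈ S) (fun x => not_congr (ζ.2 x)))
  invFun q := ⟨Equiv.Perm.subtypeCongr q.1 q.2, fun x => by
    by_cases hx : x ∈ S
    · simp [Equiv.Perm.subtypeCongr.left_apply, hx]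
    · simp only [Equiv.Perm.subtypeCongr.right_apply _ _ hx, hx, iff_false]
      exact (q.2 ⟨x, hx⟩).2⟩
  left_inv ζ := by
    ext x
    by_cases hx : x ∈ S
    · simp [Equiv.Perm.subtypeCongr.left_apply, hx]
    · simp [Equiv.Perm.subtypeCongr.right_apply _ _ hx]
  right_inv q := by
    ext ⟨x, hx⟩
    · simp [Equiv.Perm.subtypeCongr.left_apply, hx]
    · simp [Equiv.Perm.subtypeCongr.right_apply _ _ hx]

theorem huW_prod (N : ℕ) {X : Type*} [DecidableEq X] {S : Finset X} {ζ : Equiv.Perm X}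
    (h : HuInv S ζ) :
    huW N ζ = huW N (ζ.subtypePerm (p := fun x => x ∈ S) h) *
      huW N (ζ.subtypePerm (p := fun x => ¬ x ∈ S) (fun x => not_congr (h x))) := by
  unfold huW
  rw [← Nat.card_prod]
  apply Nat.card_congr
  refine ⟨fun f => (⟨fun x => f.1 x.1, fun x => f.2 _⟩, ⟨fun x => f.1 x.1, fun x => f.2 _⟩),
    fun q => ⟨fun x => if hx : x ∈ S then q.1.1 ⟨x, hx⟩ else q.2.1 ⟨x, hx⟩, fun x => ?_⟩, ?_, ?_⟩
  · beta_reduce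
    by_cases hx : x ∈ S
    · rw [dif_pos hx, dif_pos ((h x).2 hx)]
      exact q.1.2 ⟨x, hx⟩
    · rw [dif_neg hx, dif_neg (fun h' => hx ((h x).1 h'))]
      exact q.2.2 ⟨x, hx⟩
  · intro f; ext x; simp
  · intro q; ext ⟨x, hx⟩
    · simp [hx]
    · simp [hx]

open Classical in
theorem hu_sum_prod (N : ℕ) {X : Type*} [Fintype X] [DecidableEq X] (S : Finset X) :
    ∑ ζ : Equiv.Perm X, hue S ζ * (huW N ζ : ℤ) =
      (∑ σ : Equiv.Perm {x // x ∈ S}, (Equiv.Perm.sign σ : ℤ) * (huW N σ : ℤ)) *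
      (∑ σ : Equiv.Perm {x // ¬ x ∈ S}, (huW N σ : ℤ)) := by
  rw [Finset.sum_mul_sum, ← Fintype.sum_prod_type']
  rw [← Equiv.sum_comp (huSplit S)]
  rw [← Finset.sum_filter_add_sum_filter_not Finset.univ (fun ζ => HuInv S ζ)]
  have h0 : ∑ ζ ∈ Finset.univ.filter (fun ζ => ¬ HuInv S ζ), hue S ζ * (huW N ζ : ℤ) = 0 := by
    apply Finset.sum_eq_zero
    intro ζ hζ
    simp only [Finset.mem_filter, Finset.mem_univ, true_and] at hζ
    unfold hue
    rw [if_neg hζ, zero_mul]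
  rw [h0, add_zero]
  rw [← Finset.sum_subtype_of_mem (p := fun ζ => HuInv S ζ)]
  · have : Finset.subtype (fun ζ => HuInv S ζ) (Finset.univ.filter (fun ζ => HuInv S ζ)) =
      Finset.univ := by ext ζ; simpa using ζ.2
    rw [this]
    apply Finset.sum_congr rfl
    rintro ⟨ζ, hζ⟩ _
    simp only [huSplit, Equiv.coe_fn_mk]
    rw [huW_prod N hζ]
    unfold hue
    rw [if_pos hζ, hurs_sign hζ]
    push_cast
    ring
  · intro ζ hζ
    simpa using hζ

theorem huW_dec_zero (N k : ℕ) (e : Equiv.Perm (Fin k)) :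
    huW N (Equiv.Perm.decomposeFin.symm (0, e)) = N * huW N e := by
  have hN : N = Nat.card (ZMod N) := by simp
  unfold huW
  refine Eq.trans ?_ (congrArg (· * _) hN).symm
  rw [← Nat.card_prod]
  apply Nat.card_congr
  refine ⟨fun f => (f.1 0, ⟨fun x => f.1 x.succ, fun x => ?_⟩),
    fun q => ⟨Fin.cons q.1 q.2.1, fun x => ?_⟩, ?_, ?_⟩
  · have := f.2 x.succ
    simpa using this
  · refine Fin.cases ?_ (fun i => ?_) x
    · simp
    · simpa using q.2.2 i
  · rintro ⟨f, hf⟩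
    ext x
    refine Fin.cases ?_ (fun i => ?_) x <;> simp
  · intro q; ext <;> simp

theorem huW_dec (N k : ℕ) (hN : 0 < N) (e : Equiv.Perm (Fin k)) (p : Fin (k+1)) (hp : p ≠ 0) :
    huW N (Equiv.Perm.decomposeFin.symm (p, e)) = huW N e := by
  have h1 : Equiv.Perm.decomposeFin.symm (p, e) =
      Equiv.swap 0 p * Equiv.Perm.decomposeFin.symm (0, e) := by
    ext x
    refine Fin.cases ?_ (fun i => ?_) x <;> simp
  have hi : HuInv {0} (Equiv.Perm.decomposeFin.symm (0, e)) := by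
    intro x
    refine Fin.cases ?_ (fun i => ?_) x <;> simp
  have h2 := huW_swap N hi (a := 0) (b := p) (by simp) (by simpa using hp)
  rw [h1, huW_comm]
  rw [huW_dec_zero] at h2
  exact Nat.eq_of_mul_eq_mul_left hN h2

theorem hu_rise_fin (N k : ℕ) (hN : 0 < N) :
    ∑ σ : Equiv.Perm (Fin k), (huW N σ : ℤ) = (N.ascFactorial k : ℤ) := by
  induction k with
  | zero =>
    simp [huW]
  | succ k ih =>
    rw [← Equiv.sum_comp Equiv.Perm.decomposeFin.symm, Fintype.sum_prod_type,
      Fin.sum_univ_succ]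
    simp_rw [huW_dec_zero, fun (i : Fin k) e => huW_dec N k hN e i.succ (Fin.succ_ne_zero i)]
    simp only [Nat.cast_mul, ← Finset.mul_sum, ih]
    rw [Nat.ascFactorial_succ]
    simp
    ring

theorem hu_fall_fin (N k : ℕ) (hN : 0 < N) :
    ∑ σ : Equiv.Perm (Fin k), (Equiv.Perm.sign σ : ℤ) * (huW N σ : ℤ) =
      (N.descFactorial k : ℤ) := by
  induction k with
  | zero =>
    simp [huW]
  | succ k ih =>
    rw [← Equiv.sum_comp Equiv.Perm.decomposeFin.symm, Fintype.sum_prod_type,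
      Fin.sum_univ_succ]
    simp_rw [huW_dec_zero, fun (i : Fin k) e => huW_dec N k hN e i.succ (Fin.succ_ne_zero i)]
    have h1 : ∀ e : Equiv.Perm (Fin k), ((Equiv.Perm.sign
      (Equiv.Perm.decomposeFin.symm ((0 : Fin (k+1)), e)) : ℤˣ) : ℤ) * ((N * huW N e : ℕ) : ℤ) =
      N * ((Equiv.Perm.sign e : ℤ) * (huW N e : ℤ)) := by
      intro e
      rw [Equiv.Perm.decomposeFin.symm_sign]
      simp
      ring
    have h2 : ∀ (i : Fin k) (e : Equiv.Perm (Fin k)), ((Equiv.Perm.sign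
      (Equiv.Perm.decomposeFin.symm (i.succ, e)) : ℤˣ) : ℤ) * (huW N e : ℤ) =
      - ((Equiv.Perm.sign e : ℤ) * (huW N e : ℤ)) := by
      intro i e
      rw [Equiv.Perm.decomposeFin.symm_sign]
      simp [Fin.succ_ne_zero]
    simp_rw [h1, h2, Finset.sum_neg_distrib, ← Finset.mul_sum, ih]
    rw [Nat.descFactorial_succ]
    by_cases h : k ≤ N
    · rw [Nat.cast_mul, Nat.cast_sub h]
      simp
      ring
    · rw [Nat.descFactorial_of_lt (by omega)]
      simp

theorem hu_rise (N : ℕ) (hN : 0 < N) (Y : Type*) [Fintype Y] [DecidableEq Y] :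
    ∑ σ : Equiv.Perm Y, (huW N σ : ℤ) = (N.ascFactorial (Fintype.card Y) : ℤ) := by
  rw [← hu_rise_fin N _ hN, ← Equiv.sum_comp (Fintype.equivFin Y).permCongr]
  simp_rw [huW_permCongr]

theorem hu_fall (N : ℕ) (hN : 0 < N) (Y : Type*) [Fintype Y] [DecidableEq Y] :
    ∑ σ : Equiv.Perm Y, (Equiv.Perm.sign σ : ℤ) * (huW N σ : ℤ) =
      (N.descFactorial (Fintype.card Y) : ℤ) := by
  rw [← hu_fall_fin N _ hN, ← Equiv.sum_comp (Fintype.equivFin Y).permCongr]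
  simp_rw [huW_permCongr, Equiv.Perm.sign_permCongr]

theorem hue_mul_right {X : Type*} [Fintype X] [DecidableEq X] {S : Finset X} {ξ : Equiv.Perm X}
    (h : HuInv S ξ) (ζ : Equiv.Perm X) :
    hue S (ζ * ξ) = hue S ζ * (Equiv.Perm.sign (hurs S ξ) : ℤ) := by
  classical
  unfold hue
  by_cases hz : HuInv S ζ
  · rw [if_pos hz, if_pos (hz.mul h), hurs_mul hz h, Equiv.Perm.sign_mul]
    push_cast
    rfl
  · rw [if_neg hz, if_neg, zero_mul]
    intro h'
    apply hz
    have := h'.mul h.inv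
    simpa using this

theorem hue_mul_left {X : Type*} [Fintype X] [DecidableEq X] {S : Finset X} {ξ : Equiv.Perm X}
    (h : HuInv S ξ) (ζ : Equiv.Perm X) :
    hue S (ξ * ζ) = (Equiv.Perm.sign (hurs S ξ) : ℤ) * hue S ζ := by
  classical
  unfold hue
  by_cases hz : HuInv S ζ
  · rw [if_pos hz, if_pos (h.mul hz), hurs_mul h hz, Equiv.Perm.sign_mul]
    push_cast
    rfl
  · rw [if_neg hz, if_neg, mul_zero]
    intro h'
    apply hz
    have := h.inv.mul h'
    simpa [← mul_assoc] using this

theorem hu_swap_out {X : Type*} [DecidableEq X] {S : Finset X} {a b : X}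
    (ha : a ∉ S) (hb : b ∉ S) : HuInv S (Equiv.swap a b) ∧ hurs S (Equiv.swap a b) = 1 := by
  have h : HuInv S (Equiv.swap a b) := by
    intro x
    rw [Equiv.swap_apply_def]
    split_ifs with h1 h2
    · subst h1; simp [ha, hb]
    · subst h2; simp [ha, hb]
    · rfl
  refine ⟨h, ?_⟩
  ext x
  by_cases hx : x ∈ S
  · rw [hurs_mem h hx, Equiv.swap_apply_of_ne_of_ne]
    · rfl
    · rintro rfl; exact ha hx
    · rintro rfl; exact hb hx
  · rw [hurs_not_mem hx]; rfl

theorem hu_swap_in {X : Type*} [DecidableEq X] {S : Finset X} {a b : X}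
    (ha : a ∈ S) (hb : b ∈ S) :
    HuInv S (Equiv.swap a b) ∧ hurs S (Equiv.swap a b) = Equiv.swap a b := by
  have h : HuInv S (Equiv.swap a b) := by
    intro x
    rw [Equiv.swap_apply_def]
    split_ifs with h1 h2
    · subst h1; simp [ha, hb]
    · subst h2; simp [ha, hb]
    · rfl
  refine ⟨h, ?_⟩
  ext x
  by_cases hx : x ∈ S
  · rw [hurs_mem h hx]
  · rw [hurs_not_mem hx, Equiv.swap_apply_of_ne_of_ne]
    · rintro rfl; exact hx ha
    · rintro rfl; exact hx hb

theorem hu_G_zero (N : ℕ) {X : Type*} [Fintype X] [DecidableEq X] (S : Finset X)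
    (s : Equiv.Perm X) {a b : X} (hab : a ≠ b) (ha : a ∉ S) (hb : b ∉ S) (hsa : s a ∈ S)
    (hsb : s b ∈ S) : ∑ ζ : Equiv.Perm X, hue S ζ * (huW N (s * ζ) : ℤ) = 0 := by
  obtain ⟨i1, r1⟩ := hu_swap_out ha hb
  obtain ⟨i2, r2⟩ := hu_swap_in hsa hsb
  have key : ∀ ζ : Equiv.Perm X, hue S (Equiv.swap a b * (ζ * Equiv.swap (s a) (s b))) *
      (huW N (s * (Equiv.swap a b * (ζ * Equiv.swap (s a) (s b)))) : ℤ) =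
      - (hue S ζ * (huW N (s * ζ) : ℤ)) := by
    intro ζ
    rw [hue_mul_left i1, hue_mul_right i2, r1, r2, Equiv.Perm.sign_swap (s.injective.ne hab)]
    have h1 : s * (Equiv.swap a b * (ζ * Equiv.swap (s a) (s b))) =
        Equiv.swap (s a) (s b) * ((s * ζ) * Equiv.swap (s a) (s b)) := by
      rw [Equiv.swap_apply_apply]
      group
    rw [h1, huW_comm, mul_assoc (s * ζ), Equiv.swap_mul_self]
    simp
  have h2 := Equiv.sum_comp ((Equiv.mulRight (Equiv.swap (s a) (s b))).trans
    (Equiv.mulLeft (Equiv.swap a b))) (fun ζ : Equiv.Perm X => hue S ζ * (huW N (s * ζ) : ℤ))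
  simp only [Equiv.trans_apply, Equiv.coe_mulRight, Equiv.coe_mulLeft, key,
    Finset.sum_neg_distrib] at h2
  linarith

theorem hu_G_one (N : ℕ) (hN : 0 < N) {X : Type*} [Fintype X] [DecidableEq X] (S : Finset X)
    (s : Equiv.Perm X) (hs : ∀ x y, Equiv.Perm.SameCycle s x y) {a b : X} (ha : a ∉ S) (hb : b ∈ S)
    (hi : HuInv S (s * Equiv.swap a b)) :
    N * ((-1) ^ (S.card + 1) * ∑ ζ : Equiv.Perm X, hue S ζ * (huW N (s * ζ) : ℤ)) =
      N.descFactorial S.card * N.ascFactorial (Fintype.card X - S.card) := by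
  classical
  set s' := s * Equiv.swap a b with hs'
  have hss : s = s' * Equiv.swap a b := by rw [hs', mul_assoc, Equiv.swap_mul_self, mul_one]
  have htr : ∀ x ∈ S, Equiv.Perm.SameCycle s' b x := by
    intro x hx
    by_contra hcon
    set U : Finset X := S.filter (fun y => ¬ Equiv.Perm.SameCycle s' b y) with hU
    have hxU : x ∈ U := by simp [hU, hx, hcon]
    have hbU : b ∉ U := by simp [hU, Equiv.Perm.SameCycle.refl]
    have hUi' : HuInv U s' := by
      intro y
      simp only [hU, Finset.mem_filter, hi y, Equiv.Perm.sameCycle_apply_right]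
    have haU : a ∉ U := by simp [hU, ha]
    have hUi : HuInv U s := by
      rw [hss]
      exact hUi'.mul (hu_swap_out haU hbU).1
    exact hbU ((hUi.sameCycle (hs x b)).2 hxU)
  have hsg : (Equiv.Perm.sign (hurs S s') : ℤ) = (-1) ^ (S.card + 1) := by
    rw [hurs_trans_sign hi ⟨b, hb⟩ (fun x hx y hy => (htr x hx).symm.trans (htr y hy))]
    push_cast; rfl
  have h1 : (-1) ^ (S.card + 1) * ∑ ζ : Equiv.Perm X, hue S ζ * (huW N (s * ζ) : ℤ) =
      ∑ ζ : Equiv.Perm X, hue S ζ * (huW N (ζ * Equiv.swap b a) : ℤ) := by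
    rw [← hsg, Finset.mul_sum, ← Equiv.sum_comp (Equiv.mulRight s')
      (fun ζ : Equiv.Perm X => hue S ζ * (huW N (ζ * Equiv.swap b a) : ℤ))]
    apply Finset.sum_congr rfl
    intro ζ _
    rw [Equiv.coe_mulRight, hue_mul_right hi]
    have : huW N (s * ζ) = huW N (ζ * s' * Equiv.swap b a) := by
      rw [huW_comm, mul_assoc, Equiv.swap_comm b a, ← hss]
    rw [this]; ring
  have h2 : ∀ ζ : Equiv.Perm X, N * (hue S ζ * (huW N (ζ * Equiv.swap b a) : ℤ)) =
      hue S ζ * (huW N ζ : ℤ) := by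
    intro ζ
    by_cases hz : HuInv S ζ
    · rw [← huW_swap N hz hb ha]
      push_cast; ring
    · unfold hue
      rw [if_neg hz]; simp
  rw [h1, Finset.mul_sum]
  simp_rw [h2]
  rw [hu_sum_prod, hu_fall N hN, hu_rise N hN]
  congr 2
  · simp
  · simp [Fintype.card_subtype_compl]

theorem hu_G_univ (N : ℕ) (hN : 0 < N) {X : Type*} [Fintype X] [DecidableEq X] [Nonempty X]
    (s : Equiv.Perm X) (hs : ∀ x y, Equiv.Perm.SameCycle s x y) :
    ((-1) ^ ((Finset.univ : Finset X).card + 1) *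
      ∑ ζ : Equiv.Perm X, hue Finset.univ ζ * (huW N (s * ζ) : ℤ)) =
      N.descFactorial (Fintype.card X) := by
  classical
  have hi : HuInv Finset.univ s := fun x => by simp
  have hsg : (Equiv.Perm.sign (hurs Finset.univ s) : ℤ) = (-1) ^ ((Finset.univ : Finset X).card + 1) := by
    rw [hurs_trans_sign hi Finset.univ_nonempty (fun x _ y _ => hs x y)]
    push_cast; rfl
  rw [← hsg, Finset.mul_sum, ← hu_fall N hN, ← Equiv.sum_comp (Equiv.mulLeft s)
    (fun σ : Equiv.Perm X => (Equiv.Perm.sign σ : ℤ) * (huW N σ : ℤ))]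
  apply Finset.sum_congr rfl
  intro ζ _
  rw [← mul_assoc, ← hue_mul_left hi, Equiv.coe_mulLeft]
  congr 1
  unfold hue
  rw [if_pos (fun x => by simp), hurs_univ]

theorem hu_rot_trans (n : ℕ) (x y : Fin (n+1)) :
    Equiv.Perm.SameCycle (Equiv.addRight (1 : Fin (n+1))) x y := by
  refine ⟨((y.val + (n + 1 - x.val) : ℕ) : ℤ), ?_⟩
  have h : ∀ k : ℕ, (((Equiv.addRight (1 : Fin (n+1))) ^ k) x).val = (x.val + k) % (n + 1) := by
    intro k
    induction k with
    | zero => simp [Nat.mod_eq_of_lt x.2]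
    | succ k ih =>
      rw [pow_succ', Equiv.Perm.mul_apply, Equiv.coe_addRight, Fin.val_add, ih, Fin.val_one',
        ← Nat.add_mod, add_assoc]
  rw [zpow_natCast]
  apply Fin.ext
  rw [h]
  have hx := x.2
  rw [show x.val + (y.val + (n + 1 - x.val)) = y.val + (n + 1) by omega, Nat.add_mod_right,
    Nat.mod_eq_of_lt y.2]

def huPhi (n : ℕ) (p : (_ : ℕ) × ℕ) : Finset (Fin (n+1)) :=
  Finset.univ.filter (fun v => ¬ (p.1 - p.2 ≤ v.val ∧ v.val ≤ p.1))

theorem hu_mem_phi {n y i : ℕ} {v : Fin (n+1)} :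
    v ∈ huPhi n ⟨y, i⟩ ↔ ¬ (y - i ≤ v.val ∧ v.val ≤ y) := by
  simp [huPhi]

theorem hu_phi_card {n y i : ℕ} (hi : i < y) (hy : y < n + 1) :
    (huPhi n ⟨y, i⟩).card = n - i := by
  have h1 : huPhi n ⟨y, i⟩ = (Finset.Icc (⟨y - i, by omega⟩ : Fin (n+1)) ⟨y, hy⟩)ᶜ := by
    ext v
    rw [hu_mem_phi, Finset.mem_compl, Finset.mem_Icc, Fin.le_def, Fin.le_def]
  rw [h1, Finset.card_compl, Fin.card_Icc]
  simp
  omega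

theorem hu_phi_inv {n y i : ℕ} (hi : i < y) (hy : y < n + 1) :
    HuInv (huPhi n ⟨y, i⟩) (Equiv.addRight (1 : Fin (n+1)) *
      Equiv.swap ⟨y, hy⟩ ⟨y - i - 1, by omega⟩) := by
  intro x
  rw [Equiv.Perm.mul_apply, Equiv.coe_addRight, Equiv.swap_apply_def, hu_mem_phi, hu_mem_phi,
    Fin.val_add_one]
  have hx := x.2
  split_ifs with h1 h2 h3 h4 h5 <;> simp only [Fin.ext_iff, Fin.val_last] at * <;> omega

theorem hu_class {n : ℕ} (S : Finset (Fin (n+1))) (h0 : 0 ∈ S) (hu : S ≠ Finset.univ)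
    (hp : ∀ y i, i < y → y < n + 1 → huPhi n ⟨y, i⟩ ≠ S) :
    ∃ a b : Fin (n+1), a ≠ b ∧ a ∉ S ∧ b ∉ S ∧ a + 1 ∈ S ∧ b + 1 ∈ S := by
  have hT : (Sᶜ).Nonempty := by
    rw [Finset.nonempty_iff_ne_empty]
    intro h
    exact hu (by simpa using h)
  set y := Sᶜ.max' hT with hy
  set x := Sᶜ.min' hT with hx
  have hyT : y ∉ S := by simpa using Sᶜ.max'_mem hT
  have hxT : x ∉ S := by simpa using Sᶜ.min'_mem hT
  have hle : ∀ v, v ∉ S → v ≤ y := fun v hv => Finset.le_max' _ _ (by simpa using hv)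
  have hge : ∀ v, v ∉ S → x ≤ v := fun v hv => Finset.min'_le _ _ (by simpa using hv)
  have hx0 : 0 < x.val := by
    rcases Nat.eq_zero_or_pos x.val with h | h
    · exact absurd h0 ((Fin.ext h : x = 0) ▸ hxT)
    · exact h
  have hxy := Fin.le_def.1 (hle x hxT)
  obtain ⟨z, hzS, hz⟩ : ∃ z, z ∈ S ∧ x ≤ z ∧ z ≤ y := by
    by_contra hcon
    push Not at hcon
    apply hp y.val (y.val - x.val) (by omega) y.2
    ext v
    rw [hu_mem_phi]
    have h1 := hle v
    have h2 := hge v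
    have h3 := hcon v
    simp only [Fin.le_def, Fin.lt_def] at h1 h2 h3
    constructor
    · intro h
      by_contra hv
      have := h1 hv
      have := h2 hv
      omega
    · intro hv
      have := h3 hv
      omega
  have hF : (Sᶜ.filter (fun v => v < z)).Nonempty := by
    refine ⟨x, ?_⟩
    simp only [Finset.mem_filter, Finset.mem_compl]
    exact ⟨hxT, lt_of_le_of_ne hz.1 (by rintro h; exact hxT (h ▸ hzS))⟩
  set a := (Sᶜ.filter (fun v => v < z)).max' hF with ha
  have haF := (Sᶜ.filter (fun v => v < z)).max'_mem hF
  rw [← ha] at haF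
  simp only [Finset.mem_filter, Finset.mem_compl] at haF
  have hzy : z < y := lt_of_le_of_ne hz.2 (by rintro h; exact hyT (h ▸ hzS))
  refine ⟨a, y, (haF.2.trans hzy).ne, haF.1, hyT, ?_, ?_⟩
  · by_contra hcon
    have hv := Fin.val_add_one a
    have hl : a ≠ Fin.last n := (lt_of_lt_of_le haF.2 (Fin.le_last z)).ne
    rw [if_neg hl] at hv
    have hne : a + 1 ≠ z := by rintro h; exact hcon (h ▸ hzS)
    have h1 := Fin.lt_def.1 haF.2
    have h2 : (a + 1).val ≠ z.val := fun h => hne (Fin.ext h)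
    have h3 : a + 1 ≤ a := by
      apply Finset.le_max'
      simp only [Finset.mem_filter, Finset.mem_compl]
      exact ⟨hcon, Fin.lt_def.2 (by omega)⟩
    have := Fin.le_def.1 h3
    omega
  · by_contra hcon
    have hv := Fin.val_add_one y
    have h1 := Fin.le_def.1 (hle _ hcon)
    split_ifs at hv with hl
    · exact hcon ((Fin.ext hv : y + 1 = 0) ▸ h0)
    · omega

theorem hu_desc_asc (N n i : ℕ) (hi : i ≤ n) :
    N.descFactorial (n - i) * N.ascFactorial (i + 1) = N * (N + i).descFactorial n := by
  have h1 : N.ascFactorial (i + 1) = N * (N + i).descFactorial i := by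
    rw [Nat.add_descFactorial_eq_ascFactorial, Nat.ascFactorial_succ, Nat.succ_ascFactorial]
  have h2 := Nat.descFactorial_mul_descFactorial (n := N + i) hi
  rw [Nat.add_sub_cancel] at h2
  rw [h1, ← h2]; ring

theorem hu_binom1 (N n y : ℕ) :
    Nat.choose N (n+1) + ∑ i ∈ Finset.range y, Nat.choose (N + i) n = Nat.choose (N + y) (n + 1) := by
  induction y with
  | zero => simp
  | succ y ih =>
    rw [Finset.sum_range_succ, ← add_assoc, ih, ← add_assoc N y 1, Nat.choose_succ_succ]
    ring

theorem hu_binom2 (N n : ℕ) :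
    (N.descFactorial (n+1) : ℤ) + ∑ y ∈ Finset.range (n+1), ∑ i ∈ Finset.range y,
      ((N + i).descFactorial n : ℤ) =
      n.factorial * (Nat.choose (N + n + 1) (n + 2) - Nat.choose N (n + 2)) := by
  have h1 := hu_binom1 N (n+1) (n+1)
  have h2 : N.descFactorial (n+1) + ∑ y ∈ Finset.range (n+1), ∑ i ∈ Finset.range y,
      (N + i).descFactorial n =
      n.factorial * ∑ y ∈ Finset.range (n+1), Nat.choose (N + y) (n + 1) := by
    simp_rw [← hu_binom1 N n, Nat.descFactorial_eq_factorial_mul_choose, ← Finset.mul_sum,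
      Finset.sum_add_distrib]
    rw [Finset.sum_const, Finset.card_range, Nat.factorial_succ]
    simp only [smul_eq_mul]
    ring
  have h1' : ((Nat.choose N (n+2) : ℕ) : ℤ) + ((∑ i ∈ Finset.range (n+1), Nat.choose (N + i) (n+1) : ℕ) : ℤ)
    = Nat.choose (N + n + 1) (n + 2) := by exact_mod_cast h1
  rw [← h1']
  rw [add_sub_cancel_left]
  exact_mod_cast h2

theorem hu_total (N n : ℕ) (hN : 0 < N) :
    ∑ S ∈ (Finset.univ : Finset (Finset (Fin (n+1)))).filter (fun S => 0 ∈ S),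
      (-1 : ℤ) ^ (S.card + 1) * ∑ ζ : Equiv.Perm (Fin (n+1)), hue S ζ *
        (huW N (Equiv.addRight (1 : Fin (n+1)) * ζ) : ℤ) =
      n.factorial * (Nat.choose (N + n + 1) (n + 2) - Nat.choose N (n + 2)) := by
  classical
  set D : Finset ((_ : ℕ) × ℕ) := (Finset.range (n+1)).sigma (fun y => Finset.range y) with hD
  have hmemD : ∀ y i, (⟨y, i⟩ : (_ : ℕ) × ℕ) ∈ D ↔ y < n + 1 ∧ i < y := by
    intro y i; simp [hD]
  have hnot : Finset.univ ∉ D.image (huPhi n) := by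
    intro h
    obtain ⟨⟨y, i⟩, hp, he⟩ := Finset.mem_image.1 h
    rw [hmemD] at hp
    have : (⟨y, hp.1⟩ : Fin (n+1)) ∈ huPhi n ⟨y, i⟩ := by rw [he]; simp
    rw [hu_mem_phi] at this
    simp at this
  have hsub : insert Finset.univ (D.image (huPhi n)) ⊆
      (Finset.univ : Finset (Finset (Fin (n+1)))).filter (fun S => 0 ∈ S) := by
    intro S hS
    simp only [Finset.mem_filter, Finset.mem_univ, true_and]
    rcases Finset.mem_insert.1 hS with rfl | h
    · simp
    · obtain ⟨⟨y, i⟩, hp, rfl⟩ := Finset.mem_image.1 h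
      rw [hmemD] at hp
      rw [hu_mem_phi]
      simp
      omega
  rw [← Finset.sum_subset hsub]
  · rw [Finset.sum_insert hnot, hu_G_univ N hN _ (hu_rot_trans n), Finset.sum_image]
    · rw [hD, Finset.sum_sigma, ← hu_binom2, Fintype.card_fin]
      congr 1
      apply Finset.sum_congr rfl
      intro y hy
      apply Finset.sum_congr rfl
      intro i hi
      rw [Finset.mem_range] at hy hi
      have h1 := hu_G_one N hN (huPhi n ⟨y, i⟩) _ (hu_rot_trans n) (a := ⟨y, hy⟩)
        (b := ⟨y - i - 1, by omega⟩) (by rw [hu_mem_phi]; simp) (by rw [hu_mem_phi]; simp; omega)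
        (hu_phi_inv hi hy)
      have h2 : (N.descFactorial (huPhi n ⟨y, i⟩).card *
          N.ascFactorial (Fintype.card (Fin (n+1)) - (huPhi n ⟨y, i⟩).card) : ℤ) =
          N * (N + i).descFactorial n := by
        rw [hu_phi_card hi hy, Fintype.card_fin]
        rw [show n + 1 - (n - i) = i + 1 by omega]
        exact_mod_cast hu_desc_asc N n i (by omega)
      rw [h2] at h1
      exact mul_left_cancel₀ (by exact_mod_cast hN.ne') h1
    · rintro ⟨y, i⟩ hp ⟨y', i'⟩ hp' he
      rw [Finset.mem_coe, hmemD] at hp hp'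
      have e : ∀ v : ℕ, v < n + 1 → ((y - i ≤ v ∧ v ≤ y) ↔ (y' - i' ≤ v ∧ v ≤ y')) := by
        intro v hv
        have : (⟨v, hv⟩ : Fin (n+1)) ∈ huPhi n ⟨y, i⟩ ↔ (⟨v, hv⟩ : Fin (n+1)) ∈ huPhi n ⟨y', i'⟩ := by
          rw [he]
        rw [hu_mem_phi, hu_mem_phi, not_iff_not] at this
        exact this
      have e1 := e y (by omega)
      have e2 := e y' (by omega)
      have e3 := e (y - i) (by omega)
      have e4 := e (y' - i') (by omega)
      have : y = y' := by omega
      subst this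
      have : i = i' := by omega
      subst this
      rfl
  · intro S hS hS'
    simp only [Finset.mem_filter, Finset.mem_univ, true_and] at hS
    rw [Finset.mem_insert, not_or] at hS'
    obtain ⟨a, b, hab, ha, hb, ha1, hb1⟩ := hu_class S hS hS'.1 (by
      intro y i hi hy he
      exact hS'.2 (Finset.mem_image.2 ⟨⟨y, i⟩, (hmemD y i).2 ⟨hy, hi⟩, he⟩))
    rw [hu_G_zero N S _ hab ha hb ha1 hb1, mul_zero]

theorem hu_surj (n : ℕ) (ζ : Equiv.Perm (Fin (n+1)))
    (h : ∀ x y, Equiv.Perm.SameCycle ζ x y) :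
    ∃ κ : Equiv.Perm (Fin (n+1)), κ 0 = 0 ∧
      κ * (Equiv.addRight (1 : Fin (n+1)))⁻¹ * κ⁻¹ = ζ := by
  set s := Equiv.addRight (1 : Fin (n+1)) with hs
  have hst : ∀ x y, Equiv.Perm.SameCycle s⁻¹ x y := fun x y => by
    rw [Equiv.Perm.sameCycle_inv]; exact hu_rot_trans n x y
  have hconj : IsConj s⁻¹ ζ := by
    by_cases hsub : Subsingleton (Fin (n+1))
    · rw [Subsingleton.elim s⁻¹ ζ]
    · rw [not_subsingleton_iff_nontrivial] at hsub
      have aux : ∀ f : Equiv.Perm (Fin (n+1)), (∀ x y, Equiv.Perm.SameCycle f x y) →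
          f.IsCycle ∧ f.support = Finset.univ := by
        intro f hf
        have hne : ∀ x, f x ≠ x := by
          intro x hx
          obtain ⟨y, hy⟩ := exists_ne x
          obtain ⟨k, hk⟩ := hf x y
          have : (f ^ k) x = x := Equiv.Perm.zpow_apply_eq_self_of_apply_eq_self hx k
          exact hy (by rw [← hk, this])
        refine ⟨⟨0, hne 0, fun y _ => hf 0 y⟩, ?_⟩
        ext x; simp [hne x]
      obtain ⟨h1, h2⟩ := aux _ hst
      obtain ⟨h3, h4⟩ := aux _ h
      exact h1.isConj h3 (by rw [h2, h4])
  obtain ⟨c, hc⟩ := isConj_iff.1 hconj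
  obtain ⟨k, hk⟩ := hu_rot_trans n 0 (c⁻¹ 0)
  refine ⟨c * s ^ k, ?_, ?_⟩
  · rw [Equiv.Perm.mul_apply, hs, hk]; simp
  · rw [← hc]; group

theorem hu_conj_sum (n : ℕ) (F : Equiv.Perm (Fin (n+1)) → ℤ)
    (P : Equiv.Perm (Fin (n+1)) → Prop) [DecidablePred P]
    (hP : ∀ ζ, P ζ ↔ ∀ x y, Equiv.Perm.SameCycle ζ x y) :
    ∑ π : Equiv.Perm (Fin n), F (Equiv.Perm.decomposeFin.symm (0, π) *
      (Equiv.addRight (1 : Fin (n+1)))⁻¹ * (Equiv.Perm.decomposeFin.symm (0, π))⁻¹) =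
    ∑ ζ : Equiv.Perm (Fin (n+1)), if P ζ then F ζ else 0 := by
  rw [← Finset.sum_filter]
  set s := Equiv.addRight (1 : Fin (n+1)) with hs
  refine Finset.sum_bij (fun π _ => Equiv.Perm.decomposeFin.symm (0, π) * s⁻¹ *
    (Equiv.Perm.decomposeFin.symm (0, π))⁻¹) ?_ ?_ ?_ ?_
  · intro π _
    rw [Finset.mem_filter, hP]
    refine ⟨Finset.mem_univ _, fun x y => ?_⟩
    rw [Equiv.Perm.sameCycle_conj, Equiv.Perm.sameCycle_inv]
    exact hu_rot_trans n _ _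
  · intro π _ ρ _ he
    set κ := (Equiv.Perm.decomposeFin.symm ((0 : Fin (n+1)), π)) with hκ
    set μ := (Equiv.Perm.decomposeFin.symm ((0 : Fin (n+1)), ρ)) with hμ
    have hκ0 : κ 0 = 0 := by simp [hκ]
    have hμ0 : μ 0 = 0 := by simp [hμ]
    have hc : Commute (μ⁻¹ * κ) s := by
      have : Commute (μ⁻¹ * κ) s⁻¹ := by
        show μ⁻¹ * κ * s⁻¹ = s⁻¹ * (μ⁻¹ * κ)
        have he' : κ * s⁻¹ * κ⁻¹ = μ * s⁻¹ * μ⁻¹ := he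
        calc μ⁻¹ * κ * s⁻¹ = μ⁻¹ * (κ * s⁻¹ * κ⁻¹) * κ := by group
          _ = _ := by rw [he']; group
      simpa using this.inv_right
    have h1 : μ⁻¹ * κ = 1 := by
      ext x
      obtain ⟨k, hk⟩ := hu_rot_trans n 0 x
      have := (hc.zpow_right k).eq
      have h2 := congrArg (fun f : Equiv.Perm (Fin (n+1)) => f 0) this
      simp only [Equiv.Perm.mul_apply] at h2
      rw [hs, hk, hκ0, Equiv.Perm.inv_eq_iff_eq.2 hμ0.symm, hk] at h2
      rw [Equiv.Perm.mul_apply, h2]; rfl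
    have h2 : κ = μ := by
      calc κ = μ * (μ⁻¹ * κ) := by group
        _ = μ := by rw [h1, mul_one]
    have h3 := Equiv.Perm.decomposeFin.symm.injective h2
    exact (Prod.ext_iff.1 h3).2
  · intro ζ hζ
    rw [Finset.mem_filter, hP] at hζ
    obtain ⟨κ, hκ0, hκ⟩ := hu_surj n ζ hζ.2
    refine ⟨(Equiv.Perm.decomposeFin κ).2, Finset.mem_univ _, ?_⟩
    have h1 : Equiv.Perm.decomposeFin.symm ((0 : Fin (n+1)), (Equiv.Perm.decomposeFin κ).2) = κ := by
      rw [Equiv.symm_apply_eq]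
      have h2 : (Equiv.Perm.decomposeFin κ).1 = 0 := by
        have h3 : κ = Equiv.Perm.decomposeFin.symm ((Equiv.Perm.decomposeFin κ).1, (Equiv.Perm.decomposeFin κ).2) := by
          simp
        have h4 := Equiv.Perm.decomposeFin_symm_apply_zero (Equiv.Perm.decomposeFin κ).1 (Equiv.Perm.decomposeFin κ).2
        rw [← h3, hκ0] at h4
        exact h4.symm
      rw [← h2]
    rw [h1]; exact hκ
  · intro π _; rfl

theorem hu_cpi {n : ℕ} (π : Equiv.Perm (Fin n)) :
    (cpi π : Equiv.Perm (Fin (n+1))) = (Equiv.Perm.decomposeFin.symm (0, π) *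
      (Equiv.addRight (1 : Fin (n+1)))⁻¹ * (Equiv.Perm.decomposeFin.symm (0, π))⁻¹) *
      Equiv.addRight (1 : Fin (n+1)) := by
  apply Equiv.ext
  intro x
  show pihat π ((pihat π).symm (x + 1) - 1) = _
  rw [sub_eq_add_neg]
  rfl

theorem hu_A_sum (N n : ℕ) (hN : 0 < N) :
    ∑ π : Equiv.Perm (Fin n), ((N ^ A n π : ℕ) : ℤ) =
      n.factorial * (Nat.choose (N + n + 1) (n + 2) - Nat.choose N (n + 2)) := by
  classical
  have h1 : ∀ π : Equiv.Perm (Fin n), ((N ^ A n π : ℕ) : ℤ) =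
      (huW N (Equiv.addRight (1 : Fin (n+1)) * (Equiv.Perm.decomposeFin.symm (0, π) *
      (Equiv.addRight (1 : Fin (n+1)))⁻¹ * (Equiv.Perm.decomposeFin.symm (0, π))⁻¹)) : ℤ) := by
    intro π
    rw [huW_comm, ← hu_cpi π]
    congr 1
    exact (huW_orbits N (X := Fin (n+1)) (cpi π)).symm
  simp_rw [h1]
  rw [hu_conj_sum n (fun ζ => (huW N (Equiv.addRight (1 : Fin (n+1)) * ζ) : ℤ))
    (fun ζ => ∀ x y, Equiv.Perm.SameCycle ζ x y) (fun _ => Iff.rfl), ← hu_total N n hN]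
  simp_rw [Finset.mul_sum]
  rw [Finset.sum_comm]
  apply Finset.sum_congr rfl
  intro ζ _
  have := hu_newton (0 : Fin (n+1)) ζ
  simp_rw [← mul_assoc, ← Finset.sum_mul]
  rw [this]
  split_ifs <;> simp

theorem hu_A_parity {n : ℕ} (π : Equiv.Perm (Fin n)) :
    Even (n + 1 + A n π) ∧ 1 ≤ A n π ∧ A n π ≤ n + 1 := by
  refine ⟨?_, ?_, ?_⟩
  · have h1 := hu_sign_orbits (X := Fin (n+1)) (cpi π)
    have h2 : Equiv.Perm.sign (α := Fin (n+1)) (cpi π) = 1 := by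
      rw [hu_cpi]
      simp only [Equiv.Perm.sign_mul, Equiv.Perm.sign_inv]
      have a1 := Int.units_mul_self (Equiv.Perm.sign (Equiv.addRight (1 : Fin (n+1))))
      have a2 := Int.units_mul_self
        (Equiv.Perm.sign (Equiv.Perm.decomposeFin.symm ((0 : Fin (n+1)), π)))
      rw [mul_right_comm (Equiv.Perm.sign (Equiv.Perm.decomposeFin.symm ((0 : Fin (n+1)), π))), a2,
        one_mul, a1]
    rw [h2, Fintype.card_fin] at h1
    have h3 : (-1 : ℤˣ) ^ (n + 1 + A n π) = 1 := h1.symm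
    by_contra hodd
    rw [Nat.not_even_iff_odd] at hodd
    rw [hodd.neg_one_pow] at h3
    exact absurd h3 (by decide)
  · have : Finite (MulAction.orbitRel.Quotient (Subgroup.zpowers (cpi π)) (ZMod (n+1))) :=
      Quotient.finite _
    have : Nonempty (MulAction.orbitRel.Quotient (Subgroup.zpowers (cpi π)) (ZMod (n+1))) :=
      ⟨Quotient.mk _ 0⟩
    exact Nat.card_pos
  · have h := Nat.card_le_card_of_surjective (α := ZMod (n+1))
      (β := MulAction.orbitRel.Quotient (Subgroup.zpowers (cpi π)) (ZMod (n+1)))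
      (Quotient.mk _) Quotient.mk_surjective
    rw [Nat.card_zmod] at h
    exact h

theorem hu_lhs (n N : ℕ) :
    ∑ g ∈ Finset.range (n / 2 + 1), H n (n + 1 - 2 * g) * N ^ (n + 1 - 2 * g) =
      ∑ π : Equiv.Perm (Fin n), N ^ A n π := by
  classical
  have h1 : ∀ k, H n k * N ^ k = ∑ π : Equiv.Perm (Fin n), if A n π = k then N ^ k else 0 := by
    intro k
    rw [← Finset.sum_filter, Finset.sum_const, smul_eq_mul, H, Nat.card_eq_fintype_card,
      Fintype.card_subtype]
  simp_rw [h1]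
  rw [Finset.sum_comm]
  apply Finset.sum_congr rfl
  intro π _
  obtain ⟨⟨r, hr⟩, h2, h3⟩ := hu_A_parity π
  rw [Finset.sum_eq_single ((n + 1 - A n π) / 2)]
  · have : A n π = n + 1 - 2 * ((n + 1 - A n π) / 2) := by omega
    rw [if_pos this, ← this]
  · intro g hg hne
    rw [Finset.mem_range] at hg
    rw [if_neg (by omega)]
  · intro h
    rw [Finset.mem_range] at h
    omega

/-- Closed form for the Hultman polynomial `p_n(N) = Σ_g H(n, n+1-2g) N^{n+1-2g}`,
equivalent to the generating function identity
`F(x,N) = x⁻²((1-x)^{-N} - (1+x)^N)`. -/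
theorem hultman_polynomial_closed_form (n N : ℕ) :
    ∑ g ∈ Finset.range (n / 2 + 1), H n (n + 1 - 2 * g) * N ^ (n + 1 - 2 * g) =
      n.factorial * (Nat.choose (N + n + 1) (n + 2) - Nat.choose N (n + 2)) := by
  rcases Nat.eq_zero_or_pos N with rfl | hN
  · rw [Finset.sum_eq_zero]
    · rw [Nat.choose_eq_zero_of_lt (by omega)]; simp
    · intro g hg
      rw [Finset.mem_range] at hg
      rw [zero_pow (by omega), mul_zero]
  · rw [hu_lhs]
    have h := hu_A_sum N n hN
    have hle : Nat.choose N (n + 2) ≤ Nat.choose (N + n + 1) (n + 2) :=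
      Nat.choose_le_choose _ (by omega)
    zify [hle]
    push_cast at h
    exact h
end

section
/- Write h_g(n) := H(n, n+1−2g). For all n ≥ 2 and g ≥ 1, the following recursion holds (as an identity of natural numbers, with all terms nonnegative): (n+2)·h_g(n) + (n−1)·h_g(n−2) = (2n+1)·h_g(n−1) + n²·(n−1)·h_{g−1}(n−2). Moreover for g = 0 and n ≥ 2 one has (n+2)·h_0(n) + (n−1)·h_0(n−2) = (2n+1)·h_0(n−1). -/
/-- `h g n = H(n, n+1-2g)`, the number of permutations of `Fin n` whose cycle-graph
gluing has genus `g`. -/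
noncomputable def h (g n : ℕ) : ℕ := H n (n + 1 - 2 * g)

open Equiv in
noncomputable def orb {α : Type} (c : Perm α) : ℕ :=
  Nat.card (MulAction.orbitRel.Quotient (Subgroup.zpowers c) α)

namespace Hult
open Equiv

theorem orbrel {α : Type} (c : Perm α) (x y : α) :
    MulAction.orbitRel (Subgroup.zpowers c) α x y ↔ c.SameCycle y x := by
  rw [MulAction.orbitRel_apply, MulAction.mem_orbit_iff]
  constructor
  · rintro ⟨⟨g, n, rfl⟩, h⟩
    exact ⟨n, h⟩
  · rintro ⟨n, h⟩
    exact ⟨⟨c ^ n, n, rfl⟩, h⟩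

theorem same_ind {α : Type} (c : Perm α) (r : Setoid α) (hr : ∀ x, r x (c x)) (x y : α)
    (h : c.SameCycle x y) : r x y := by
  have key : ∀ (n : ℕ) (x : α), r x ((c ^ n) x) := by
    intro n
    induction n with
    | zero => intro x; exact r.refl x
    | succ n ih =>
      intro x
      rw [pow_succ']
      exact r.trans (ih x) (hr _)
  obtain ⟨n, rfl⟩ := h
  obtain ⟨m, rfl | rfl⟩ := n.eq_nat_or_neg
  · simpa using key m x
  · have := key m ((c ^ (-(m : ℤ))) x)
    apply r.symm
    simpa using this

theorem orb_of {α β : Type} (c : Perm α) (f : α → β) (hs : Function.Surjective f)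
    (h1 : ∀ x, f (c x) = f x) (h2 : ∀ x y, f x = f y → c.SameCycle x y) :
    orb c = Nat.card β := by
  unfold orb
  refine Nat.card_congr ((Quotient.congr (Equiv.refl _) ?_).trans
    (Setoid.quotientKerEquivOfSurjective f hs))
  intro x y
  refine (orbrel c x y).trans ⟨fun h => ?_, fun h => (h2 _ _ h).symm⟩
  exact same_ind c (Setoid.ker f) (fun x => (h1 x).symm) x y h.symm

theorem orb_eq {α : Type} (c : Perm α) : orb c = Nat.card (Quotient (Perm.SameCycle.setoid c)) := by
  apply orb_of c (fun x => (Quotient.mk (Perm.SameCycle.setoid c) x)) Quotient.mk_surjective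
  · intro x
    apply Quotient.sound
    exact ⟨-1, by simp⟩
  · intro x y h
    exact Quotient.exact h

theorem orb_permCongr {α β : Type} (e : α ≃ β) (c : Perm α) : orb (e.permCongr c) = orb c := by
  rw [orb_eq, orb_eq]
  refine Nat.card_congr (Quotient.congr e.symm ?_)
  intro x y
  constructor
  · rintro ⟨n, h⟩
    refine ⟨n, ?_⟩
    rw [show e.permCongr c = e.permCongrHom c from rfl, ← map_zpow] at h
    simp [Equiv.permCongrHom] at h
    simp [← h]
  · rintro ⟨n, h⟩
    refine ⟨n, ?_⟩
    rw [show e.permCongr c = e.permCongrHom c from rfl, ← map_zpow]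
    simp [Equiv.permCongrHom, h]

theorem orb_conj {α : Type} (g c : Perm α) : orb (g * c * g⁻¹) = orb c := by
  rw [← orb_permCongr g c]
  congr 1

theorem orb_comm {α : Type} (g c : Perm α) : orb (g * c) = orb (c * g) := by
  rw [← orb_conj c (g * c)]
  congr 1; group

theorem orb_inv {α : Type} (c : Perm α) : orb c⁻¹ = orb c := by
  unfold orb
  rw [Subgroup.zpowers_inv]

variable {α : Type}

def hat : Perm α →* Perm (Option α) where
  toFun ρ := optionCongr ρ
  map_one' := by simp
  map_mul' a b := by ext x; cases x <;> simp

@[simp] theorem hat_some (ρ : Perm α) (x : α) : hat ρ (some x) = some (ρ x) := rfl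
@[simp] theorem hat_none (ρ : Perm α) : hat ρ none = none := rfl

theorem hat_swap [DecidableEq α] (x y : α) : hat (swap x y) = swap (some x) (some y) :=
  optionCongr_swap x y

theorem orb_hat [Finite α] (ρ : Perm α) : orb (hat ρ) = orb ρ + 1 := by
  rw [orb_eq ρ, ← Finite.card_option]
  apply orb_of (hat ρ) (Option.map (Quotient.mk (Perm.SameCycle.setoid ρ)))
  · rintro (_ | q)
    · exact ⟨none, rfl⟩
    · obtain ⟨x, rfl⟩ := Quotient.mk_surjective q
      exact ⟨some x, rfl⟩
  · rintro (_ | x)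
    · rfl
    · simp only [hat_some, Option.map_some, Option.some.injEq]
      apply Quotient.sound
      exact ⟨-1, by simp⟩
  · rintro (_ | x) (_ | y) h
    · exact Perm.SameCycle.refl _ _
    · simp at h
    · simp at h
    · simp only [Option.map_some, Option.some.injEq] at h
      exact same_ind ρ ((Perm.SameCycle.setoid (hat ρ)).comap some)
        (fun x => ⟨1, by simp⟩) x y (Quotient.exact h)

theorem orb_ins [DecidableEq α] (ρ : Perm α) (i : α) :
    orb (swap none (some i) * hat ρ) = orb ρ := by
  rw [orb_eq ρ]
  have hR : ∀ x y, ρ.SameCycle x y →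
      (swap none (some i) * hat ρ).SameCycle (some x) (some y) := by
    intro x y
    refine same_ind ρ ((Perm.SameCycle.setoid (swap none (some i) * hat ρ)).comap some) ?_ x y
    intro x
    by_cases hx : ρ x = i
    · refine ⟨2, ?_⟩
      simp [zpow_ofNat, pow_two, hx]
    · refine ⟨1, ?_⟩
      simp [swap_apply_of_ne_of_ne, hx]
  have hn : (swap none (some i) * hat ρ).SameCycle none (some i) := ⟨1, by simp⟩
  apply orb_of _ (fun u => Quotient.mk (Perm.SameCycle.setoid ρ) (u.getD i))
  · intro q
    obtain ⟨x, rfl⟩ := Quotient.mk_surjective q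
    exact ⟨some x, rfl⟩
  · rintro (_ | x)
    · simp
    · apply Quotient.sound
      by_cases hx : ρ x = i
      · exact ⟨-1, by simp [hx]; rw [← hx]; simp⟩
      · exact ⟨-1, by simp [swap_apply_of_ne_of_ne, hx]⟩
  · rintro (_ | x) (_ | y) h <;> have h := Quotient.exact h
    · exact Perm.SameCycle.refl _ _
    · exact hn.trans (hR _ _ h)
    · exact (hR _ _ h).trans hn.symm
    · exact hR _ _ h

theorem dec_none [DecidableEq α] (ρ : Perm α) : Perm.decomposeOption.symm (none, ρ) = hat ρ := by
  simp [hat]; rfl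

theorem dec_some [DecidableEq α] (ρ : Perm α) (i : α) :
    Perm.decomposeOption.symm (some i, ρ) = swap none (some i) * hat ρ := by
  simp [hat]

theorem sum_option {R : Type} [AddCommMonoid R] [Fintype α] [DecidableEq α]
    (f : Perm (Option α) → R) :
    ∑ c, f c = ∑ ρ : Perm α, (f (hat ρ) + ∑ i, f (swap none (some i) * hat ρ)) := by
  rw [← Perm.decomposeOption.symm.sum_comp, Fintype.sum_prod_type, Finset.sum_comm]
  refine Finset.sum_congr rfl fun ρ _ => ?_
  rw [Fintype.sum_option, dec_none]
  simp only [dec_some]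

theorem orb_zero_iff [Finite α] (c : Perm α) : orb c = 0 ↔ IsEmpty α := by
  rw [orb_eq, Finite.card_eq_zero_iff]
  exact ⟨fun h => ⟨fun x => h.1 (Quotient.mk _ x)⟩, fun h => ⟨fun q => by
    obtain ⟨x, -⟩ := Quotient.mk_surjective q; exact h.1 x⟩⟩

theorem sign_orb [Fintype α] [DecidableEq α] (c : Perm α) :
    (Perm.sign c : ℤ) = (-1) ^ (Fintype.card α + orb c) := by
  suffices H : ∀ (n : ℕ) (α : Type) [Fintype α] [DecidableEq α] (c : Perm α),
      Fintype.card α = n → (Perm.sign c : ℤ) = (-1) ^ (Fintype.card α + orb c) from H _ α c rfl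
  clear c
  intro n
  induction n with
  | zero =>
    intro α _ _ c h
    have : IsEmpty α := Fintype.card_eq_zero_iff.1 h
    rw [(orb_zero_iff c).2 this, h, Subsingleton.elim c 1]
    simp
  | succ n ih =>
    intro α _ _ c h
    have : Nonempty α := Fintype.card_pos_iff.1 (by omega)
    obtain ⟨a⟩ := this
    let e := optionSubtypeNe a
    have hc : c = e.permCongr (e.symm.permCongr c) := by ext; simp
    generalize e.symm.permCongr c = d at hc
    have hcard : Fintype.card { b // b ≠ a } = n := by
      have := Fintype.card_congr e
      rw [Fintype.card_option] at this; omega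
    rw [hc, Perm.sign_permCongr, orb_permCongr]
    obtain ⟨⟨u, ρ⟩, rfl⟩ := Perm.decomposeOption.symm.surjective d
    have h1 := ih _ ρ hcard
    rw [hcard] at h1
    rw [h]
    rcases u with _ | i
    · rw [dec_none, orb_hat]
      have : Perm.sign (hat ρ) = Perm.sign ρ := optionCongr_sign ρ
      rw [this, h1]; ring
    · rw [dec_some, orb_ins]
      have : Perm.sign (hat ρ) = Perm.sign ρ := optionCongr_sign ρ
      rw [Perm.sign_mul, this, Perm.sign_swap (by simp)]
      push_cast
      rw [h1]; ring

noncomputable def lg (c : Perm α) : ℤ := if orb c = 1 then 1 else 0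

theorem lg_hat [Finite α] [Nonempty α] (c : Perm α) : lg (hat c) = 0 := by
  unfold lg
  rw [orb_hat, if_neg]
  intro h
  have := (orb_zero_iff c).1 (by omega)
  exact not_isEmpty_of_nonempty α this

theorem lg_ins [DecidableEq α] (c : Perm α) (i : α) : lg (swap none (some i) * hat c) = lg c := by
  unfold lg
  rw [orb_ins]

noncomputable def L [Fintype α] [DecidableEq α] (ρ : Perm α) : ℤ := ∑ c : Perm α, lg c * lg (c * ρ)

section
variable [Fintype α] [DecidableEq α]

theorem L_permCongr {β : Type} [Fintype β] [DecidableEq β] (e : α ≃ β) (ρ : Perm α) :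
    L (e.permCongr ρ) = L ρ := by
  unfold L
  rw [← e.permCongrHom.toEquiv.sum_comp]
  refine Finset.sum_congr rfl fun c _ => ?_
  have h1 : e.permCongrHom.toEquiv c = e.permCongr c := rfl
  have h2 : e.permCongr c * e.permCongr ρ = e.permCongr (c * ρ) := (map_mul e.permCongrHom c ρ).symm
  rw [h1, h2]
  simp only [lg, orb_permCongr]

theorem L_conj (g ρ : Perm α) : L (g * ρ * g⁻¹) = L ρ := by
  rw [← L_permCongr g ρ]
  congr 1

theorem L_inv (ρ : Perm α) : L ρ⁻¹ = L ρ := by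
  unfold L
  rw [← Equiv.sum_comp (Equiv.mulRight ρ)]
  refine Finset.sum_congr rfl fun c _ => ?_
  simp [mul_comm]

theorem L_odd (ρ : Perm α) (h : Perm.sign ρ = -1) : L ρ = 0 := by
  unfold L
  refine Finset.sum_eq_zero fun c _ => ?_
  unfold lg
  by_cases h1 : orb c = 1
  · by_cases h2 : orb (c * ρ) = 1
    · exfalso
      have e1 := sign_orb c
      have e2 := sign_orb (c * ρ)
      rw [h1] at e1
      rw [h2, ← e1, Perm.sign_mul, h] at e2
      rcases Int.units_eq_one_or (Perm.sign c) with h | h <;> rw [h] at e2 <;> simp at e2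
    · simp [h2]
  · simp [h1]

theorem L_hat [Nonempty α] (ρ : Perm α) : L (hat ρ) = Fintype.card α * L ρ := by
  unfold L
  rw [sum_option, Finset.mul_sum]
  refine Finset.sum_congr rfl fun c _ => ?_
  simp only [lg_hat, lg_ins, mul_assoc, ← map_mul]
  simp

theorem L_hat_swap (ρ : Perm α) (b : α) :
    L (hat ρ * swap none (some b)) = ∑ j ∈ Finset.univ.erase b, L (ρ * swap j b) := by
  have : Nonempty α := ⟨b⟩
  unfold L
  rw [sum_option, Finset.sum_comm]
  refine Finset.sum_congr rfl fun c _ => ?_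
  simp only [lg_hat, lg_ins, zero_mul, zero_add]
  rw [← Equiv.sum_comp (c * ρ), ← Finset.add_sum_erase _ _ (Finset.mem_univ b)]
  have key : ∀ j, swap none (some ((c * ρ) j)) * hat c * (hat ρ * swap none (some b)) =
      hat (c * ρ) * swap none (some j) * swap none (some b) := by
    intro j
    rw [mul_assoc, ← mul_assoc (hat c), ← map_mul, ← mul_assoc]
    congr 1
    have := Equiv.mul_swap_eq_swap_mul (hat (c * ρ)) none (some j)
    rw [this]; simp
  rw [key]
  have h0 : lg (hat (c * ρ) * swap none (some b) * swap none (some b)) = 0 := by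
    rw [mul_assoc, swap_mul_self, mul_one, lg_hat]
  rw [h0, mul_zero, zero_add]
  refine Finset.sum_congr rfl fun j hj => ?_
  have hj : j ≠ b := (Finset.mem_erase.1 hj).1
  rw [key]
  congr 1
  have h1 : swap none (some j) * swap none (some b) = swap none (some b) * hat (swap j b) := by
    rw [hat_swap]
    ext1 u
    rcases u with _ | u
    · simp [swap_apply_of_ne_of_ne, hj.symm]
    · by_cases h1 : u = j
      · subst h1; simp [swap_apply_of_ne_of_ne, hj]
      · by_cases h2 : u = b
        · subst h2; simp [swap_apply_of_ne_of_ne, hj]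
        · simp [swap_apply_of_ne_of_ne, h1, h2]
  rw [mul_assoc, h1, ← mul_assoc, Equiv.mul_swap_eq_swap_mul, mul_assoc, ← map_mul, ← mul_assoc]
  simp only [hat_none, hat_some]
  rw [lg_ins]

theorem L_rec (r : Perm α) (a i : α) (ha : r a = a) (hi : i ≠ a) :
    ((Fintype.card α : ℤ) - 1) * L (r * swap a i) =
      ∑ j ∈ (Finset.univ.erase i).erase a, L (r * swap j i) := by
  let e := optionSubtypeNe a
  obtain ⟨s, hs⟩ : ∃ s : Perm {b // b ≠ a}, r = e.permCongr (hat s) := by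
    obtain ⟨⟨u, s⟩, hd⟩ := Perm.decomposeOption.symm.surjective (e.symm.permCongr r)
    have hu : u = none := by
      have := congrArg (fun f => f none) hd
      simpa [e, ha] using this
    subst hu
    rw [dec_none] at hd
    exact ⟨s, by rw [hd]; ext; simp⟩
  have hc : (Fintype.card α : ℤ) - 1 = Fintype.card {b // b ≠ a} := by
    have := Fintype.card_congr e
    rw [Fintype.card_option] at this
    rw [← this]; push_cast; ring
  have hsw : ∀ x y, e.permCongr (swap x y) = swap (e x) (e y) := by
    intro x y
    ext z; simp [Equiv.permCongr_apply, Equiv.swap_apply_def, Equiv.symm_apply_eq]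
    split_ifs <;> simp
  have hm : ∀ x y, L (r * swap (e x) (e y)) = L (hat s * swap x y) := by
    intro x y
    rw [hs, ← hsw, ← L_permCongr e]
    congr 1
    exact (map_mul e.permCongrHom _ _).symm
  have hne : Nonempty {b // b ≠ a} := ⟨⟨i, hi⟩⟩
  have h1 : L (r * swap a i) = L (hat s * swap none (some ⟨i, hi⟩)) := by
    rw [← hm]; simp [e]
  rw [h1, L_hat_swap, hc, Finset.mul_sum]
  symm
  refine Finset.sum_bij' (fun j hj => ⟨j, (Finset.mem_erase.1 hj).1⟩) (fun j _ => j.1) ?_ ?_ ?_ ?_ ?_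
  · intro j hj
    simp at hj ⊢
    exact hj.2
  · intro j hj
    simp at hj ⊢
    refine ⟨j.2, fun h => hj (Subtype.ext h)⟩
  · intros; rfl
  · intros; rfl
  · intro j hj
    have hja := (Finset.mem_erase.1 hj).1
    rw [← L_hat, map_mul, hat_swap, ← hm]
    simp [e]
end

set_option linter.unusedSectionVars false
section
variable [Fintype α] [DecidableEq α]

noncomputable def V (π : Perm α) : ℤ := ∑ a, L (swap a (π a) * π)

theorem permCongr_swap {β : Type} [DecidableEq β] (e : α ≃ β) (x y : α) :
    e.permCongr (swap x y) = swap (e x) (e y) := by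
  ext z; simp [Equiv.permCongr_apply, Equiv.swap_apply_def, Equiv.symm_apply_eq]
  split_ifs <;> simp

theorem permCongr_mul' {β : Type} (e : α ≃ β) (x y : Perm α) :
    e.permCongr (x * y) = e.permCongr x * e.permCongr y := map_mul e.permCongrHom x y

theorem V_permCongr {β : Type} [Fintype β] [DecidableEq β] (e : α ≃ β) (ρ : Perm α) :
    V (e.permCongr ρ) = V ρ := by
  unfold V
  rw [← Equiv.sum_comp e]
  refine Finset.sum_congr rfl fun a _ => ?_
  rw [← L_permCongr e, permCongr_mul', permCongr_swap]
  simp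

theorem S1 (ρ : Perm α) (i : α) (hρ : Perm.sign ρ = 1) :
    ∑ j ∈ Finset.univ.erase i, L (swap i (ρ j) * ρ * swap i j) =
      ((Fintype.card α : ℤ) - 1) * L ρ := by
  have hpos : 1 ≤ Fintype.card α := Fintype.card_pos_iff.2 ⟨i⟩
  by_cases h : ρ i = i
  · rw [Finset.sum_congr rfl (g := fun _ => L ρ)]
    · rw [Finset.sum_const, Finset.card_erase_of_mem (Finset.mem_univ _), Finset.card_univ]
      simp [Nat.cast_sub hpos]
    · intro j _
      congr 1
      have := Equiv.mul_swap_eq_swap_mul ρ i j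
      rw [h] at this
      rw [← this]; simp [mul_assoc]
  · obtain ⟨b, hb⟩ := ρ.surjective i
    have hbi : b ≠ i := by rintro rfl; exact h hb
    have := L_rec (ρ * swap b i) i b (by simp [hb]) hbi
    rw [swap_comm i b, mul_assoc ρ, swap_mul_self, mul_one] at this
    rw [this, Finset.erase_right_comm,
      ← Finset.add_sum_erase (Finset.univ.erase i) _ (Finset.mem_erase.2 ⟨hbi, Finset.mem_univ b⟩)]
    have h0 : L (swap i (ρ b) * ρ * swap i b) = 0 := by
      apply L_odd
      rw [hb, swap_self]
      simp only [Perm.sign_mul, hρ, Perm.sign_swap hbi.symm]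
      simp
    rw [h0, zero_add]
    refine Finset.sum_congr rfl fun j hj => ?_
    simp at hj
    congr 1
    have h2 : swap i (ρ j) * ρ = ρ * swap b j := by
      rw [Equiv.mul_swap_eq_swap_mul, hb]
    rw [h2, mul_assoc, mul_assoc]
    congr 1
    ext1 u
    simp only [Perm.mul_apply, Equiv.swap_apply_def]
    grind

theorem S2 (ρ : Perm α) (i : α) (hρ : Perm.sign ρ = 1) :
    ∑ j ∈ Finset.univ.erase i, L (swap j (ρ i) * ρ * swap i j) =
      ((Fintype.card α : ℤ) - 1) * L ρ := by
  rw [← L_inv ρ, ← S1 ρ⁻¹ i (by simp [hρ])]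
  refine Finset.sum_congr rfl fun j _ => ?_
  rw [← L_inv, ← L_conj (swap i j)]
  congr 1
  have h1 : ρ⁻¹ * swap (ρ i) j = swap i (ρ⁻¹ j) * ρ⁻¹ := by
    rw [Equiv.mul_swap_eq_swap_mul]; simp
  simp only [mul_inv_rev, swap_inv]
  rw [← h1, swap_comm j (ρ i)]
  simp [mul_assoc]

theorem V_expand (ρ : Perm α) (i : α) :
    V (hat ρ * swap none (some i)) = 2 * (Fintype.card α : ℤ) * L ρ +
      ∑ a ∈ Finset.univ.erase i, ∑ j ∈ Finset.univ.erase i,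
        L (swap a (ρ a) * ρ * swap j i) := by
  have : Nonempty α := ⟨i⟩
  unfold V
  rw [Fintype.sum_option, ← Finset.add_sum_erase _ _ (Finset.mem_univ i), ← add_assoc]
  congr 1
  · have h1 : swap none ((hat ρ * swap none (some i)) none) * (hat ρ * swap none (some i)) = hat ρ := by
      have := Equiv.mul_swap_eq_swap_mul (hat ρ) none (some i)
      rw [this]; simp
    have h2 : swap (some i) ((hat ρ * swap none (some i)) (some i)) * (hat ρ * swap none (some i)) =
        swap none (some i) * hat ρ * (swap none (some i))⁻¹ := by
      simp [swap_comm, mul_assoc]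
    rw [h1, h2, L_conj, L_hat]; ring
  · refine Finset.sum_congr rfl fun a ha => ?_
    have ha : a ≠ i := (Finset.mem_erase.1 ha).1
    rw [← L_hat_swap, map_mul, hat_swap]
    simp [swap_apply_of_ne_of_ne, ha, mul_assoc]

theorem V_step (ρ : Perm α) (i : α) (hρ : Perm.sign ρ = 1) :
    ((Fintype.card α : ℤ) - 1) * V (hat ρ * swap none (some i)) =
      (Fintype.card α : ℤ) * ∑ j ∈ Finset.univ.erase i, V (ρ * swap i j) := by
  have hV : ∀ j ∈ Finset.univ.erase i, V (ρ * swap i j) =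
      L (swap i (ρ j) * ρ * swap i j) + L (swap j (ρ i) * ρ * swap i j) +
      ∑ a ∈ (Finset.univ.erase i).erase j, L (swap a (ρ a) * ρ * swap j i) := by
    intro j hj
    unfold V
    rw [← Finset.add_sum_erase _ _ (Finset.mem_univ i), ← Finset.add_sum_erase _ _ hj, ← add_assoc]
    congr 1
    · simp [mul_assoc]
    · refine Finset.sum_congr rfl fun a ha => ?_
      simp at ha
      simp [swap_apply_of_ne_of_ne, ha, mul_assoc, swap_comm i j]
  rw [Finset.sum_congr rfl hV, Finset.sum_add_distrib, Finset.sum_add_distrib, S1 ρ i hρ, S2 ρ i hρ,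
    V_expand]
  have hE : ∑ j ∈ Finset.univ.erase i, ∑ a ∈ (Finset.univ.erase i).erase j,
      L (swap a (ρ a) * ρ * swap j i) = ∑ a ∈ Finset.univ.erase i,
      ∑ j ∈ (Finset.univ.erase i).erase a, L (swap a (ρ a) * ρ * swap j i) := by
    apply Finset.sum_comm'
    intro x y; simp; tauto
  have hF : ((Fintype.card α : ℤ) - 1) * ∑ a ∈ Finset.univ.erase i, ∑ j ∈ Finset.univ.erase i,
        L (swap a (ρ a) * ρ * swap j i) = (Fintype.card α : ℤ) * ∑ a ∈ Finset.univ.erase i,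
      ∑ j ∈ (Finset.univ.erase i).erase a, L (swap a (ρ a) * ρ * swap j i) := by
    rw [Finset.mul_sum, Finset.mul_sum]
    refine Finset.sum_congr rfl fun a ha => ?_
    rw [← Finset.add_sum_erase _ _ ha, mul_add,
      L_rec (swap a (ρ a) * ρ) a i (by simp) (Finset.mem_erase.1 ha).1.symm]
    ring
  rw [hE, mul_add, hF]
  ring

end

theorem V_odd : ∀ (n : ℕ) (α : Type) [Fintype α] [DecidableEq α] (π : Perm α),
    Fintype.card α = n + 1 → Perm.sign π = -1 → V π = 2 * (n.factorial : ℤ) := by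
  intro n
  induction n with
  | zero =>
    intro α _ _ π hc hs
    have : Subsingleton α := Fintype.card_le_one_iff_subsingleton.1 (by omega)
    rw [Subsingleton.elim π 1] at hs
    simp at hs
  | succ n ih =>
    intro α _ _ π hc hs
    obtain ⟨a, ha⟩ : ∃ a, π a ≠ a := by
      by_contra! h
      have : π = 1 := by ext x; simp [h]
      rw [this] at hs
      simp at hs
    let e := optionSubtypeNe a
    have hπ : π = e.permCongr (e.symm.permCongr π) := by ext; simp
    have hd : e.symm.permCongr π none ≠ none := by
      simp [e, ha]
    generalize e.symm.permCongr π = d at hπ hd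
    have hcard : Fintype.card { b // b ≠ a } = n + 1 := by
      have := Fintype.card_congr e
      rw [Fintype.card_option] at this; omega
    rw [hπ, Perm.sign_permCongr] at hs
    rw [hπ, V_permCongr]
    obtain ⟨⟨u, ρ⟩, rfl⟩ := Perm.decomposeOption.symm.surjective d
    rcases u with _ | k
    · simp at hd
    rw [dec_some] at hs ⊢
    obtain ⟨i, rfl⟩ := ρ.surjective k
    have hsw : swap none (some (ρ i)) * hat ρ = hat ρ * swap none (some i) := by
      rw [Equiv.mul_swap_eq_swap_mul]; simp
    rw [hsw] at hs ⊢
    have hsh : Perm.sign (hat ρ) = Perm.sign ρ := optionCongr_sign ρ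
    have hρ : Perm.sign ρ = 1 := by
      rw [Perm.sign_mul, hsh, Perm.sign_swap (by simp)] at hs
      simpa using hs
    rcases Nat.eq_zero_or_pos n with rfl | hn
    · have hsub : Subsingleton { b // b ≠ a } := Fintype.card_le_one_iff_subsingleton.1 (by omega)
      have he : (Finset.univ.erase i) = ∅ := by
        ext x; simp [Subsingleton.elim x i]
      have ho : ∀ c : Perm { b // b ≠ a }, lg c = 1 := by
        intro c
        unfold lg
        rw [if_pos]
        rw [orb_eq]
        rw [Nat.card_eq_one_iff_unique]
        refine ⟨⟨fun x y => ?_⟩, ⟨Quotient.mk _ i⟩⟩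
        obtain ⟨x, rfl⟩ := Quotient.mk_surjective x
        obtain ⟨y, rfl⟩ := Quotient.mk_surjective y
        rw [Subsingleton.elim x y]
      rw [V_expand, he, hcard]
      simp only [L, ho]
      simp [Fintype.card_subtype_compl] at hcard ⊢
    · have hst := V_step ρ i hρ
      rw [Finset.sum_congr rfl (g := fun _ => 2 * (n.factorial : ℤ))] at hst
      · rw [Finset.sum_const, Finset.card_erase_of_mem (Finset.mem_univ _), Finset.card_univ,
          hcard] at hst
        have hn' : (n : ℤ) ≠ 0 := by exact_mod_cast hn.ne'
        apply mul_left_cancel₀ hn'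
        simp at hst
        rw [hst, Nat.factorial_succ]
        push_cast; ring
      · intro j hj
        refine ih _ _ hcard ?_
        rw [Perm.sign_mul, hρ, Perm.sign_swap (Finset.mem_erase.1 hj).1.symm]
        simp

open Polynomial

noncomputable def gp (w : ℤ) : ℕ → ℤ[X]
  | 0 => 1
  | n + 1 => (X + C (w * n)) * gp w n

theorem sum_card_ind {M : Type} (F : (α : Type) → [Fintype α] → [DecidableEq α] → M)
    (g : ℕ → M)
    (he : ∀ (α β : Type) [Fintype α] [DecidableEq α] [Fintype β] [DecidableEq β] (_ : α ≃ β),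
      F α = F β)
    (h0 : F Empty = g 0)
    (hs : ∀ (α : Type) [Fintype α] [DecidableEq α], F α = g (Fintype.card α) →
      F (Option α) = g (Fintype.card α + 1)) :
    ∀ (n : ℕ) (α : Type) [Fintype α] [DecidableEq α], Fintype.card α = n → F α = g n := by
  intro n
  induction n with
  | zero =>
    intro α _ _ h
    have : IsEmpty α := Fintype.card_eq_zero_iff.1 h
    rw [he α Empty (Equiv.equivOfIsEmpty _ _), h0]
  | succ n ih =>
    intro α _ _ h
    have : Nonempty α := Fintype.card_pos_iff.1 (by omega)
    obtain ⟨a⟩ := this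
    have hcard : Fintype.card { b // b ≠ a } = n := by
      have := Fintype.card_congr (optionSubtypeNe a)
      rw [Fintype.card_option] at this; omega
    rw [← he _ _ (optionSubtypeNe a)]
    have := hs _ (by rw [hcard]; exact ih _ hcard)
    rw [this, hcard]

theorem sign_hat [Fintype α] [DecidableEq α] (ρ : Perm α) : Perm.sign (hat ρ) = Perm.sign ρ :=
  optionCongr_sign ρ

theorem sign_ins [Fintype α] [DecidableEq α] (ρ : Perm α) (i : α) :
    Perm.sign (swap none (some i) * hat ρ) = -Perm.sign ρ := by
  rw [Perm.sign_mul, sign_hat, Perm.sign_swap (by simp)]; simp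

theorem sum_perm_congr {α β M : Type} [AddCommMonoid M] [Fintype α] [DecidableEq α]
    [Fintype β] [DecidableEq β]
    (e : α ≃ β) (f : Perm β → M) : ∑ π, f π = ∑ π : Perm α, f (e.permCongr π) :=
  (Equiv.sum_comp e.permCongrHom.toEquiv f).symm

theorem gen_rise : ∀ (n : ℕ) (α : Type) [Fintype α] [DecidableEq α], Fintype.card α = n →
    ∑ π : Perm α, (X : ℤ[X]) ^ orb π = gp 1 n := by
  apply sum_card_ind (fun α _ _ => ∑ π : Perm α, (X : ℤ[X]) ^ orb π) (gp 1)
  · intro α β _ _ _ _ e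
    rw [sum_perm_congr e]
    simp only [orb_permCongr]
  · simp [gp, (orb_zero_iff (_ : Perm Empty)).2 inferInstance]
  · intro α _ _ h
    rw [sum_option]
    simp only [orb_hat, orb_ins]
    simp only [gp, ← h, Finset.mul_sum]
    refine Finset.sum_congr rfl fun π _ => ?_
    simp
    ring

theorem gen_fall : ∀ (n : ℕ) (α : Type) [Fintype α] [DecidableEq α], Fintype.card α = n →
    ∑ π : Perm α, C ((Perm.sign π : ℤˣ) : ℤ) * (X : ℤ[X]) ^ orb π = gp (-1) n := by
  apply sum_card_ind (fun α _ _ => ∑ π : Perm α, C ((Perm.sign π : ℤˣ) : ℤ) * (X : ℤ[X]) ^ orb π)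
    (gp (-1))
  · intro α β _ _ _ _ e
    rw [sum_perm_congr e]
    simp only [orb_permCongr, Perm.sign_permCongr]
  · simp [gp, (orb_zero_iff (_ : Perm Empty)).2 inferInstance]
  · intro α _ _ h
    rw [sum_option]
    simp only [orb_hat, orb_ins, sign_hat, sign_ins]
    simp only [gp, ← h, Finset.mul_sum]
    refine Finset.sum_congr rfl fun π _ => ?_
    simp
    ring

theorem lg_count : ∀ (n : ℕ) (α : Type) [Fintype α] [DecidableEq α], Fintype.card α = n →
    ∑ π : Perm α, lg π = if n = 0 then 0 else ((n - 1).factorial : ℤ) := by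
  apply sum_card_ind (fun α _ _ => ∑ π : Perm α, lg π)
    (fun n => if n = 0 then 0 else ((n - 1).factorial : ℤ))
  · intro α β _ _ _ _ e
    rw [sum_perm_congr e]
    simp only [lg, orb_permCongr]
  · simp [lg, (orb_zero_iff (_ : Perm Empty)).2 inferInstance]
  · intro α _ _ h
    rw [sum_option]
    rcases isEmpty_or_nonempty α with he | he
    · simp [lg, orb_hat, (orb_zero_iff (_ : Perm α)).2 he]
    · simp only [lg_hat, lg_ins]
      simp only [Finset.sum_const, zero_add, ← Finset.smul_sum, h]
      have : Fintype.card α ≠ 0 := Fintype.card_ne_zero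
      obtain ⟨m, hm⟩ := Nat.exists_eq_succ_of_ne_zero this
      simp [hm, Nat.factorial_succ]

noncomputable def T (α : Type) [Fintype α] [DecidableEq α] : ℤ[X] :=
  ∑ ρ : Perm α, C (L ρ) * X ^ orb ρ

theorem key [Fintype α] [DecidableEq α] [Nonempty α] (N : ℕ) (hN : Fintype.card α = N) :
    C (N.factorial : ℤ) * (gp 1 (N + 1) - gp (-1) (N + 1)) =
      C (((N + 1) * N * N : ℕ) : ℤ) * T α := by
  have hc : Fintype.card (Option α) = N + 1 := by rw [Fintype.card_option, hN]
  have e1 : ∑ π : Perm (Option α), C (1 - (Perm.sign π : ℤ)) * C (V π) * (X : ℤ[X]) ^ orb π =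
      C (2 * (N.factorial : ℤ)) * (gp 1 (N + 1) - gp (-1) (N + 1)) := by
    rw [← gen_rise _ _ hc, ← gen_fall _ _ hc, ← Finset.sum_sub_distrib, Finset.mul_sum]
    refine Finset.sum_congr rfl fun π _ => ?_
    rcases Int.units_eq_one_or (Perm.sign π) with h | h
    · simp [h]
    · rw [V_odd N _ π hc h, h]
      simp; ring
  have e2 : ∀ a : Option α, ∑ π : Perm (Option α),
      C (1 - (Perm.sign π : ℤ)) * C (L (swap a (π a) * π)) * (X : ℤ[X]) ^ orb π =
      C (2 * (N : ℤ) * N) * T α := by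
    intro a
    rw [sum_perm_congr (swap none a)]
    have : ∀ π : Perm (Option α), L (swap a ((swap none a).permCongr π a) * (swap none a).permCongr π)
        = L (swap none (π none) * π) := by
      intro π
      rw [← L_permCongr (swap none a) (swap none (π none) * π), permCongr_mul', permCongr_swap]
      simp
    simp only [this, orb_permCongr, Perm.sign_permCongr]
    rw [sum_option, T, Finset.mul_sum]
    refine Finset.sum_congr rfl fun ρ _ => ?_
    have h1 : ∀ i : α, swap none ((swap none (some i) * hat ρ) none) * (swap none (some i) * hat ρ)
        = hat ρ := by
      intro i; simp [← mul_assoc]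
    simp only [h1, orb_ins, sign_ins, sign_hat, hat_none, swap_self, Finset.sum_const,
      Finset.card_univ, hN, L_hat, orb_hat]
    have h2 : L (Equiv.refl (Option α) * hat ρ) = N * L ρ := by
      rw [show Equiv.refl (Option α) * hat ρ = hat ρ from one_mul _, L_hat, hN]
    rw [h2]
    rcases Int.units_eq_one_or (Perm.sign ρ) with h | h
    · simp [h]; ring
    · simp [L_odd ρ h]
  have e3 : ∑ π : Perm (Option α), C (1 - (Perm.sign π : ℤ)) * C (V π) * (X : ℤ[X]) ^ orb π =
      C (((N : ℤ) + 1) * (2 * (N : ℤ) * N)) * T α := by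
    simp only [V, map_sum, Finset.mul_sum, Finset.sum_mul]
    rw [Finset.sum_comm, Finset.sum_congr rfl (fun a _ => e2 a), Finset.sum_const, Finset.card_univ, hc]
    simp; ring
  have h2 : (C (2 : ℤ)) ≠ 0 := by simp
  apply mul_left_cancel₀ h2
  rw [← mul_assoc, ← mul_assoc, ← map_mul, ← map_mul, ← e1, e3]
  congr 2
  push_cast; ring

def sh (n : ℕ) : Perm (ZMod (n + 1)) := Equiv.addRight 1

theorem sh_apply (n : ℕ) (x : ZMod (n + 1)) : sh n x = x + 1 := rfl

theorem sh_pow (n k : ℕ) (x : ZMod (n + 1)) : (sh n ^ k) x = x + k := by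
  induction k with
  | zero => simp
  | succ k ih => rw [pow_succ', Perm.mul_apply, ih, sh_apply]; push_cast; ring

theorem orb_sh (n : ℕ) : orb (sh n) = 1 := by
  rw [orb_of (sh n) (fun _ => ()) (fun _ => ⟨0, rfl⟩) (fun _ => rfl)]
  · simp
  · intro x y _
    refine ⟨((y - x).val : ℕ), ?_⟩
    rw [zpow_natCast, sh_pow]
    simp

theorem pihat_zero {n : ℕ} (π : Perm (Fin n)) : pihat π 0 = 0 :=
  Perm.decomposeFin_symm_apply_zero 0 π

theorem pihat_inj {n : ℕ} : Function.Injective (pihat (n := n)) := by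
  intro a b h
  have := Perm.decomposeFin.symm.injective h
  simpa using this

def ph {n : ℕ} (π : Perm (Fin n)) : Perm (ZMod (n + 1)) := pihat π * sh n * (pihat π)⁻¹

theorem ph_inj {n : ℕ} : Function.Injective (ph (n := n)) := by
  intro a b h
  apply pihat_inj
  unfold ph at h
  have hk : (pihat b)⁻¹ * pihat a * sh n = sh n * ((pihat b)⁻¹ * pihat a) := by
    have := congrArg (fun z => (pihat b)⁻¹ * z * pihat a) h
    simpa [mul_assoc] using this
  have h0 : ((pihat b)⁻¹ * pihat a) 0 = 0 := by
    rw [Perm.mul_apply, pihat_zero, Perm.inv_eq_iff_eq, pihat_zero]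
  generalize hkk : (pihat b)⁻¹ * pihat a = k at hk h0
  have hn : ∀ m : ℕ, k (m : ZMod (n + 1)) = m := by
    intro m
    induction m with
    | zero => simpa using h0
    | succ m ih =>
      have := congrArg (fun f => f (m : ZMod (n + 1))) hk
      simp only [Perm.mul_apply, sh_apply, ih] at this
      push_cast
      exact this
  have : k = 1 := by
    ext1 x
    have := hn x.val
    simpa using this
  rw [this] at hkk
  exact (inv_mul_eq_one.1 hkk).symm

theorem orb_ph {n : ℕ} (π : Perm (Fin n)) : orb (ph π) = 1 := by
  rw [ph, orb_conj, orb_sh]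

theorem sum_long {n : ℕ} (f : Perm (ZMod (n + 1)) → ℤ[X]) :
    ∑ c, C (lg c) * f c = ∑ π : Perm (Fin n), f (ph π) := by
  classical
  have himg : Finset.univ.image (ph (n := n)) = Finset.univ.filter (fun c => orb c = 1) := by
    apply Finset.eq_of_subset_of_card_le
    · intro c hc
      obtain ⟨π, -, rfl⟩ := Finset.mem_image.1 hc
      simp [orb_ph]
    · rw [Finset.card_image_of_injective _ ph_inj, Finset.card_univ, Fintype.card_perm,
        Fintype.card_fin]
      have := lg_count (n + 1) (ZMod (n + 1)) (ZMod.card (n + 1))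
      simp [lg] at this
      exact_mod_cast this.le
  have : ∑ c, C (lg c) * f c = ∑ c ∈ Finset.univ.filter (fun c => orb c = 1), f c := by
    rw [Finset.sum_filter]
    refine Finset.sum_congr rfl fun c _ => ?_
    unfold lg
    split_ifs <;> simp
  rw [this, ← himg, Finset.sum_image (fun a _ b _ h => ph_inj h)]

noncomputable def P (n : ℕ) : ℤ[X] := ∑ π : Perm (Fin n), X ^ A n π

theorem A_eq {n : ℕ} (π : Perm (Fin n)) : A n π = orb ((ph π)⁻¹ * sh n) := by
  change orb (cpi π) = _
  congr 1
  ext1 x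
  simp [cpi, ph, sh]
  exact sub_eq_add_neg _ _

theorem T_eq (n : ℕ) : T (ZMod (n + 1)) = C (n.factorial : ℤ) * P n := by
  have h1 : T (ZMod (n + 1)) = ∑ d : Perm (ZMod (n + 1)), C (lg d) *
      ∑ c : Perm (ZMod (n + 1)), C (lg c) * X ^ orb (c⁻¹ * d) := by
    simp only [T, L, map_sum, Finset.sum_mul, Finset.mul_sum]
    rw [Finset.sum_comm]
    rw [Finset.sum_comm (s := Finset.univ) (t := Finset.univ) (f := fun d c =>
      C (lg d) * (C (lg c) * (X : ℤ[X]) ^ orb (c⁻¹ * d)))]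
    refine Finset.sum_congr rfl fun c _ => ?_
    rw [← Equiv.sum_comp (Equiv.mulLeft c⁻¹)]
    refine Finset.sum_congr rfl fun d _ => ?_
    simp; ring
  rw [h1, sum_long]
  have h2 : ∀ σ : Perm (Fin n), ∑ c : Perm (ZMod (n + 1)), C (lg c) * (X : ℤ[X]) ^ orb (c⁻¹ * ph σ)
      = P n := by
    intro σ
    rw [sum_perm_congr (pihat σ)]
    have : ∀ c, orb (((pihat σ).permCongr c)⁻¹ * ph σ) = orb (c⁻¹ * sh n) := by
      intro c
      have : ((pihat σ).permCongr c) = pihat σ * c * (pihat σ)⁻¹ := rfl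
      rw [this, ← orb_conj (pihat σ) (c⁻¹ * sh n), ph]
      congr 1; group
    simp only [this, lg, orb_permCongr]
    have := sum_long (n := n) (fun c => X ^ orb (c⁻¹ * sh n))
    simp only [lg] at this
    rw [this, P]
    simp only [A_eq]
  simp only [h2]
  simp [Fintype.card_perm]

theorem P_eq (n : ℕ) : C (((n : ℤ) + 1) * (n + 2)) * P n = gp 1 (n + 2) - gp (-1) (n + 2) := by
  have h := key (α := ZMod (n + 1)) (n + 1) (ZMod.card _)
  rw [T_eq] at h
  have h2 : (C ((n + 1).factorial : ℤ)) ≠ 0 := by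
    simp only [ne_eq, C_eq_zero]
    exact_mod_cast Nat.factorial_ne_zero _
  apply mul_left_cancel₀ h2
  rw [h, ← mul_assoc, ← mul_assoc, ← map_mul, ← map_mul, Nat.factorial_succ]
  congr 2
  push_cast; ring

theorem P_rec (m : ℕ) : C ((m : ℤ) + 4) * P (m + 2) + C ((m : ℤ) + 1) * (X ^ 2 * P m) =
    C (2 * (m : ℤ) + 5) * (X * P (m + 1)) + C (((m : ℤ) + 2) ^ 2 * (m + 1)) * P m := by
  have h0 := P_eq m
  have h1 := P_eq (m + 1)
  have h2 := P_eq (m + 2)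
  simp only [gp] at h0 h1 h2
  have h3 : (C (((m : ℤ) + 2) * (m + 3))) ≠ 0 := by
    simp only [ne_eq, C_eq_zero]
    positivity
  apply mul_left_cancel₀ h3
  simp only [map_mul, map_add, map_pow, map_neg, map_natCast, map_ofNat, map_one] at h0 h1 h2 ⊢
  push_cast at h0 h1 h2
  linear_combination ((m : ℤ[X]) + 2) * h2 + (((m : ℤ[X]) + 3) * X ^ 2 - (m + 2) ^ 2 * (m + 3)) * h0
    - (2 * (m : ℤ[X]) + 5) * X * h1

theorem P_coeff (n k : ℕ) : (P n).coeff k = (H n k : ℤ) := by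
  classical
  unfold P H
  rw [finsetSum_coeff]
  simp only [coeff_X_pow]
  rw [Nat.card_eq_fintype_card, Fintype.card_subtype]
  simp [eq_comm]

theorem H_zero (n : ℕ) : H n 0 = 0 := by
  unfold H
  rw [Finite.card_eq_zero_iff]
  refine ⟨fun π => ?_⟩
  have h := π.2
  rw [A_eq, orb_zero_iff] at h
  exact h.1 (0 : ZMod (n + 1))

theorem H_big (n k : ℕ) (hk : n + 1 < k) : H n k = 0 := by
  unfold H
  rw [Finite.card_eq_zero_iff]
  refine ⟨fun π => ?_⟩
  have h := π.2
  rw [A_eq, orb_eq] at h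
  have := Nat.card_le_card_of_surjective _
    (Quotient.mk_surjective (s := Perm.SameCycle.setoid ((ph π.1)⁻¹ * sh n)))
  rw [h, Nat.card_zmod] at this
  omega

theorem H_rec (m k : ℕ) : (m + 4) * H (m + 2) k + (m + 1) * (if k < 2 then 0 else H m (k - 2)) =
    (2 * m + 5) * H (m + 1) (k - 1) + (m + 2) ^ 2 * (m + 1) * H m k := by
  rcases k with _ | k
  · simp [H_zero]
  have h := congrArg (fun p => p.coeff (k + 1)) (P_rec m)
  simp only [coeff_add, coeff_C_mul, coeff_X_mul, P_coeff] at h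
  rcases k with _ | k
  · rw [pow_two, mul_assoc, coeff_X_mul, coeff_X_mul_zero] at h
    simp
    simp at h
    exact_mod_cast h
  · rw [pow_two, mul_assoc, coeff_X_mul, coeff_X_mul, P_coeff] at h
    simp
    exact_mod_cast h

end Hult

/-- The recursion
`(n+2) h_g(n) = (2n+1) h_g(n-1) - (n-1) h_g(n-2) + n²(n-1) h_{g-1}(n-2)`
for the Hultman numbers `h_g(n) = H(n, n+1-2g)`, written with all terms nonnegative
(the case `g = 0` having no `h_{g-1}` term). -/
theorem hultman_recursion (n : ℕ) (hn : 2 ≤ n) :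
    (∀ g : ℕ, 1 ≤ g →
      (n + 2) * h g n + (n - 1) * h g (n - 2) =
        (2 * n + 1) * h g (n - 1) + n ^ 2 * (n - 1) * h (g - 1) (n - 2)) ∧
    ((n + 2) * h 0 n + (n - 1) * h 0 (n - 2) = (2 * n + 1) * h 0 (n - 1)) := by
  obtain ⟨m, rfl⟩ := Nat.exists_eq_add_of_le' hn
  have e1 : m + 2 - 1 = m + 1 := by omega
  have e2 : m + 2 - 2 = m := by omega
  constructor
  · intro g hg
    have hr := Hult.H_rec m (m + 2 + 1 - 2 * g)
    unfold h
    rw [e1, e2]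
    have i1 : m + 1 + 1 - 2 * g = m + 2 + 1 - 2 * g - 1 := by omega
    have i2 : m + 1 - 2 * (g - 1) = m + 2 + 1 - 2 * g := by omega
    have i3 : H m (m + 1 - 2 * g) =
        if m + 2 + 1 - 2 * g < 2 then 0 else H m (m + 2 + 1 - 2 * g - 2) := by
      split_ifs with hk
      · rw [show m + 1 - 2 * g = 0 by omega, Hult.H_zero]
      · congr 1
        omega
    rw [i1, i2, i3]
    linarith
  · have hr := Hult.H_rec m (m + 2 + 1)
    unfold h
    rw [e1, e2]
    rw [Hult.H_big m (m + 2 + 1) (by omega), if_neg (by omega)] at hr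
    simp only [mul_zero, add_zero, Nat.sub_zero] at hr ⊢
    rw [show m + 2 + 1 - 2 = m + 1 by omega, show m + 2 + 1 - 1 = m + 1 + 1 by omega] at hr
    linarith
end
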